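/- Let p ∈ {2,3,5,7}, q = p−1, r = 48/(q(p+1)), m = 24/(p+1), N = √p (A_q^r, G). The lattice L obtained by rescaling N' ⊕ II_{1,1} by p is an even lattice of genus II_{2m+1,1}(p^{+m}); this genus contains a single class, and L is isomorphic to Λ_p ⊕ II_{1,1}, the orthogonal sum of the fixpoint lattice Λ_p with the even unimodular Lorentzian lattice of rank 2. -/

import Mathlib

/-!
STATEMENT 14.
Let p ∈ {2,3,5,7}, q = p−1, r = 48/(q(p+1)), m = 24/(p+1), N = √p (A_q^r, G).  The
lattice L obtained by rescaling N' ⊕ II_{1,1} by p is an even lattice of genus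
II_{2m+1,1}(p^{+m}); this genus contains a single class, and L is isomorphic to
Λ_p ⊕ II_{1,1}, the orthogonal sum of the fixpoint lattice Λ_p with the even unimodular
Lorentzian lattice of rank 2.

Formalization notes.  N' ⊕ II_{1,1} rescaled by p is isomorphic (via y = p·x on the
first summand) to the set of triples (y, a, b) with y in the glue lattice
(A_q^r, G^⊥) ⊆ (ℚ^p)^r and a, b ∈ ℤ, equipped with the bilinear form
⟨(y,a,b),(y',a',b')⟩ = ⟨y,y'⟩ + p(ab' + a'b); this is the model `MemLvec`/`blL` used
below.  Membership in the genus II_{2m+1,1}(p^{+m}) is encoded by its complete list of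
defining invariants: even, signature (2m+1,1), determinant −p^m, level p (the sign +
being determined by these data via the Milgram formula).  "Single class in the genus"
is stated for arbitrary Gram matrices with these invariants, and "L ≅ Λ_p ⊕ II_{1,1}"
is stated by exhibiting a ℤ-basis of L whose Gram matrix is A ⊕ (0 1; 1 0), where A is
a Gram matrix of the fixpoint lattice Λ_p of an automorphism of cycle shape 1^m p^m of
the Leech lattice (the Leech lattice and the automorphism being modeled as in the
statement-10 file).
-/

open scoped BigOperators Classical
open Matrix

/-- `t ∈ ℤ ⊆ ℚ`. -/
def isInt (t : ℚ) : Prop := ∃ z : ℤ, (z : ℚ) = t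

/-- Membership in the dual `A_q' = A_{p-1}'` of the root lattice `A_{p-1}`, in the
standard model: `A_{p-1}' = {x ∈ ℚ^p | ∑ x_k = 0, x_k − x_l ∈ ℤ, p·x_k ∈ ℤ}`. -/
def MemAqDual (p : ℕ) (x : Fin p → ℚ) : Prop :=
  (∑ k, x k) = 0 ∧ (∀ k l, isInt (x k - x l)) ∧ (∀ k, isInt ((p : ℚ) * x k))

/-- The class of `x ∈ A_{p-1}'` in the discriminant group `A_{p-1}'/A_{p-1} ≅ ℤ/pℤ`
(the class of the fundamental weight `Λ̄_i` being `i`); it is computed as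
`−p·x_0 mod p`.  (Junk value if `x ∉ A_{p-1}'`.) -/
noncomputable def clsOf (p : ℕ) [NeZero p] (x : Fin p → ℚ) : ZMod p :=
  (((-((p : ℚ) * x 0)).num : ℤ) : ZMod p)

/-- The glue code `G ⊆ 𝔽_p^r` from the appendix: the (extended) binary Hamming code of
length 16 for `p = 2` (cut out by the overall parity check and the four parity checks
given by the binary digits of the coordinate positions), the ternary zero-sum code of
length 6 for `p = 3`, and all of `𝔽_5^2` resp. `𝔽_7` for `p = 5, 7`. -/
noncomputable def glueCode (p r : ℕ) [NeZero p] : Finset (Fin r → ZMod p) :=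
  Finset.univ.filter (fun x =>
    if p = 2 then
      ((∑ i, x i = 0) ∧ ∀ j : Fin 4, (∑ i, if Nat.testBit i.1 j.1 then x i else 0) = 0)
    else if p = 3 then (∑ i, x i = 0) else True)

/-- Vectors of the ambient rational space `(ℚ^p)^r` containing `A_{p-1}^r` and its
glue lattices. -/
abbrev GVec (p r : ℕ) := Fin r → Fin p → ℚ

/-- Membership in the glue lattice `(A_q^r, G)`: each component lies in `A_q'` and the
vector of classes lies in the glue code `G`.  The lattice `N = √p (A_q^r, G)` is this
set of vectors equipped with the rescaled quadratic form `x ↦ p·|x|²/2`. -/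
def MemGlue (p r : ℕ) [NeZero p] (x : GVec p r) : Prop :=
  (∀ i, MemAqDual p (x i)) ∧ (fun i => clsOf p (x i)) ∈ glueCode p r

/-- The bilinear form of `N = √p (A_q^r, G)`: `p` times the standard scalar product. -/
def blN (p r : ℕ) (x y : GVec p r) : ℚ := (p : ℚ) * ∑ i, ∑ k, x i k * y i k

/-- The norm `x² = p·|x|²` of `N = √p (A_q^r, G)`. -/
def nrmN (p r : ℕ) (x : GVec p r) : ℚ := (p : ℚ) * ∑ i, ∑ k, (x i k) ^ 2

/-- Membership in the dual lattice `N'` of `N`. -/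
def MemNdual (p r : ℕ) [NeZero p] (y : GVec p r) : Prop :=
  (∀ i, (∑ k, y i k) = 0 ∧ ∀ k l, isInt (y i k - y i l)) ∧
    ∀ x, MemGlue p r x → isInt (blN p r y x)

open Polynomial

/-- Membership in the glue lattice `(A_q^r, G^⊥)`: each component lies in `A_q'` and
the vector of classes is orthogonal to the glue code `G`. -/
def MemGluePerp (p r : ℕ) [NeZero p] (x : GVec p r) : Prop :=
  (∀ i, MemAqDual p (x i)) ∧ ∀ g ∈ glueCode p r, (∑ i, clsOf p (x i) * g i) = 0

/-- The underlying set of the lattice `L` = (N' ⊕ II_{1,1}) rescaled by `p`, in the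
model `{(y,a,b) | y ∈ (A_q^r,G^⊥), a, b ∈ ℤ}`. -/
def MemLvec (p r : ℕ) [NeZero p] (v : GVec p r × ℤ × ℤ) : Prop :=
  MemGluePerp p r v.1

/-- The bilinear form of `L` = (N' ⊕ II_{1,1}) rescaled by `p`, in the above model:
`⟨(y,a,b),(y',a',b')⟩ = ⟨y,y'⟩ + p(ab' + a'b)`. -/
def blL (p r : ℕ) (v w : GVec p r × ℤ × ℤ) : ℚ :=
  (∑ i, ∑ k, v.1 i k * w.1 i k) + (p : ℚ) * (v.2.1 * w.2.2 + v.2.2 * w.2.1)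

/-- Signature `(2m+1, 1)` of an integral symmetric matrix of size `2m+2`. -/
def HasLorentzSignature (m : ℕ) (B : Matrix (Fin (2 * m + 2)) (Fin (2 * m + 2)) ℤ) :
    Prop :=
  ∃ P : Matrix (Fin (2 * m + 2)) (Fin (2 * m + 2)) ℝ, IsUnit P.det ∧
    Pᵀ * (B.map (Int.cast : ℤ → ℝ)) * P
      = Matrix.diagonal (fun i : Fin (2 * m + 2) => if (i : ℕ) < 2 * m + 1 then (1 : ℝ) else -1)

/-- The invariants characterizing the genus `II_{2m+1,1}(p^{+m})`: even, signature
`(2m+1,1)`, determinant `−p^m`, level `p`. -/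
def InGenusIIpm (p m : ℕ) (B : Matrix (Fin (2 * m + 2)) (Fin (2 * m + 2)) ℤ) : Prop :=
  B.IsSymm ∧ (∀ i, 2 ∣ B i i) ∧ HasLorentzSignature m B ∧ B.det = -(p : ℤ) ^ m ∧
    ∃ C : Matrix (Fin (2 * m + 2)) (Fin (2 * m + 2)) ℤ,
      B * C = (p : ℤ) • 1 ∧ ∀ i, 2 ∣ C i i

/-- An integral lattice: a free `ℤ`-module of finite rank with a symmetric bilinear form. -/
structure ILat where
  carrier : Type
  [grp : AddCommGroup carrier]
  [free : Module.Free ℤ carrier]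
  [fin : Module.Finite ℤ carrier]
  form : carrier →ₗ[ℤ] carrier →ₗ[ℤ] ℤ
  symm : ∀ x y, form x y = form y x

namespace ILat

instance : CoeSort ILat Type := ⟨ILat.carrier⟩

attribute [instance] ILat.grp ILat.free ILat.fin

/-- Orthogonal sum. -/
abbrev prod (L M : ILat) : ILat where
  carrier := L × M
  form := LinearMap.mk₂ ℤ (fun x y => L.form x.1 y.1 + M.form x.2 y.2)
    (by intros; simp; ring) (by intros; simp; ring) (by intros; simp; ring) (by intros; simp; ring)
  symm x y := by simp [L.symm x.1, M.symm x.2]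

theorem prod_form (L M : ILat) (x y : L × M) :
    (L.prod M).form x y = L.form x.1 y.1 + M.form x.2 y.2 := rfl

/-- The sublattice carried by a submodule. -/
abbrev res (L : ILat) (S : Submodule ℤ L) : ILat where
  carrier := S
  form := LinearMap.mk₂ ℤ (fun x y => L.form x y)
    (by intros; simp) (by intros; simp) (by intros; simp) (by intros; simp)
  symm x y := L.symm x y

theorem res_form (L : ILat) (S : Submodule ℤ L) (x y : S) :
    (L.res S).form x y = L.form x y := rfl

/-- Division of the form by an integer dividing all its values. -/
abbrev down (L : ILat) (c : ℤ) (h : ∀ x y, c ∣ L.form x y) : ILat where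
  carrier := L
  form := LinearMap.mk₂ ℤ (fun x y => L.form x y / c)
    (by intro x y z; simp [Int.add_ediv_of_dvd_left (h x z)])
    (by intro k x y; simp [Int.mul_ediv_assoc _ (h x y)])
    (by intro x y z; simp [Int.add_ediv_of_dvd_left (h x y)])
    (by intro k x y; simp [Int.mul_ediv_assoc _ (h x y)])
  symm x y := by simp [L.symm x y]

theorem down_form (L : ILat) {c : ℤ} (h : ∀ x y, c ∣ L.form x y) (x y : L) :
    c * (L.down c h).form x y = L.form x y := Int.mul_ediv_cancel' (h x y)

/-- The rank one lattice `⟨c⟩`. -/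
abbrev rk1 (c : ℤ) : ILat where
  carrier := ℤ
  form := LinearMap.mk₂ ℤ (fun x y => c * x * y)
    (by intros; ring) (by intros; simp; ring) (by intros; ring) (by intros; simp; ring)
  symm x y := by simp; ring

theorem rk1_form (c : ℤ) (x y : ℤ) : (rk1 c).form x y = c * x * y := rfl

/-- The hyperbolic plane. -/
abbrev hyp : ILat where
  carrier := ℤ × ℤ
  form := LinearMap.mk₂ ℤ (fun x y => x.1 * y.2 + x.2 * y.1)
    (by intros; simp; ring) (by intros; simp; ring) (by intros; simp; ring) (by intros; simp; ring)
  symm x y := by simp; ring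

theorem hyp_form (x y : ℤ × ℤ) : hyp.form x y = x.1 * y.2 + x.2 * y.1 := rfl

/-- The lattice with a given Gram matrix. -/
abbrev ofMatrix {n : ℕ} (G : Matrix (Fin n) (Fin n) ℤ) (hG : G.IsSymm) : ILat where
  carrier := Fin n → ℤ
  form := LinearMap.mk₂ ℤ (fun x y => x ⬝ᵥ G *ᵥ y)
    (by intros; simp [add_dotProduct]) (by intro c x y; exact smul_dotProduct c x _)
    (by intros; simp [mulVec_add]) (by intro c x y; change x ⬝ᵥ G *ᵥ (c • y) = _; rw [mulVec_smul, dotProduct_smul])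
  symm x y := by
    rw [LinearMap.mk₂_apply, LinearMap.mk₂_apply, Matrix.dotProduct_mulVec,
      ← Matrix.mulVec_transpose, hG, dotProduct_comm]

theorem ofMatrix_form {n : ℕ} (G : Matrix (Fin n) (Fin n) ℤ) (hG : G.IsSymm) (x y : Fin n → ℤ) :
    (ofMatrix G hG).form x y = x ⬝ᵥ G *ᵥ y := rfl

/-- Isometry of lattices. -/
def Isom (L M : ILat) : Prop := ∃ e : L ≃ₗ[ℤ] M, ∀ x y, M.form (e x) (e y) = L.form x y

theorem Isom.refl (L : ILat) : Isom L L := ⟨LinearEquiv.refl _ _, fun _ _ => rfl⟩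

theorem Isom.symm {L M : ILat} : Isom L M → Isom M L := fun ⟨e, he⟩ =>
  ⟨e.symm, fun x y => by rw [← he]; simp⟩

theorem Isom.trans {L M N : ILat} : Isom L M → Isom M N → Isom L N := fun ⟨e, he⟩ ⟨f, hf⟩ =>
  ⟨e.trans f, fun x y => by simp [hf, he]⟩

theorem Isom.prod {L M L' M' : ILat} : Isom L M → Isom L' M' → Isom (L.prod L') (M.prod M') :=
  fun ⟨e, he⟩ ⟨f, hf⟩ => 
    ⟨(AddEquiv.prodCongr e.toAddEquiv f.toAddEquiv).toIntLinearEquiv, fun x y => by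
    rw [prod_form, prod_form, ← he, ← hf]; rfl⟩

theorem prod_comm (L M : ILat) : Isom (L.prod M) (M.prod L) :=
  ⟨(AddEquiv.prodComm (M := L) (N := M)).toIntLinearEquiv, fun x y => by rw [prod_form, prod_form, add_comm]; rfl⟩

theorem prod_assoc (L M N : ILat) : Isom ((L.prod M).prod N) (L.prod (M.prod N)) :=
  ⟨(AddEquiv.prodAssoc (M := L) (N := M) (P := N)).toIntLinearEquiv, fun x y => by
    rw [prod_form, prod_form, prod_form, prod_form, add_assoc]; rfl⟩

theorem prod_left_comm (L M N : ILat) : Isom (L.prod (M.prod N)) (M.prod (L.prod N)) :=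
  (prod_assoc L M N).symm.trans (((prod_comm L M).prod (Isom.refl N)).trans (prod_assoc M L N))

/-- Gram matrix of a family of vectors. -/
def gram (L : ILat) {ι : Type*} (b : ι → L) : Matrix ι ι ℤ := Matrix.of fun i j => L.form (b i) (b j)

/-- The rank. -/
noncomputable def rk (L : ILat) : ℕ := Module.finrank ℤ L

/-- The absolute value of the determinant. -/
noncomputable def d (L : ILat) : ℕ := (L.gram (Module.Free.chooseBasis ℤ L)).det.natAbs

theorem gram_toMatrix (L : ILat) {ι κ : Type*} [Fintype ι] (b : Module.Basis ι ℤ L) (c : κ → L) :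
    L.gram c = (b.toMatrix c)ᵀ * L.gram b * b.toMatrix c := by
  ext i j
  have h : ∀ i, c i = ∑ k, b.toMatrix c k i • b k := fun i => by
    simp [Module.Basis.toMatrix_apply, b.sum_repr]
  simp only [gram, of_apply, Matrix.mul_apply, transpose_apply, Finset.sum_mul]
  rw [h i, h j]
  simp only [map_sum, LinearMap.sum_apply, map_smul, LinearMap.smul_apply, smul_eq_mul,
    Finset.mul_sum]
  refine Finset.sum_congr rfl fun k _ => Finset.sum_congr rfl fun l _ => ?_
  ring

theorem d_eq (L : ILat) {ι : Type*} [Fintype ι] [DecidableEq ι] (b : Module.Basis ι ℤ L) :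
    L.d = (L.gram b).det.natAbs := by
  let b0 := Module.Free.chooseBasis ℤ L
  let e := b.indexEquiv b0
  let c := b.reindex e
  have h1 : (L.gram c).det = (L.gram b).det := by
    have : L.gram c = (L.gram b).submatrix e.symm e.symm := by
      ext i j; simp [gram, c]
    rw [this, Matrix.det_submatrix_equiv_self]
  have h2 := L.gram_toMatrix b0 c
  have h3 : (b0.toMatrix c).det.natAbs = 1 := by
    have : b0.toMatrix c * c.toMatrix b0 = 1 := by simp
    have := congrArg Matrix.det this
    rw [det_mul, det_one] at this
    exact Int.isUnit_iff_natAbs_eq.mp (IsUnit.of_mul_eq_one _ this)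
  rw [← h1, h2, det_mul, det_mul, det_transpose, Int.natAbs_mul, Int.natAbs_mul, h3]
  simp [d, b0]

theorem Isom.rk {L M : ILat} (h : Isom L M) : L.rk = M.rk := by
  obtain ⟨e, _⟩ := h
  exact e.finrank_eq

theorem Isom.d {L M : ILat} (h : Isom L M) : L.d = M.d := by
  obtain ⟨e, he⟩ := h
  let b := Module.Free.chooseBasis ℤ L
  rw [L.d_eq b, M.d_eq (b.map e)]
  congr 2
  ext i j
  simp [gram, he]

theorem rk_prod (L M : ILat) : (L.prod M).rk = L.rk + M.rk :=
  Module.finrank_prod (R := ℤ) (M := L) (M' := M)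

theorem d_prod (L M : ILat) : (L.prod M).d = L.d * M.d := by
  let b := Module.Free.chooseBasis ℤ L
  let c := Module.Free.chooseBasis ℤ M
  rw [L.d_eq b, M.d_eq c, (L.prod M).d_eq (b.prod c), ← Int.natAbs_mul]
  have : (L.prod M).gram (b.prod c) = Matrix.fromBlocks (L.gram b) 0 0 (M.gram c) := by
    ext i j
    rcases i with i | i <;> rcases j with j | j <;> simp [gram, b, c]
  rw [this, Matrix.det_fromBlocks_zero₂₁]

theorem rk_rk1 (c : ℤ) : (rk1 c).rk = 1 := Module.finrank_self ℤ

theorem d_rk1 (c : ℤ) : (rk1 c).d = c.natAbs := by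
  rw [(rk1 c).d_eq (Module.Basis.singleton Unit ℤ)]
  simp [gram]

theorem rk_hyp : hyp.rk = 2 := by
  change Module.finrank ℤ (ℤ × ℤ) = 2
  rw [Module.finrank_prod, Module.finrank_self]

theorem d_hyp : hyp.d = 1 := by
  rw [hyp.d_eq (Module.Basis.finTwoProd ℤ), Matrix.det_fin_two]
  simp [gram]

theorem rk_down (L : ILat) {c : ℤ} (h : ∀ x y, c ∣ L.form x y) : (L.down c h).rk = L.rk := rfl

theorem d_down (L : ILat) {c : ℤ} (h : ∀ x y, c ∣ L.form x y) :
    c.natAbs ^ L.rk * (L.down c h).d = L.d := by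
  let b := Module.finBasis ℤ L
  rw [L.d_eq b, (L.down c h).d_eq (show Module.Basis _ ℤ (L.down c h) from b), ← Int.natAbs_pow,
    ← Int.natAbs_mul]
  congr 1
  have : L.gram b = c • (L.down c h).gram b := by
    ext i j
    exact (L.down_form h _ _).symm
  rw [this, Matrix.det_smul]
  simp [rk]

theorem rk_ofMatrix {n : ℕ} (G : Matrix (Fin n) (Fin n) ℤ) (hG : G.IsSymm) :
    (ofMatrix G hG).rk = n := by
  have := Module.finrank_fin_fun ℤ (n := n)
  exact this

theorem gram_ofMatrix {n : ℕ} (G : Matrix (Fin n) (Fin n) ℤ) (hG : G.IsSymm) :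
    (ofMatrix G hG).gram (Pi.basisFun ℤ (Fin n)) = G := by
  ext i j
  simp only [gram, Matrix.of_apply]
  erw [ofMatrix_form]
  simp

theorem d_ofMatrix {n : ℕ} (G : Matrix (Fin n) (Fin n) ℤ) (hG : G.IsSymm) :
    (ofMatrix G hG).d = G.det.natAbs := by
  rw [(ofMatrix G hG).d_eq (Pi.basisFun ℤ (Fin n)), gram_ofMatrix]

theorem rk_res (L : ILat) (S : Submodule ℤ L) {k : ℤ} (hk : k ≠ 0) (h : ∀ x, k • x ∈ S) :
    (L.res S).rk = L.rk := by
  apply le_antisymm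
  · exact Submodule.finrank_le S
  · let f : L →ₗ[ℤ] S := LinearMap.codRestrict S (k • LinearMap.id) h
    refine LinearMap.finrank_le_finrank_of_injective (f := f) ?_
    intro x y hxy
    have : k • x = k • y := congrArg Subtype.val hxy
    exact smul_right_injective _ hk this

theorem d_res (L : ILat) (S : Submodule ℤ L) (h : (L.res S).rk = L.rk) :
    (L.res S).d = L.d * Nat.card (L ⧸ S) ^ 2 := by
  let b := Module.finBasisOfFinrankEq ℤ L h.symm
  let c : Module.Basis (Fin (L.res S).rk) ℤ S := Module.finBasis ℤ S
  rw [L.d_eq b, (L.res S).d_eq (show Module.Basis _ ℤ (L.res S) from c),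
    ← Submodule.natAbs_det_basis_change b S c]
  have h1 : (L.res S).gram c = L.gram (Subtype.val ∘ c) := rfl
  have h2 := L.gram_toMatrix b (Subtype.val ∘ c)
  rw [h1, h2, det_mul, det_mul, det_transpose, Int.natAbs_mul, Int.natAbs_mul,
    Module.Basis.det_apply]
  ring

/-! ### Predicates -/

def IsEven (L : ILat) : Prop := ∀ x, 2 ∣ L.form x x

def Pos (L : ILat) : Prop := ∀ x, x ≠ 0 → 0 < L.form x x

def Lor (L : ILat) : Prop := ∃ v, L.form v v < 0 ∧ ∀ x, x ≠ 0 → L.form x v = 0 → 0 < L.form x x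

/-- `p L' ⊆ L`, where `L'` is the dual lattice. -/
def Elem (p : ℤ) (L : ILat) : Prop := ∀ φ : L →ₗ[ℤ] ℤ, ∃ x, ∀ y, L.form x y = p * φ y

/-- `pL' ∩ L`. -/
def R (L : ILat) (p : ℤ) : Submodule ℤ L where
  carrier := {x | ∀ y, p ∣ L.form x y}
  add_mem' := fun ha hb y => by simpa using dvd_add (ha y) (hb y)
  zero_mem' := fun y => by simp
  smul_mem' := fun c x hx y => by simpa using (hx y).mul_left c

theorem mem_R {L : ILat} {p : ℤ} {x : L} : x ∈ L.R p ↔ ∀ y, p ∣ L.form x y := Iff.rfl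

def E2 (p : ℤ) (L : ILat) : Prop := ∀ x ∈ L.R p, 2 * p ∣ L.form x x

def Nondeg (L : ILat) : Prop := ∀ x, (∀ y, L.form x y = 0) → x = 0

theorem Pos.nondeg {L : ILat} (h : L.Pos) : L.Nondeg := fun x hx => by
  by_contra hne
  exact (h x hne).ne' (hx x)

theorem eq_zero_of_forall_dual {L : ILat} {x : L} (h : ∀ φ : L →ₗ[ℤ] ℤ, φ x = 0) : x = 0 :=
  (Module.forall_dual_apply_eq_zero_iff ℤ x).mp h

theorem Elem.nondeg {L : ILat} {p : ℤ} (hp : p ≠ 0) (h : L.Elem p) : L.Nondeg := fun x hx => by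
  refine eq_zero_of_forall_dual fun φ => ?_
  obtain ⟨z, hz⟩ := h φ
  have := hz x
  rw [L.symm, hx] at this
  exact (mul_eq_zero.mp this.symm).resolve_left hp

theorem Isom.isEven {L M : ILat} (h : Isom L M) (hL : L.IsEven) : M.IsEven := by
  obtain ⟨e, he⟩ := h.symm
  intro x; rw [← he]; exact hL _

theorem Isom.pos {L M : ILat} (h : Isom L M) (hL : L.Pos) : M.Pos := by
  obtain ⟨e, he⟩ := h.symm
  intro x hx; rw [← he]; exact hL _ (by simpa using hx)

theorem Isom.lor {L M : ILat} (h : Isom L M) (hL : L.Lor) : M.Lor := by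
  obtain ⟨e, he⟩ := h
  obtain ⟨v, hv, hv'⟩ := hL
  refine ⟨e v, by rwa [he], fun x hx hxv => ?_⟩
  obtain ⟨y, rfl⟩ := e.surjective x
  rw [he] at hxv ⊢
  exact hv' y (by simpa using hx) hxv

theorem Isom.elem {L M : ILat} {p : ℤ} (h : Isom L M) (hL : L.Elem p) : M.Elem p := by
  obtain ⟨e, he⟩ := h
  intro φ
  obtain ⟨x, hx⟩ := hL (φ ∘ₗ e.toLinearMap)
  refine ⟨e x, fun y => ?_⟩
  obtain ⟨z, rfl⟩ := e.surjective y
  rw [he, hx]; rfl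

theorem Isom.mem_R {L M : ILat} {p : ℤ} {e : L ≃ₗ[ℤ] M} (he : ∀ x y, M.form (e x) (e y) = L.form x y)
    {x : L} : e x ∈ M.R p ↔ x ∈ L.R p := by
  constructor
  · intro h y
    rw [← he]; exact h _
  · intro h y
    obtain ⟨z, rfl⟩ := e.surjective y
    rw [he]; exact h _

theorem Isom.e2 {L M : ILat} {p : ℤ} (h : Isom L M) (hL : L.E2 p) : M.E2 p := by
  obtain ⟨e, he⟩ := h
  intro x hx
  obtain ⟨y, rfl⟩ := e.surjective x
  rw [he]
  exact hL y ((Isom.mem_R he).mp hx)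

theorem E2_of_odd {L : ILat} {p : ℤ} (hp : ¬ 2 ∣ p) (hL : L.IsEven) : L.E2 p := fun x hx =>
  IsCoprime.mul_dvd ((Int.prime_two.coprime_iff_not_dvd).mpr hp) (hL x) (hx x)

/-- The form takes the value `1` on a suitable linear functional of a primitive vector. -/
theorem exists_primitive {L : ILat} {e : L} (he : e ≠ 0) :
    ∃ (k : ℤ) (e0 : L) (φ : L →ₗ[ℤ] ℤ), e = k • e0 ∧ φ e0 = 1 := by
  let ev : (L →ₗ[ℤ] ℤ) →ₗ[ℤ] ℤ := LinearMap.applyₗ e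
  obtain ⟨k, hk⟩ := (IsPrincipalIdealRing.principal (LinearMap.range ev)).principal
  have hmem : k ∈ LinearMap.range ev := by rw [hk]; exact Submodule.mem_span_singleton_self k
  obtain ⟨φ, hφ⟩ := hmem
  have hdiv : ∀ ψ : L →ₗ[ℤ] ℤ, k ∣ ψ e := fun ψ => by
    have : ev ψ ∈ LinearMap.range ev := ⟨ψ, rfl⟩
    rw [hk, Submodule.mem_span_singleton] at this
    obtain ⟨a, ha⟩ := this
    exact ⟨a, by rw [← show ev ψ = ψ e from rfl, ← ha]; simp [mul_comm]⟩
  let b := Module.Free.chooseBasis ℤ L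
  choose a ha using fun i => hdiv (b.coord i)
  have h1 : e = k • ∑ i, a i • b i := by
    conv_lhs => rw [← b.sum_repr e]
    rw [Finset.smul_sum]
    refine Finset.sum_congr rfl fun i _ => ?_
    rw [smul_smul, ← ha]; rfl
  refine ⟨k, ∑ i, a i • b i, φ, h1, ?_⟩
  have hφ' : φ e = k := hφ
  have hk0 : k ≠ 0 := by rintro rfl; rw [zero_smul] at h1; exact he h1
  rw [h1, map_smul, smul_eq_mul] at hφ'
  exact mul_left_cancel₀ hk0 (by rw [hφ', mul_one])

theorem exists_functional_not_dvd {L : ILat} {p : ℤ} {x : L} (hx : ¬ ∃ y, x = p • y) :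
    ∃ φ : L →ₗ[ℤ] ℤ, ¬ p ∣ φ x := by
  by_contra! h
  let b := Module.Free.chooseBasis ℤ L
  choose a ha using fun i => h (b.coord i)
  refine hx ⟨∑ i, a i • b i, ?_⟩
  conv_lhs => rw [← b.sum_repr x]
  rw [Finset.smul_sum]
  refine Finset.sum_congr rfl fun i _ => ?_
  rw [smul_smul, ← ha]; rfl


theorem elem_one_of_d {L : ILat} (h : L.d = 1) : L.Elem 1 := by
  intro φ
  let b := Module.finBasis ℤ L
  rw [L.d_eq b] at h
  have hu : IsUnit (L.gram b).det := Int.isUnit_iff_natAbs_eq.mpr h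
  let c : Fin _ → ℤ := (L.gram b)⁻¹ *ᵥ (fun i => φ (b i))
  have hc : L.gram b *ᵥ c = fun i => φ (b i) := by
    simp only [c, mulVec_mulVec, Matrix.mul_nonsing_inv _ hu, one_mulVec]
  refine ⟨∑ i, c i • b i, fun y => ?_⟩
  rw [one_mul]
  suffices h : L.form (∑ i, c i • b i) = φ by rw [h]
  refine b.ext fun j => ?_
  have := congrFun hc j
  rw [← this]
  simp only [map_sum, map_smul, LinearMap.sum_apply, LinearMap.smul_apply, smul_eq_mul,
    Matrix.mulVec, dotProduct, gram, Matrix.of_apply]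
  refine Finset.sum_congr rfl fun i _ => ?_
  rw [L.symm]; ring

/-- Multiples of `p`. -/
def pm (L : ILat) (p : ℤ) : Submodule ℤ L := LinearMap.range (p • LinearMap.id : L →ₗ[ℤ] L)

theorem mem_pm {L : ILat} {p : ℤ} {x : L} : x ∈ L.pm p ↔ ∃ y, x = p • y :=
  ⟨fun ⟨y, hy⟩ => ⟨y, hy.symm⟩, fun ⟨y, hy⟩ => ⟨y, hy.symm⟩⟩

theorem pm_le_R (L : ILat) (p : ℤ) : L.pm p ≤ L.R p := fun x hx y => by
  obtain ⟨z, rfl⟩ := mem_pm.mp hx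
  simp

/-- A relative index of submodules. -/
noncomputable def ridx {L : ILat} (K S : Submodule ℤ L) : ℕ := K.toAddSubgroup.relIndex S.toAddSubgroup

theorem ridx_top {L : ILat} (K : Submodule ℤ L) : ridx K ⊤ = Nat.card (L ⧸ K) := by
  rw [ridx, Submodule.top_toAddSubgroup, AddSubgroup.relIndex_top_right]; rfl

theorem card_R {L : ILat} {p : ℤ} (hp : p ≠ 0) (h : L.Elem p) :
    Nat.card (L ⧸ L.R p) * L.d = p.natAbs ^ L.rk := by
  let b := Module.finBasis ℤ L
  have key : ∀ x ∈ L.R p, ∀ y, p * (L.form x y / p) = L.form x y := fun x hx y =>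
    Int.mul_ediv_cancel' (hx y)
  let f : L.R p →ₗ[ℤ] (Fin (Module.finrank ℤ L) → ℤ) :=
    { toFun := fun x i => L.form x (b i) / p
      map_add' := fun x y => by
        ext i; simp [Int.add_ediv_of_dvd_left (x.2 (b i))]
      map_smul' := fun k x => by
        ext i; simp [Int.mul_ediv_assoc _ (x.2 (b i))] }
  have hf : ∀ x i, p * f x i = L.form x (b i) := fun x i => key x x.2 _
  have hinj : Function.Injective f := by
    rw [← LinearMap.ker_eq_bot, LinearMap.ker_eq_bot']
    intro x hx
    apply Subtype.ext
    refine h.nondeg hp _ fun y => ?_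
    suffices h : L.form x = 0 by rw [h]; rfl
    refine b.ext fun i => ?_
    rw [← hf, hx]; simp
  have hsurj : Function.Surjective f := by
    intro c
    obtain ⟨x, hx⟩ := h (b.constr ℤ c)
    refine ⟨⟨x, fun y => ⟨_, hx y⟩⟩, ?_⟩
    ext i
    apply mul_left_cancel₀ hp
    rw [hf, hx]
    simp
  let c : Module.Basis _ ℤ (L.R p) := Module.Basis.ofEquivFun (LinearEquiv.ofBijective f ⟨hinj, hsurj⟩)
  have hc : ∀ i j, L.form (c j) (b i) = if j = i then p else 0 := by
    intro i j
    rw [← hf]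
    have : f (c j) = Pi.single j 1 := by
      have := Module.Basis.equivFun_self c j
      rw [Module.Basis.equivFun_ofEquivFun] at this
      ext k
      rw [Pi.single_apply]
      exact (this k).trans (by simp only [eq_comm])
    rw [this, Pi.single_apply]
    by_cases hij : j = i
    · simp [hij]
    · simp [hij, Ne.symm hij]
  rw [← Submodule.natAbs_det_basis_change b (L.R p) c, L.d_eq b, ← Int.natAbs_mul, mul_comm,
    Module.Basis.det_apply, ← det_mul]
  have : L.gram b * b.toMatrix (Subtype.val ∘ c) = p • 1 := by
    ext i j
    rw [Matrix.mul_apply]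
    have h2 : L.form (b i) (c j) = ∑ k, L.form (b i) (b k) * b.toMatrix (Subtype.val ∘ c) k j := by
      conv_lhs => rw [← b.sum_repr (c j : L)]
      simp only [map_sum, map_smul, smul_eq_mul, Module.Basis.toMatrix_apply, Function.comp]
      exact Finset.sum_congr rfl fun k _ => mul_comm _ _
    simp only [gram, of_apply]
    rw [← h2, L.symm, hc, Matrix.smul_apply, Matrix.one_apply]
    by_cases hij : j = i
    · simp [hij]
    · simp [hij, Ne.symm hij]
  rw [this, det_smul]
  simp [rk, Int.natAbs_pow]

theorem d_of_elem_one {L : ILat} (h : L.Elem 1) : L.d = 1 := by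
  have := card_R one_ne_zero h
  simp at this
  exact this.2

theorem ridx_pm_R {L : ILat} {p : ℕ} (hp : p ≠ 0) (h : L.Elem p) : ridx (L.pm p) (L.R p) = L.d := by
  have h1 := card_R (Int.natCast_ne_zero.mpr hp) h
  have h2 : (L.pm p).toAddSubgroup.index = p ^ L.rk := by
    rw [rk, ← AddSubgroup.index_range_nsmul]
    congr 1
    ext x
    simp only [Submodule.mem_toAddSubgroup, mem_pm, AddMonoidHom.mem_range]
    constructor
    · rintro ⟨y, rfl⟩; exact ⟨y, by simp⟩
    · rintro ⟨y, rfl⟩; exact ⟨y, by simp⟩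
  have h3 := AddSubgroup.relIndex_mul_index (H := (L.pm p).toAddSubgroup) (K := (L.R p).toAddSubgroup)
    (pm_le_R L p)
  rw [h2] at h3
  have h4 : (L.R p).toAddSubgroup.index = Nat.card (L ⧸ L.R p) := rfl
  rw [h4] at h3
  rw [Int.natAbs_natCast, ← h3, mul_comm] at h1
  have h5 : Nat.card (L ⧸ L.R (p : ℤ)) ≠ 0 := by
    intro h0
    rw [h0, mul_zero] at h3
    exact pow_ne_zero _ hp h3.symm
  exact (mul_right_cancel₀ h5 h1).symm

theorem ridx_R_top {L : ILat} {p : ℕ} (hp : p.Prime) (h : L.Elem p) {a k : ℕ} (hd : L.d = p ^ a)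
    (hr : L.rk = a + k) : ridx (L.R p) ⊤ = p ^ k := by
  have h1 := card_R (Int.natCast_ne_zero.mpr hp.ne_zero) h
  rw [Int.natAbs_natCast, hd, hr, ← ridx_top, pow_add, mul_comm] at h1
  exact mul_left_cancel₀ (pow_ne_zero _ hp.ne_zero) h1

theorem exists_basis_of_zmod {V : Type*} [AddCommGroup V] {p : ℕ} [Fact p.Prime]
    [Module (ZMod p) V] {j : ℕ} (hcard : Nat.card V = p ^ j) :
    ∃ b : Fin j → V, (∀ c : Fin j → ℤ, ∑ i, c i • b i = 0 → ∀ i, (p : ℤ) ∣ c i) ∧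
      ∀ v, ∃ c : Fin j → ℤ, v = ∑ i, c i • b i := by
  have : Finite V := Nat.finite_of_card_ne_zero
    (by rw [hcard]; exact pow_ne_zero _ (Fact.out : p.Prime).ne_zero)
  have hrank : Module.finrank (ZMod p) V = j := by
    have := Module.natCard_eq_pow_finrank (K := ZMod p) (V := V)
    rw [hcard, Nat.card_zmod] at this
    exact (Nat.pow_right_injective (Fact.out : p.Prime).two_le this).symm
  let b := Module.finBasisOfFinrankEq (ZMod p) V hrank
  refine ⟨b, fun c hc i => ?_, fun v => ⟨fun i => ((b.repr v i).val : ℤ), ?_⟩⟩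
  · have h0 : ∑ i, ((c i : ℤ) : ZMod p) • b i = 0 := by
      simpa only [Int.cast_smul_eq_zsmul] using hc
    exact (ZMod.intCast_zmod_eq_zero_iff_dvd _ _).mp
      (Fintype.linearIndependent_iff.mp b.linearIndependent _ h0 i)
  · conv_lhs => rw [← b.sum_repr v]
    refine Finset.sum_congr rfl fun i _ => ?_
    rw [← Int.cast_smul_eq_zsmul (ZMod p)]
    simp

theorem exists_basis_of_card {V : Type*} [AddCommGroup V] {p : ℕ} (hp : p.Prime)
    (htor : ∀ v : V, p • v = 0) {j : ℕ} (hcard : Nat.card V = p ^ j) :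
    ∃ b : Fin j → V, (∀ c : Fin j → ℤ, ∑ i, c i • b i = 0 → ∀ i, (p : ℤ) ∣ c i) ∧
      ∀ v, ∃ c : Fin j → ℤ, v = ∑ i, c i • b i :=
  have := Fact.mk hp
  @exists_basis_of_zmod V _ p _ (AddCommGroup.zmodModule htor) j hcard

theorem quotient_basis {L : ILat} {p : ℕ} (hp : p.Prime) {K S : Submodule ℤ L}
    (hpS : ∀ x ∈ S, (p : ℤ) • x ∈ K) {j : ℕ} (hj : ridx K S = p ^ j) :
    ∃ x : Fin j → L, (∀ i, x i ∈ S) ∧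
      (∀ c : Fin j → ℤ, ∑ i, c i • x i ∈ K → ∀ i, (p : ℤ) ∣ c i) ∧
      ∀ y ∈ S, ∃ c : Fin j → ℤ, y - ∑ i, c i • x i ∈ K := by
  have hmk : ∀ x : S, (K.comap S.subtype).mkQ x = 0 ↔ (x : L) ∈ K := fun x => by
    rw [← LinearMap.mem_ker, Submodule.ker_mkQ]; rfl
  have hsurj := Submodule.mkQ_surjective (K.comap S.subtype)
  obtain ⟨b, hb, hb'⟩ := exists_basis_of_card (V := S ⧸ K.comap S.subtype) hp (fun v => by
    obtain ⟨x, rfl⟩ := hsurj v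
    rw [← map_nsmul, hmk]
    simpa using hpS x x.2) hj
  choose x hx using fun i => hsurj (b i)
  have hsum : ∀ c : Fin j → ℤ, (K.comap S.subtype).mkQ (∑ i, c i • x i) = ∑ i, c i • b i :=
    fun c => by simp only [map_sum, map_zsmul, hx]
  refine ⟨fun i => x i, fun i => (x i).2, fun c hc i => ?_, fun y hy => ?_⟩
  · refine hb c ?_ i
    rw [← hsum, hmk]
    simpa using hc
  · obtain ⟨c, hc⟩ := hb' ((K.comap S.subtype).mkQ ⟨y, hy⟩)
    refine ⟨c, ?_⟩
    rw [← hsum, ← sub_eq_zero, ← map_sub, hmk] at hc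
    simpa using hc

/-- A ternary quadratic form over `𝔽_p` is isotropic. -/
theorem ternary_isotropic {p : ℕ} (hp : p.Prime) (a b c u v w : ℤ) :
    ∃ x y z : ℤ, (¬ ((p : ℤ) ∣ x ∧ (p : ℤ) ∣ y ∧ (p : ℤ) ∣ z)) ∧
      (p : ℤ) ∣ a * x ^ 2 + b * y ^ 2 + c * z ^ 2 + u * (x * y) + v * (x * z) + w * (y * z) := by
  have := Fact.mk hp
  let X : Fin 3 → MvPolynomial (Fin 3) (ZMod p) := MvPolynomial.X
  let C : ZMod p → MvPolynomial (Fin 3) (ZMod p) := MvPolynomial.C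
  have htm : ∀ (t : ZMod p) (i j : Fin 3), (C t * (X i * X j)).totalDegree ≤ 2 := fun t i j => by
    refine (MvPolynomial.totalDegree_mul _ _).trans ?_
    rw [MvPolynomial.totalDegree_C, zero_add]
    refine (MvPolynomial.totalDegree_mul _ _).trans ?_
    simp only [X, MvPolynomial.totalDegree_X]
    norm_num
  let f : MvPolynomial (Fin 3) (ZMod p) := C a * (X 0 * X 0) + C b * (X 1 * X 1) + C c * (X 2 * X 2)
    + C u * (X 0 * X 1) + C v * (X 0 * X 2) + C w * (X 1 * X 2)
  have hdeg : f.totalDegree < Fintype.card (Fin 3) := by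
    rw [Fintype.card_fin]
    have : f.totalDegree ≤ 2 := by
      simp only [f]
      repeat' refine (MvPolynomial.totalDegree_add _ _).trans (max_le ?_ (htm _ _ _))
      exact htm _ _ _
    omega
  have hev : ∀ x : Fin 3 → ZMod p, MvPolynomial.eval x f = a * (x 0 * x 0) + b * (x 1 * x 1) +
      c * (x 2 * x 2) + u * (x 0 * x 1) + v * (x 0 * x 2) + w * (x 1 * x 2) := fun x => by
    simp [f, X, C]
  have hdvd := char_dvd_card_solutions p hdeg
  have hone : 1 < Fintype.card {x : Fin 3 → ZMod p // MvPolynomial.eval x f = 0} := by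
    refine lt_of_lt_of_le hp.one_lt (Nat.le_of_dvd ?_ hdvd)
    exact Fintype.card_pos_iff.mpr ⟨⟨0, by rw [hev]; simp⟩⟩
  obtain ⟨x, hx⟩ := Fintype.exists_ne_of_one_lt_card hone ⟨0, by rw [hev]; simp⟩
  have hx0 : x.1 ≠ 0 := fun h => hx (Subtype.ext h)
  have hxe := x.2
  rw [hev] at hxe
  refine ⟨(x.1 0).val, (x.1 1).val, (x.1 2).val, ?_, ?_⟩
  · rintro ⟨h0, h1, h2⟩
    apply hx0
    ext i
    rw [← ZMod.intCast_zmod_eq_zero_iff_dvd] at h0 h1 h2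
    fin_cases i
    · simpa using h0
    · simpa using h1
    · simpa using h2
  · rw [← ZMod.intCast_zmod_eq_zero_iff_dvd]
    push_cast
    simp only [ZMod.natCast_val, ZMod.cast_id', id_eq]
    linear_combination hxe


theorem form_add_sq (L : ILat) (x y : L) :
    L.form (x + y) (x + y) = L.form x x + 2 * L.form x y + L.form y y := by
  simp only [map_add, LinearMap.add_apply, L.symm y x]; ring

theorem form_smul_sq (L : ILat) (k : ℤ) (x : L) : L.form (k • x) (k • x) = k ^ 2 * L.form x x := by
  simp; ring

theorem smul_ne_zero' {L : ILat} {k : ℤ} {x : L} (hk : k ≠ 0) (hx : x ≠ 0) : k • x ≠ 0 :=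
  smul_ne_zero hk hx

theorem smul_cancel {L : ILat} {k : ℤ} {x y : L} (hk : k ≠ 0) (h : k • x = k • y) : x = y :=
  smul_right_injective _ hk h

theorem Lor.pos_of_orthogonal {L : ILat} (h : L.Lor) {v x : L} (hv : L.form v v < 0) (hx : x ≠ 0)
    (hxv : L.form x v = 0) : 0 < L.form x x := by
  obtain ⟨w, hw, hpos⟩ := h
  by_contra! hx2
  let a := L.form v w
  let b := L.form x w
  have hy : L.form (a • x - b • v) w = 0 := by simp [a, b]; ring
  have hy2 : L.form (a • x - b • v) (a • x - b • v) = a ^ 2 * L.form x x + b ^ 2 * L.form v v := by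
    simp [L.symm v x, hxv]; ring
  have hy0 : a • x - b • v = 0 := by
    by_contra hne
    have := hpos _ hne hy
    nlinarith [mul_nonneg (sq_nonneg a) (neg_nonneg.mpr hx2), mul_nonneg (sq_nonneg b) (neg_nonneg.mpr hv.le)]
  rw [hy0] at hy2
  simp only [map_zero] at hy2
  have hb : b = 0 := by
    by_contra hb
    have := mul_pos (sq_pos_of_ne_zero hb) (neg_pos.mpr hv)
    nlinarith [mul_nonneg (sq_nonneg a) (neg_nonneg.mpr hx2)]
  rw [hb, zero_smul, sub_zero] at hy0
  have ha : a = 0 := by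
    by_contra ha
    exact smul_ne_zero' ha hx hy0
  have hv0 : v ≠ 0 := by rintro rfl; simp at hv
  exact absurd (hpos v hv0 ha) (by linarith)

/-! ### Inheritance of properties -/

theorem Pos.res {L : ILat} (h : L.Pos) (S : Submodule ℤ L) : (L.res S).Pos := fun x hx =>
  h x.1 (fun h0 => hx (Subtype.ext h0))

theorem IsEven.res {L : ILat} (h : L.IsEven) (S : Submodule ℤ L) : (L.res S).IsEven := fun x => h x.1

theorem Lor.res {L : ILat} (h : L.Lor) (S : Submodule ℤ L) {k : ℤ} (hk : k ≠ 0)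
    (hS : ∀ x, k • x ∈ S) : (L.res S).Lor := by
  obtain ⟨v, hv, hpos⟩ := h
  refine ⟨⟨k • v, hS v⟩, ?_, fun x hx hxv => hpos x.1 (fun h0 => hx (Subtype.ext h0)) ?_⟩
  · rw [res_form, form_smul_sq]
    exact mul_neg_of_pos_of_neg (sq_pos_of_ne_zero hk) hv
  · rw [res_form] at hxv
    simpa [hk] using hxv

theorem Pos.down {L : ILat} (h : L.Pos) {c : ℤ} (hc : 0 < c) (hd : ∀ x y, c ∣ L.form x y) :
    (L.down c hd).Pos := fun x hx => by
  have := h x hx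
  rw [← L.down_form hd] at this
  exact pos_of_mul_pos_right this hc.le

theorem Lor.down {L : ILat} (h : L.Lor) {c : ℤ} (hc : 0 < c) (hd : ∀ x y, c ∣ L.form x y) :
    (L.down c hd).Lor := by
  obtain ⟨v, hv, hpos⟩ := h
  refine ⟨v, ?_, fun x hx hxv => ?_⟩
  · rw [← L.down_form hd] at hv
    exact neg_of_mul_neg_right hv hc.le
  · have := hpos x hx (by rw [← L.down_form hd, hxv, mul_zero])
    rw [← L.down_form hd] at this
    exact pos_of_mul_pos_right this hc.le

theorem Pos.prod {L M : ILat} (hL : L.Pos) (hM : M.Pos) : (L.prod M).Pos := by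
  rintro ⟨x, y⟩ hx
  rw [prod_form]
  by_cases h : x = 0
  · subst h
    have : y ≠ 0 := by rintro rfl; exact hx rfl
    simpa using hM y this
  · have h1 := hL x h
    have h2 : 0 ≤ M.form y y := by
      by_cases h : y = 0
      · simp [h]
      · exact (hM y h).le
    exact add_pos_of_pos_of_nonneg h1 h2

theorem Pos.nonneg {L : ILat} (h : L.Pos) (x : L) : 0 ≤ L.form x x := by
  by_cases hx : x = 0
  · simp [hx]
  · exact (h x hx).le

theorem Pos.right {L M : ILat} (h : (L.prod M).Pos) : M.Pos := fun x hx => by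
  have := h (0, x) (fun h0 => hx (congrArg Prod.snd h0))
  simpa [prod_form] using this

theorem Lor.prod {L M : ILat} (hL : L.Lor) (hM : M.Pos) : (L.prod M).Lor := by
  obtain ⟨v, hv, hpos⟩ := hL
  refine ⟨(v, 0), by simpa [prod_form] using hv, ?_⟩
  rintro ⟨x, y⟩ hx hxv
  have hxv' : L.form x v = 0 := by simpa [prod_form] using hxv
  rw [prod_form]
  by_cases h : x = 0
  · subst h
    have : y ≠ 0 := by rintro rfl; exact hx rfl
    simpa using hM y this
  · exact add_pos_of_pos_of_nonneg (hpos x h hxv') (hM.nonneg y)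

theorem Lor.right {L M : ILat} (h : (L.prod M).Lor) {v : L} (hv : L.form v v < 0) : M.Pos :=
  fun x hx => by
    have := h.pos_of_orthogonal (v := (v, 0)) (x := (0, x)) (by simpa [prod_form] using hv)
      (fun h0 => hx (congrArg Prod.snd h0)) (by simp)
    simpa [prod_form] using this

theorem IsEven.prod {L M : ILat} (hL : L.IsEven) (hM : M.IsEven) : (L.prod M).IsEven := fun x =>
  dvd_add (hL x.1) (hM x.2)

theorem IsEven.right {L M : ILat} (h : (L.prod M).IsEven) : M.IsEven := fun x => by
  simpa [prod_form] using h (0, x)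

theorem Elem.prod {L M : ILat} {p : ℤ} (hL : L.Elem p) (hM : M.Elem p) : (L.prod M).Elem p := by
  intro φ
  let i1 : L →ₗ[ℤ] (L.prod M) := (AddMonoidHom.inl L M).toIntLinearMap
  let i2 : M →ₗ[ℤ] (L.prod M) := (AddMonoidHom.inr L M).toIntLinearMap
  obtain ⟨x, hx⟩ := hL (φ ∘ₗ i1)
  obtain ⟨y, hy⟩ := hM (φ ∘ₗ i2)
  refine ⟨(x, y), fun z => ?_⟩
  rw [prod_form]
  have : z = i1 z.1 + i2 z.2 := by simp [i1, i2]
  conv_rhs => rw [this, map_add]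
  rw [hx, hy, mul_add]; rfl

theorem Elem.right {L M : ILat} {p : ℤ} (h : (L.prod M).Elem p) : M.Elem p := by
  intro φ
  let pr : (L.prod M) →ₗ[ℤ] M := (AddMonoidHom.snd L M).toIntLinearMap
  obtain ⟨x, hx⟩ := h (φ ∘ₗ pr)
  refine ⟨x.2, fun y => ?_⟩
  have := hx (0, y)
  rw [prod_form] at this
  simpa [pr] using this

theorem Elem.mul {L : ILat} {p : ℤ} (h : L.Elem p) (k : ℤ) : L.Elem (k * p) := fun φ => by
  obtain ⟨x, hx⟩ := h φ
  exact ⟨k • x, fun y => by simp [hx]; ring⟩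

theorem mem_R_prod {L M : ILat} {p : ℤ} {x : L × M} :
    x ∈ (L.prod M).R p ↔ x.1 ∈ L.R p ∧ x.2 ∈ M.R p := by
  constructor
  · intro h
    refine ⟨fun y => ?_, fun y => ?_⟩
    · have := h (y, 0)
      rw [prod_form] at this
      simpa using this
    · have := h (0, y)
      rw [prod_form] at this
      simpa using this
  · rintro ⟨h1, h2⟩ y
    exact dvd_add (h1 y.1) (h2 y.2)

theorem E2.right {L M : ILat} {p : ℤ} (h : (L.prod M).E2 p) : M.E2 p := fun x hx => by
  have := h (0, x) (mem_R_prod.mpr ⟨Submodule.zero_mem _, hx⟩)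
  rw [prod_form] at this
  simpa using this

theorem hyp_neg : hyp.form ((1, -1) : ℤ × ℤ) ((1, -1) : ℤ × ℤ) < 0 := by
  rw [hyp_form]; norm_num

theorem rk1_pos {c : ℤ} (hc : 0 < c) : (rk1 c).Pos := fun x hx => by
  rw [rk1_form]
  have := mul_pos hc (mul_self_pos.mpr (show (x : ℤ) ≠ 0 from hx))
  linarith

theorem rk1_neg {c : ℤ} (hc : c < 0) : (rk1 c).form (1 : ℤ) (1 : ℤ) < 0 := by
  rw [rk1_form]; linarith

theorem rk1_lor {c : ℤ} (hc : c < 0) : (rk1 c).Lor := by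
  refine ⟨(1 : ℤ), rk1_neg hc, fun x hx h => ?_⟩
  rw [rk1_form] at h
  have h0 : x = (0 : ℤ) := by simpa [hc.ne] using h
  exact absurd h0 hx

theorem rk1_elem (c : ℤ) : (rk1 c).Elem c := fun φ => by
  refine ⟨φ (1 : ℤ), fun y => ?_⟩
  rw [rk1_form]
  have : φ y = y * φ (1 : ℤ) := by
    have := φ.map_smul (y : ℤ) (1 : ℤ)
    simpa using this
  rw [this]; ring

/-! ### Splitting -/

theorem split {L N : ILat} (i : N →ₗ[ℤ] L) (π : L →ₗ[ℤ] N)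
    (h1 : ∀ n x, L.form (i n) x = N.form n (π x)) (h2 : ∀ n, π (i n) = n) :
    Isom L (N.prod (L.res (LinearMap.ker π))) := by
  have hk : ∀ x, x - i (π x) ∈ LinearMap.ker π := fun x => by simp [h2]
  let e : L ≃+ (N × LinearMap.ker π) :=
    { toFun := fun x => (π x, ⟨x - i (π x), hk x⟩)
      invFun := fun y => i y.1 + y.2
      left_inv := fun x => by simp
      right_inv := fun y => by
        have : π (y.2 : L) = 0 := y.2.2
        ext <;> simp [h2, this]
      map_add' := fun x y => by
        ext
        · simp
        · simp only [map_add, Prod.snd_add, Submodule.coe_add]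
          abel }
  refine ⟨e.toIntLinearEquiv, fun x y => ?_⟩
  change (N.prod (L.res (LinearMap.ker π))).form (e x) (e y) = _
  rw [prod_form, res_form]
  change N.form (π x) (π y) + L.form (x - i (π x)) (y - i (π y)) = _
  simp only [map_sub, LinearMap.sub_apply]
  rw [L.symm x (i _), h1, h1, h1, h2, N.symm (π y)]
  ring

theorem split_unit {L : ILat} {ε : ℤ} (hε : ε * ε = 1) {u : L} (hu : L.form u u = ε) :
    Isom L ((rk1 ε).prod (L.res (LinearMap.ker (L.form u)))) := by
  have := split (L := L) (N := rk1 ε) (LinearMap.toSpanSingleton ℤ L u) (ε • L.form u)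
    (fun n x => by
      rw [rk1_form]
      simp only [LinearMap.toSpanSingleton_apply, map_smul, LinearMap.smul_apply, smul_eq_mul]
      linear_combination (-n * L.form u x) * hε)
    (fun n => by
      simp only [LinearMap.toSpanSingleton_apply, map_smul, LinearMap.smul_apply, smul_eq_mul, hu]
      linear_combination n * hε)
  have hker : LinearMap.ker (ε • L.form u) = LinearMap.ker (L.form u) := by
    ext x
    have : ε ≠ 0 := by rintro rfl; simp at hε
    simp [this]
  rwa [hker] at this

theorem split_hyp {L : ILat} (hL : L.IsEven) {e f : L} (he : L.form e e = 0) (hf : L.form e f = 1) :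
    ∃ M, Isom L (hyp.prod M) := by
  obtain ⟨k, hk⟩ := hL f
  let g := f - k • e
  have hg : L.form g g = 0 := by
    simp [g, L.symm f e, he, hf, hk]; ring
  have heg : L.form e g = 1 := by simp [g, he, hf]
  refine ⟨_, split (L := L) (N := hyp)
    ((LinearMap.toSpanSingleton ℤ L e).coprod (LinearMap.toSpanSingleton ℤ L g))
    ((L.form g).prod (L.form e)) (fun n x => ?_) (fun n => ?_)⟩
  · rw [hyp_form]
    simp
  · ext
    · simp [L.symm g e, heg, hg]
    · simp [heg, he]

theorem split_odd {L : ILat} {e f : L} (he : L.form e e = 0) (hf : L.form e f = 1)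
    (hodd : ¬ 2 ∣ L.form f f) : ∃ M, Isom L ((rk1 1).prod ((rk1 (-1)).prod M)) := by
  obtain ⟨k, hk⟩ : ∃ k, L.form f f = 2 * k + 1 := by
    obtain ⟨k, hk⟩ := Int.odd_iff.mpr (Int.two_dvd_ne_zero.mp hodd)
    exact ⟨k, hk⟩
  let g := f - k • e
  have hg : L.form g g = 1 := by
    simp [g, L.symm f e, he, hf, hk]; ring
  have heg : L.form e g = 1 := by simp [g, he, hf]
  let h := e - g
  have hh : L.form h h = -1 := by simp [h, L.symm g e, hg, heg, he]
  have hgh : L.form g h = 0 := by simp [h, L.symm g e, hg, heg]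
  refine ⟨_, (split (L := L) (N := (rk1 1).prod (rk1 (-1)))
    ((LinearMap.toSpanSingleton ℤ L g).coprod (LinearMap.toSpanSingleton ℤ L h))
    ((L.form g).prod (-L.form h)) (fun n x => ?_) (fun n => ?_)).trans (prod_assoc _ _ _)⟩
  · rw [prod_form, rk1_form, rk1_form]
    simp
  · ext
    · simp [hg, hgh]
    · simp [L.symm h g, hh, hgh]

/-- An isotropic vector in a unimodular lattice can be completed to a hyperbolic pair. -/
theorem exists_pair_of_elem_one {L : ILat} (hL : L.Elem 1) {e : L} (he : e ≠ 0) (he2 : L.form e e = 0) :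
    ∃ e' f : L, L.form e' e' = 0 ∧ L.form e' f = 1 ∧ e' ≠ 0 := by
  obtain ⟨k, e0, φ, hk, hφ⟩ := exists_primitive he
  obtain ⟨f, hf⟩ := hL φ
  have hk0 : k ≠ 0 := by rintro rfl; rw [zero_smul] at hk; exact he hk
  refine ⟨e0, f, ?_, by rw [L.symm, hf, hφ]; norm_num, ?_⟩
  · rw [hk, form_smul_sq] at he2
    simpa [hk0] using he2
  · rintro rfl
    rw [smul_zero] at hk
    exact he hk


open MeasureTheory in
/-- Blichfeldt's kernel inequality: truncated paraboloids of points at mutual squared distance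
at least `μ` add up to at most `μ / 2`. -/
theorem sum_ofReal_sub_norm_sq_le {E ι : Type*} [NormedAddCommGroup E] [InnerProductSpace ℝ E]
    {μ : ℝ} (hμ : 0 < μ) (a : ι → E) (h : ∀ i j, i ≠ j → μ ≤ ‖a i - a j‖ ^ 2) (t : Finset ι) :
    ∑ i ∈ t, ENNReal.ofReal (μ / 2 - ‖a i‖ ^ 2) ≤ ENNReal.ofReal (μ / 2) := by
  let s := t.filter fun i => 0 < μ / 2 - ‖a i‖ ^ 2
  have hst : ∑ i ∈ t, ENNReal.ofReal (μ / 2 - ‖a i‖ ^ 2)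
      = ∑ i ∈ s, ENNReal.ofReal (μ / 2 - ‖a i‖ ^ 2) := by
    refine (Finset.sum_filter_of_ne fun i _ hi => ?_).symm
    by_contra hc
    exact hi (ENNReal.ofReal_of_nonpos (not_lt.1 hc))
  rw [hst, ← ENNReal.ofReal_sum_of_nonneg fun i hi => (Finset.mem_filter.1 hi).2.le]
  refine ENNReal.ofReal_le_ofReal ?_
  rcases s.eq_empty_or_nonempty with hs | hs
  · simp [hs]; positivity
  have hk : (0 : ℝ) < s.card := by exact_mod_cast hs.card_pos
  have h1 : ∑ i ∈ s, ∑ j ∈ s, ‖a i - a j‖ ^ 2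
      = 2 * s.card * ∑ i ∈ s, ‖a i‖ ^ 2 - 2 * ‖∑ i ∈ s, a i‖ ^ 2 := by
    have h2 : ‖∑ i ∈ s, a i‖ ^ 2 = ∑ i ∈ s, ∑ j ∈ s, inner ℝ (a i) (a j) := by
      rw [← real_inner_self_eq_norm_sq, sum_inner]
      simp_rw [inner_sum]
    simp_rw [h2, norm_sub_sq_real, Finset.sum_add_distrib, Finset.sum_sub_distrib,
      Finset.sum_const, nsmul_eq_mul, ← Finset.mul_sum]
    ring
  have h3 : (s.card : ℝ) * ((s.card - 1) * μ) ≤ ∑ i ∈ s, ∑ j ∈ s, ‖a i - a j‖ ^ 2 := by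
    have : ∀ i ∈ s, ((s.card : ℝ) - 1) * μ ≤ ∑ j ∈ s, ‖a i - a j‖ ^ 2 := fun i hi => by
      have h4 : ∑ j ∈ s, (if i = j then 0 else μ) ≤ ∑ j ∈ s, ‖a i - a j‖ ^ 2 :=
        Finset.sum_le_sum fun j _ => by
          split_ifs with hij
          · positivity
          · exact h i j hij
      have h5 : ∑ j ∈ s, (if i = j then 0 else μ) = ((s.card : ℝ) - 1) * μ := by
        have : ∀ j, (if i = j then 0 else μ) = μ - (if i = j then μ else 0) := fun j => by
          split_ifs <;> simp
        simp_rw [this, Finset.sum_sub_distrib, Finset.sum_const, nsmul_eq_mul,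
          Finset.sum_ite_eq, if_pos hi]
        ring
      linarith
    calc _ = ∑ i ∈ s, ((s.card : ℝ) - 1) * μ := by rw [Finset.sum_const, nsmul_eq_mul]
      _ ≤ _ := Finset.sum_le_sum this
  have h6 : ((s.card : ℝ) - 1) * μ ≤ 2 * ∑ i ∈ s, ‖a i‖ ^ 2 := by
    refine le_of_mul_le_mul_left ?_ hk
    nlinarith [sq_nonneg ‖∑ i ∈ s, a i‖]
  rw [Finset.sum_sub_distrib, Finset.sum_const, nsmul_eq_mul]
  linarith

/-- The volume of the unit ball. -/
noncomputable def ballVol (D : ℕ) : ℝ :=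
  MeasureTheory.volume.real (Metric.ball (0 : EuclideanSpace ℝ (Fin D)) 1)

open MeasureTheory in
theorem integral_Ioi_pow_max {c : ℝ} (hc : 0 < c) {D : ℕ} (hD : 1 ≤ D) :
    ∫ y in Set.Ioi (0 : ℝ), y ^ (D - 1) * max (c - y ^ 2) 0
      = √c ^ (D + 2) * (2 / (D * (D + 2))) := by
  have hs : 0 < √c := Real.sqrt_pos.2 hc
  have hss : √c ^ 2 = c := Real.sq_sqrt hc.le
  have h1 : ∫ y in Set.Ioi (0 : ℝ), y ^ (D - 1) * max (c - y ^ 2) 0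
      = ∫ y in Set.Ioc (0 : ℝ) √c, y ^ (D - 1) * (c - y ^ 2) := by
    have : ∫ y in Set.Ioc (0 : ℝ) √c, y ^ (D - 1) * (c - y ^ 2)
        = ∫ y in Set.Ioc (0 : ℝ) √c, y ^ (D - 1) * max (c - y ^ 2) 0 := by
      refine setIntegral_congr_fun measurableSet_Ioc fun y hy => ?_
      have : y ^ 2 ≤ c := by nlinarith [hy.1, hy.2]
      simp only [max_eq_left (sub_nonneg.2 this)]
    rw [this]
    refine setIntegral_eq_of_subset_of_forall_sdiff_eq_zero measurableSet_Ioi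
      (fun y hy => hy.1) fun y hy => ?_
    have h0 : 0 < y := hy.1
    have : c ≤ y ^ 2 := by
      have : √c < y := by
        by_contra hh
        exact hy.2 ⟨h0, not_lt.1 hh⟩
      nlinarith
    rw [max_eq_right (by linarith), mul_zero]
  rw [h1, ← intervalIntegral.integral_of_le hs.le]
  obtain ⟨k, rfl⟩ : ∃ k, D = k + 1 := ⟨D - 1, by omega⟩
  have h2 : ∀ y : ℝ, y ^ (k + 1 - 1) * (c - y ^ 2) = c * y ^ k - y ^ (k + 2) := fun y => by
    rw [Nat.add_sub_cancel]; ring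
  simp_rw [h2]
  rw [intervalIntegral.integral_sub (Continuous.intervalIntegrable (by fun_prop) _ _)
    (Continuous.intervalIntegrable (by fun_prop) _ _),
    intervalIntegral.integral_const_mul, integral_pow, integral_pow]
  nth_rewrite 1 [← hss]
  have : (k : ℝ) + 1 ≠ 0 := by positivity
  have : (k : ℝ) + 2 + 1 ≠ 0 := by positivity
  push_cast
  field_simp
  ring

open MeasureTheory in
theorem lintegral_ofReal_sub_norm_sq {c : ℝ} (hc : 0 < c) {D : ℕ} (hD : 1 ≤ D) :
    ∫⁻ z : EuclideanSpace ℝ (Fin D), ENNReal.ofReal (c - ‖z‖ ^ 2)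
      = ENNReal.ofReal (ballVol D * √c ^ (D + 2) * (2 / (D + 2))) := by
  have : Nonempty (Fin D) := ⟨⟨0, hD⟩⟩
  have h1 : ∫ z : EuclideanSpace ℝ (Fin D), max (c - ‖z‖ ^ 2) 0
      = ballVol D * √c ^ (D + 2) * (2 / (D + 2)) := by
    rw [integral_fun_norm_addHaar volume fun y => max (c - y ^ 2) 0]
    simp only [smul_eq_mul, nsmul_eq_mul, finrank_euclideanSpace, Fintype.card_fin]
    rw [integral_Ioi_pow_max hc hD, ballVol]
    have : (D : ℝ) ≠ 0 := by positivity
    field_simp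
  have hfint : Integrable fun z : EuclideanSpace ℝ (Fin D) => max (c - ‖z‖ ^ 2) 0 := by
    refine Continuous.integrable_of_hasCompactSupport (by fun_prop) ?_
    refine HasCompactSupport.intro (isCompact_closedBall 0 √c) fun z hz => ?_
    rw [mem_closedBall_zero_iff, not_le] at hz
    have := Real.sq_sqrt hc.le
    exact max_eq_right (by nlinarith [Real.sqrt_nonneg c])
  rw [← h1, ofReal_integral_eq_lintegral_ofReal hfint (Filter.Eventually.of_forall fun _ =>
    le_max_right _ _)]
  refine lintegral_congr fun z => ?_
  rcases le_total (c - ‖z‖ ^ 2) 0 with h | h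
  · rw [max_eq_right h, ENNReal.ofReal_of_nonpos h, ENNReal.ofReal_zero]
  · rw [max_eq_left h]

open MeasureTheory in
/-- Blichfeldt's bound for the lattice spanned by the columns of `P`. -/
theorem blichfeldt_matrix {D : ℕ} (hD : 1 ≤ D) (P : Matrix (Fin D) (Fin D) ℝ) (hP : P.det ≠ 0)
    {μ : ℝ} (hμ : 0 < μ)
    (h : ∀ c : Fin D → ℤ, c ≠ 0 → μ ≤ ‖WithLp.toLp 2 (P *ᵥ fun i => (c i : ℝ))‖ ^ 2) :
    (ballVol D * (2 / (D + 2))) ^ 2 * (μ / 2) ^ D ≤ P.det ^ 2 := by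
  let G : (Fin D → ℝ) → ENNReal := fun y => ENNReal.ofReal (μ / 2 - ‖WithLp.toLp 2 y‖ ^ 2)
  have hG : Measurable G := by
    have : Measurable fun z : EuclideanSpace ℝ (Fin D) => ENNReal.ofReal (μ / 2 - ‖z‖ ^ 2) := by
      fun_prop
    exact this.comp (PiLp.volume_preserving_toLp (Fin D)).measurable
  have hPm : Measurable (Matrix.toLin' P) :=
    (LinearMap.continuous_of_finiteDimensional (Matrix.toLin' P)).measurable
  have h1 : ∫⁻ x, G (Matrix.toLin' P x) = ENNReal.ofReal |P.det⁻¹| *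
      ENNReal.ofReal (ballVol D * √(μ / 2) ^ (D + 2) * (2 / (D + 2))) := by
    rw [← lintegral_map hG hPm, Real.map_matrix_volume_pi_eq_smul_volume_pi hP,
      lintegral_smul_measure, smul_eq_mul, ← lintegral_ofReal_sub_norm_sq (half_pos hμ) hD]
    congr 1
    exact (PiLp.volume_preserving_toLp (Fin D)).lintegral_comp
      (f := fun z => ENNReal.ofReal (μ / 2 - ‖z‖ ^ 2)) (by fun_prop)
  let b := Pi.basisFun ℝ (Fin D)
  have : VAddInvariantMeasure (Submodule.span ℤ (Set.range b)) (Fin D → ℝ) volume :=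
    (inferInstance : VAddInvariantMeasure (Submodule.span ℤ (Set.range b)).toAddSubgroup _ volume)
  have h2 : ∫⁻ x, G (Matrix.toLin' P x) ≤ ENNReal.ofReal (μ / 2) := by
    rw [(ZSpan.isAddFundamentalDomain b volume).lintegral_eq_tsum'', ← lintegral_tsum]
    · calc _ ≤ ∫⁻ _ in ZSpan.fundamentalDomain b, ENNReal.ofReal (μ / 2) := by
            refine lintegral_mono fun x => ?_
            refine Summable.tsum_le_of_sum_le ENNReal.summable fun s => ?_
            refine sum_ofReal_sub_norm_sq_le hμ
              (fun g : Submodule.span ℤ (Set.range b) =>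
                WithLp.toLp 2 (Matrix.toLin' P (g +ᵥ x))) (fun i j hij => ?_) s
            have hsub : i - j ≠ 0 := sub_ne_zero.2 hij
            obtain ⟨c, hc⟩ := (Submodule.mem_span_range_iff_exists_fun ℤ).1 (i - j).2
            have hc' : (i : Fin D → ℝ) - j = fun k => (c k : ℝ) := by
              have : ((i - j : Submodule.span ℤ (Set.range b)) : Fin D → ℝ) = i - j := rfl
              rw [← this, ← hc]
              ext k
              simp [b, Pi.single_apply]
            have hne : c ≠ 0 := by
              rintro rfl
              apply hsub
              ext1
              rw [← hc]; simp
            refine (h c hne).trans (le_of_eq ?_)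
            rw [← hc', ← WithLp.toLp_sub, ← map_sub]
            have : (i +ᵥ x) - (j +ᵥ x) = (i : Fin D → ℝ) - j := by
              change ((i : Fin D → ℝ) + x) - (j + x) = _
              abel
            rw [this, Matrix.toLin'_apply]
        _ = _ := by
            rw [lintegral_const, Measure.restrict_apply_univ, ZSpan.volume_fundamentalDomain]
            have : Matrix.of b = (1 : Matrix (Fin D) (Fin D) ℝ) := by
              ext i j; simp [b, Matrix.one_apply, Pi.single_apply, eq_comm]
            rw [this]; simp
    · intro g
      have : Measurable fun x : Fin D → ℝ => g +ᵥ x := measurable_const_vadd g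
      exact ((hG.comp hPm).comp this).aemeasurable
  rw [h1, ← ENNReal.ofReal_mul (abs_nonneg _), ENNReal.ofReal_le_ofReal_iff (half_pos hμ).le,
    abs_inv, inv_mul_le_iff₀ (abs_pos.2 hP)] at h2
  have hs : √(μ / 2) ^ 2 = μ / 2 := Real.sq_sqrt (half_pos hμ).le
  have hV : 0 ≤ ballVol D := measureReal_nonneg
  have h3 : ballVol D * (2 / (D + 2)) * √(μ / 2) ^ D ≤ |P.det| := by
    refine le_of_mul_le_mul_right ?_ (half_pos hμ)
    calc _ = ballVol D * √(μ / 2) ^ (D + 2) * (2 / (D + 2)) := by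
          nth_rewrite 2 [← hs]; ring
      _ ≤ _ := h2
  calc _ = (ballVol D * (2 / (D + 2)) * √(μ / 2) ^ D) ^ 2 := by
        rw [mul_pow _ (√(μ / 2) ^ D), ← pow_mul, mul_comm D 2, pow_mul, hs]
    _ ≤ |P.det| ^ 2 := by gcongr
    _ = _ := sq_abs _

theorem gram_det_ne_zero {L : ILat} (h : L.Nondeg) {ι : Type*} [Fintype ι]
    (b : Module.Basis ι ℤ L) : (L.gram b).det ≠ 0 := by
  intro h0
  obtain ⟨c, hc, hc0⟩ := Matrix.exists_mulVec_eq_zero_iff.2 h0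
  apply hc
  have h1 : ∑ i, c i • b i = 0 := by
    refine h _ fun y => ?_
    have : L.form (∑ i, c i • b i) = 0 := by
      refine b.ext fun j => ?_
      rw [L.symm]
      have := congrFun hc0 j
      simp only [mulVec, dotProduct, gram, of_apply, Pi.zero_apply] at this
      simp only [map_sum, map_smul, smul_eq_mul, LinearMap.zero_apply]
      rw [← this]
      exact Finset.sum_congr rfl fun i _ => mul_comm (c i) (L.form (b j) (b i))
    exact LinearMap.congr_fun this y
  ext i
  have := b.linearIndependent
  rw [Fintype.linearIndependent_iff] at this
  exact this c h1 i

theorem d_ne_zero {L : ILat} (h : L.Nondeg) : L.d ≠ 0 :=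
  Int.natAbs_ne_zero.2 (gram_det_ne_zero h _)

theorem form_sum_basis (L : ILat) {ι : Type*} [Fintype ι] (b : ι → L) (x y : ι → ℤ) :
    L.form (∑ i, x i • b i) (∑ i, y i • b i) = x ⬝ᵥ L.gram b *ᵥ y := by
  simp only [map_sum, map_smul, LinearMap.sum_apply, LinearMap.smul_apply, smul_eq_mul,
    dotProduct, mulVec, gram, of_apply, Finset.mul_sum]
  rw [Finset.sum_comm]
  refine Finset.sum_congr rfl fun i _ => Finset.sum_congr rfl fun j _ => by ring

/-- A quadratic form that is nonnegative on integral vectors is positive semidefinite. -/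
theorem posSemidef_of_int {ι : Type*} [Fintype ι] (G : Matrix ι ι ℤ) (hG : G.IsSymm)
    (h : ∀ x : ι → ℤ, 0 ≤ x ⬝ᵥ G *ᵥ x) : (G.map (Int.cast : ℤ → ℝ)).PosSemidef := by
  refine PosSemidef.of_dotProduct_mulVec_nonneg ?_ fun x => ?_
  · ext i j
    simpa using congrArg (Int.cast : ℤ → ℝ) (congrFun (congrFun hG i) j)
  · simp only [star_trivial]
    have hcl : IsClosed {x : ι → ℝ | 0 ≤ x ⬝ᵥ (G.map (Int.cast : ℤ → ℝ)) *ᵥ x} :=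
      isClosed_le continuous_const (by fun_prop)
    have hd : DenseRange fun (y : ι → ℚ) (i : ι) => (y i : ℝ) := 
      DenseRange.piMap (f := fun _ : ι => ((↑) : ℚ → ℝ)) fun _ => Rat.isDenseEmbedding_coe_real.dense
    refine hcl.closure_subset_iff.2 ?_ (hd x)
    rintro _ ⟨y, rfl⟩
    obtain ⟨k, hk⟩ := IsLocalization.exist_integer_multiples_of_finset (nonZeroDivisors ℤ) (Finset.univ.image y)
    have hk0 : ((k : ℤ) : ℝ) ≠ 0 := by exact_mod_cast nonZeroDivisors.ne_zero k.2
    have : ∀ i, ∃ z : ℤ, (z : ℚ) = (k : ℤ) * y i := fun i => by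
      obtain ⟨z, hz⟩ := hk (y i) (Finset.mem_image_of_mem _ (Finset.mem_univ i))
      exact ⟨z, by simpa using hz⟩
    choose z hz using this
    have hz' : ∀ i, (y i : ℝ) = (z i : ℝ) / (k : ℤ) := fun i => by
      rw [eq_div_iff hk0]
      have := congrArg (Rat.cast : ℚ → ℝ) (hz i)
      push_cast at this
      rw [this]; ring
    have h1 : ((z ⬝ᵥ G *ᵥ z : ℤ) : ℝ) ≥ 0 := by exact_mod_cast h z
    have h2 : (fun i => (y i : ℝ)) ⬝ᵥ (G.map (Int.cast : ℤ → ℝ)) *ᵥ (fun i => (y i : ℝ))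
        = ((z ⬝ᵥ G *ᵥ z : ℤ) : ℝ) / ((k : ℤ) : ℝ) ^ 2 := by
      simp only [dotProduct, mulVec, hz', map_apply]
      push_cast
      simp only [Finset.mul_sum, Finset.sum_div]
      refine Finset.sum_congr rfl fun i _ => Finset.sum_congr rfl fun j _ => ?_
      field_simp
    simp only [Set.mem_ofPred_eq]
    rw [h2]
    positivity

open scoped MatrixOrder Matrix.Norms.L2Operator in
theorem exists_eq_transpose_mul_self {ι : Type*} [Fintype ι] {G : Matrix ι ι ℝ}
    (h : G.PosSemidef) : ∃ X : Matrix ι ι ℝ, G = Xᵀ * X := by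
  obtain ⟨X, hX⟩ := CStarAlgebra.nonneg_iff_eq_star_mul_self.mp h.nonneg
  exact ⟨X, by rw [hX, star_eq_conjTranspose, conjTranspose_eq_transpose_of_trivial]⟩

theorem Pos.blichfeldt {L : ILat} (hL : L.Pos) (hD : 1 ≤ L.rk) {μ : ℝ} (hμ : 0 < μ)
    (h : ∀ x : L, x ≠ 0 → μ ≤ L.form x x) :
    (ballVol L.rk * (2 / (L.rk + 2))) ^ 2 * (μ / 2) ^ L.rk ≤ L.d := by
  let b : Module.Basis (Fin L.rk) ℤ L := Module.finBasis ℤ L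
  have hsym : (L.gram b).IsSymm := by ext i j; exact L.symm _ _
  have hps := posSemidef_of_int (L.gram b) hsym fun x => by
    rw [← form_sum_basis]; exact hL.nonneg _
  obtain ⟨X, hX⟩ := exists_eq_transpose_mul_self hps
  have hdet : X.det ^ 2 = ((L.gram b).det : ℝ) := by
    have : ((L.gram b).det : ℝ) = ((L.gram b).map (Int.cast : ℤ → ℝ)).det :=
      (Int.castRingHom ℝ).map_det _
    rw [this, hX, det_mul, det_transpose, sq]
  have hd : X.det ^ 2 = L.d := by
    rw [L.d_eq b, hdet, Nat.cast_natAbs, abs_of_nonneg]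
    have : (0 : ℝ) ≤ ((L.gram b).det : ℝ) := hdet ▸ sq_nonneg _
    exact_mod_cast this
  have h0 : X.det ≠ 0 := by
    intro h0
    rw [h0] at hd
    have : L.d = 0 := by exact_mod_cast (by simpa using hd.symm : (L.d : ℝ) = 0)
    exact d_ne_zero hL.nondeg this
  rw [← hd]
  refine blichfeldt_matrix hD X h0 hμ fun c hc => ?_
  have hne : ∑ i, c i • b i ≠ 0 := fun h1 => by
    have := b.linearIndependent
    rw [Fintype.linearIndependent_iff] at this
    exact hc (funext (this c h1))
  refine (h _ hne).trans (le_of_eq ?_)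
  rw [form_sum_basis, EuclideanSpace.norm_sq_eq]
  have h1 : ((c ⬝ᵥ L.gram b *ᵥ c : ℤ) : ℝ)
      = (fun i => (c i : ℝ)) ⬝ᵥ ((L.gram b).map (Int.cast : ℤ → ℝ)) *ᵥ fun i => (c i : ℝ) := by
    simp [dotProduct, mulVec]
  rw [h1, hX, ← mulVec_mulVec, dotProduct_mulVec, vecMul_transpose]
  simp [dotProduct, sq]


theorem ballVol_eq {D : ℕ} (hD : 1 ≤ D) :
    ballVol D = √Real.pi ^ D / Real.Gamma ((D : ℝ) / 2 + 1) := by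
  have : Nonempty (Fin D) := ⟨⟨0, hD⟩⟩
  have hG : 0 < Real.Gamma ((D : ℝ) / 2 + 1) := Real.Gamma_pos_of_pos (by positivity)
  rw [ballVol, MeasureTheory.Measure.real, EuclideanSpace.volume_ball]
  simp only [Fintype.card_fin, ENNReal.ofReal_one, one_pow, one_mul]
  exact ENNReal.toReal_ofReal (by positivity)

/-- A rational lower bound for the constant in Blichfeldt's inequality. -/
def blich : ℕ → ℚ
  | 0 => 0
  | 1 => 4 / 3
  | 2 => 31415 / 20000
  | D + 3 => blich (D + 1) * (62830 / (10000 * (D + 5)))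

theorem blich_nonneg : ∀ D, 0 ≤ blich D
  | 0 => le_rfl
  | 1 => by norm_num [blich]
  | 2 => by norm_num [blich]
  | D + 3 => mul_nonneg (blich_nonneg (D + 1)) (by positivity)

theorem blich_le : ∀ D, 1 ≤ D → (blich D : ℝ) ≤ ballVol D * (2 / (D + 2))
  | 0, h => by omega
  | 1, _ => by
    rw [ballVol_eq le_rfl]
    have h1 : Real.Gamma ((1 : ℕ) / 2 + 1) = √Real.pi / 2 := by
      rw [Real.Gamma_add_one (by norm_num)]
      norm_num [Real.Gamma_one_half_eq]
      ring
    have : √Real.pi ≠ 0 := (Real.sqrt_pos.2 Real.pi_pos).ne'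
    rw [h1, blich]
    push_cast
    field_simp
    norm_num
  | 2, _ => by
    rw [ballVol_eq (by norm_num)]
    have h1 : Real.Gamma ((2 : ℕ) / 2 + 1) = 1 := by
      norm_num [Real.Gamma_two]
    have h2 : √Real.pi ^ 2 = Real.pi := Real.sq_sqrt Real.pi_pos.le
    have := Real.pi_gt_d4
    rw [h1, h2, blich]
    push_cast
    norm_num
    linarith
  | D + 3, _ => by
    have ih := blich_le (D + 1) (by omega)
    have hrec : ballVol (D + 3) = ballVol (D + 1) * (2 * Real.pi / (D + 3)) := by
      rw [ballVol_eq (by omega), ballVol_eq (by omega)]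
      have h1 : ((D + 3 : ℕ) : ℝ) / 2 + 1 = (((D + 1 : ℕ) : ℝ) / 2 + 1) + 1 := by push_cast; ring
      have h2 : √Real.pi ^ 2 = Real.pi := Real.sq_sqrt Real.pi_pos.le
      have hG : 0 < Real.Gamma (((D + 1 : ℕ) : ℝ) / 2 + 1) := Real.Gamma_pos_of_pos (by positivity)
      rw [h1, Real.Gamma_add_one (by positivity), pow_add √Real.pi (D + 1) 2, h2]
      push_cast
      field_simp
      ring
    have hV : 0 ≤ ballVol (D + 1) := MeasureTheory.measureReal_nonneg
    have hpi := Real.pi_gt_d4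
    have h3 : (62830 / (10000 * (D + 5)) : ℝ) ≤ 2 * Real.pi / (D + 5) := by
      rw [div_le_div_iff₀ (by positivity) (by positivity)]
      have : (0 : ℝ) < D + 5 := by positivity
      nlinarith
    calc ((blich (D + 3) : ℚ) : ℝ) = (blich (D + 1) : ℝ) * (62830 / (10000 * (D + 5))) := by
          rw [blich]; push_cast; ring
      _ ≤ (ballVol (D + 1) * (2 / ((D + 1 : ℕ) + 2))) * (2 * Real.pi / (D + 5)) :=
          mul_le_mul ih h3 (by positivity) (by positivity)
      _ = _ := by
          rw [hrec]; push_cast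
          have : (D : ℝ) + 1 + 2 ≠ 0 := by positivity
          field_simp
          ring

theorem Pos.blich_le {L : ILat} (hL : L.Pos) {D : ℕ} (hD : L.rk = D) (h1 : 1 ≤ D) {μ : ℕ}
    (h : ∀ x : L, x ≠ 0 → μ ≤ L.form x x) : blich D ^ 2 * (μ / 2) ^ D ≤ L.d := by
  subst hD
  rcases Nat.eq_zero_or_pos μ with rfl | hμ
  · simp [zero_pow (by omega : L.rk ≠ 0)]
  have h2 := hL.blichfeldt h1 (μ := μ) (by exact_mod_cast hμ) fun x hx => by exact_mod_cast h x hx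
  have h3 : ((blich L.rk ^ 2 * (μ / 2) ^ L.rk : ℚ) : ℝ) ≤ L.d := by
    refine le_trans ?_ h2
    push_cast
    have := blich_nonneg L.rk
    have : (0 : ℝ) ≤ blich L.rk := by exact_mod_cast this
    have := ILat.blich_le L.rk h1
    gcongr
  exact_mod_cast h3

theorem Pos.exists_short {L : ILat} (hL : L.Pos) {D : ℕ} (hD : L.rk = D) (h1 : 1 ≤ D) {μ : ℕ}
    (h : (L.d : ℚ) < blich D ^ 2 * (μ / 2) ^ D) : ∃ x : L, x ≠ 0 ∧ L.form x x < μ := by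
  by_contra! hc
  exact absurd (hL.blich_le hD h1 hc) (not_le.2 h)

/-- A vector of nonzero norm splits off a sublattice of controlled index. -/
theorem orthogonal_complement (L : ILat) {v : L} {N : ℤ} (hv : L.form v v = N) (hN : N ≠ 0) :
    ∃ j : ℕ, 0 < j ∧ j ∣ N.natAbs ∧
      N.natAbs * (L.res (LinearMap.ker (L.form v))).d = L.d * j ^ 2 ∧
      (L.res (LinearMap.ker (L.form v))).rk + 1 = L.rk := by
  let P := LinearMap.ker (L.form v)
  let f : L →+ ZMod N.natAbs := (Int.castAddHom _).comp (L.form v).toAddMonoidHom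
  let S : Submodule ℤ L := LinearMap.ker f.toIntLinearMap
  have hS : ∀ x, x ∈ S ↔ N ∣ L.form v x := fun x => by
    rw [← Int.natAbs_dvd, ← ZMod.intCast_zmod_eq_zero_iff_dvd]; rfl
  have : NeZero N.natAbs := ⟨Int.natAbs_ne_zero.2 hN⟩
  let g : (ℤ × P) →ₗ[ℤ] S := LinearMap.codRestrict S
    ((LinearMap.toSpanSingleton ℤ L v).coprod P.subtype) fun x => by
      have : L.form v x.2 = 0 := x.2.2
      rw [hS]; simp [hv, this]
  have hg : ∀ x, ((g x : S) : L) = x.1 • v + x.2 := fun x => rfl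
  have hgv : ∀ x, L.form v (g x) = x.1 * N := fun x => by
    have : L.form v x.2 = 0 := x.2.2
    rw [hg]; simp [hv, this]
  have hinj : Function.Injective g := by
    refine (injective_iff_map_eq_zero g).2 fun x hx => ?_
    have h1 := hgv x
    rw [hx] at h1
    have h2 : x.1 = 0 := by
      have : x.1 * N = 0 := by rw [← h1]; simp
      simpa [hN] using this
    have h3 := hg x
    rw [hx, h2] at h3
    ext
    · exact h2
    · simpa using h3.symm
  have hsurj : Function.Surjective g := fun x => by
    obtain ⟨k, hk⟩ := (hS x).1 x.2
    refine ⟨(k, ⟨x - k • v, ?_⟩), ?_⟩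
    · rw [LinearMap.mem_ker, map_sub, map_smul, hv, hk]; simp; ring
    · ext1; rw [hg]; simp
  have hiso : Isom ((rk1 N).prod (L.res P)) (L.res S) := by
    refine ⟨LinearEquiv.ofBijective g ⟨hinj, hsurj⟩, fun x y => ?_⟩
    change L.form (g x) (g y) = N * x.1 * y.1 + L.form x.2 y.2
    have h1 : L.form v x.2 = 0 := x.2.2
    have h2 : L.form v y.2 = 0 := y.2.2
    rw [hg, hg]
    simp [hv, h2, L.symm _ v, h1]; ring
  have hrk : (L.res S).rk = L.rk := rk_res L S hN fun x => by rw [hS]; simp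
  have hcard : Nat.card (L ⧸ S) ∣ N.natAbs := by
    have e := f.toIntLinearMap.quotKerEquivRange
    rw [Nat.card_congr e.toEquiv]
    have := AddSubgroup.card_addSubgroup_dvd_card (LinearMap.range f.toIntLinearMap).toAddSubgroup
    rwa [Nat.card_zmod] at this
  refine ⟨Nat.card (L ⧸ S), Nat.pos_of_dvd_of_pos hcard (Nat.pos_of_ne_zero (NeZero.ne _)), hcard,
    ?_, ?_⟩
  · rw [← d_res L S hrk, ← hiso.d, d_prod, d_rk1]
  · rw [← hrk, ← hiso.rk, rk_prod, rk_rk1, add_comm]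

theorem Lor.exists_isotropic_of_even {L : ILat} (hL : L.Lor) (he : L.IsEven) {D : ℕ}
    (hD : L.rk = D + 1) (h2 : 2 ≤ D) (hd : (2 * L.d : ℚ) < blich D ^ 2 * 2 ^ D) :
    ∃ e : L, e ≠ 0 ∧ L.form e e = 0 := by
  by_contra! hiso
  have hex : ∃ k : ℕ, ∃ v : L, L.form v v = -(k + 1 : ℤ) := by
    obtain ⟨v, hv, -⟩ := hL
    exact ⟨(-L.form v v - 1).toNat, v, by omega⟩
  obtain ⟨v, hv⟩ := Nat.find_spec hex
  set k := Nat.find hex with hk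
  have hmin : ∀ w : L, L.form w w < 0 → L.form w w ≤ -(k + 1 : ℤ) := fun w hw => by
    by_contra! hc
    exact Nat.find_min hex (m := (-L.form w w - 1).toNat) (by omega) ⟨w, by omega⟩
  obtain ⟨s, hs⟩ : ∃ s : ℕ, k + 1 = 2 * (s + 1) := by
    obtain ⟨z, hz⟩ := he v
    exact ⟨(-z - 1).toNat, by omega⟩
  obtain ⟨j, hj0, hj, hjd, hjr⟩ := L.orthogonal_complement hv (by omega)
  set P := L.res (LinearMap.ker (L.form v)) with hPdef
  have hPpos : P.Pos := fun x hx =>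
    hL.pos_of_orthogonal (v := v) (by omega) (fun h => hx (Subtype.ext h))
      (by rw [L.symm]; exact x.2)
  have hmu : ∀ x : P, x ≠ 0 → ((2 * (s + 2) : ℕ) : ℤ) ≤ P.form x x := fun x hx => by
    have hxv : L.form v x = 0 := x.2
    have hx0 : (x : L) ≠ 0 := fun h => hx (Subtype.ext h)
    have h1 : L.form (x + v) (x + v) = L.form x x - (k + 1) := by
      rw [form_add_sq, L.symm (x : L) v, hxv, hv]; ring
    have hpos : 0 < L.form x x := hPpos x hx
    have hne : (x : L) + v ≠ 0 := fun h => by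
      have := congrArg (L.form v) h
      rw [map_add, hxv, hv, map_zero] at this
      omega
    have h3 := hiso _ hne
    have h4 := hmin ((x : L) + v)
    obtain ⟨z, hz⟩ := he x
    change _ ≤ L.form x x
    push_cast
    omega
  have hb := hPpos.blich_le (D := D) (by omega) (by omega) hmu
  have hPd : P.d ≤ L.d * (2 * (s + 1)) := by
    have h5 : (-(k + 1 : ℤ)).natAbs = 2 * (s + 1) := by omega
    rw [h5] at hjd hj
    have h6 := Nat.le_of_dvd (by omega) hj
    have : 2 * (s + 1) * P.d ≤ 2 * (s + 1) * (L.d * (2 * (s + 1))) := by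
      rw [hjd, mul_comm (2 * (s + 1)), mul_assoc, ← sq]
      gcongr
    exact Nat.le_of_mul_le_mul_left this (by omega)
  have hpow : (2 : ℚ) ^ D * (s + 1) ≤ (s + 2) ^ D := by
    obtain ⟨E, rfl⟩ := Nat.exists_eq_add_of_le h2
    rw [pow_add, pow_add]
    have h7 : (2 : ℚ) ^ E ≤ (s + 2) ^ E := by gcongr; linarith [Nat.cast_nonneg (α := ℚ) s]
    have h8 : (2 : ℚ) ^ 2 * (s + 1) ≤ (s + 2) ^ 2 := by nlinarith [sq_nonneg (s : ℚ)]
    calc (2 : ℚ) ^ 2 * 2 ^ E * (s + 1) = (2 ^ 2 * (s + 1)) * 2 ^ E := by ring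
      _ ≤ _ := by gcongr
  have hPd' : (P.d : ℚ) ≤ L.d * (2 * (s + 1)) := by exact_mod_cast hPd
  have h9 : (((2 * (s + 2) : ℕ) : ℚ) / 2) = s + 2 := by push_cast; ring
  rw [h9] at hb
  have hs0 : (0 : ℚ) < s + 1 := by positivity
  have h10 : blich D ^ 2 * (2 ^ D * (s + 1)) ≤ blich D ^ 2 * (s + 2) ^ D := by gcongr
  nlinarith

/-- The even sublattice has index at most two. -/
theorem exists_even_sublattice (L : ILat) : ∃ S : Submodule ℤ L, (L.res S).IsEven ∧
    (∀ x, (2 : ℤ) • x ∈ S) ∧ (∀ x, x ∈ S ↔ 2 ∣ L.form x x) ∧ (L.res S).d ≤ L.d * 4 := by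
  let f : L →+ ZMod 2 :=
    { toFun := fun x => (L.form x x : ZMod 2)
      map_zero' := by simp
      map_add' := fun x y => by
        rw [form_add_sq]; push_cast
        have : (2 : ZMod 2) = 0 := rfl
        rw [this]; ring }
  let S : Submodule ℤ L := LinearMap.ker f.toIntLinearMap
  have hS : ∀ x, x ∈ S ↔ 2 ∣ L.form x x := fun x => by
    have := ZMod.intCast_zmod_eq_zero_iff_dvd (L.form x x) 2
    exact this
  have h2 : ∀ x, (2 : ℤ) • x ∈ S := fun x => by
    rw [hS, form_smul_sq]; exact ⟨2 * L.form x x, by ring⟩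
  refine ⟨S, fun x => (hS x).1 x.2, h2, hS, ?_⟩
  rw [d_res L S (rk_res L S two_ne_zero h2)]
  have hcard : Nat.card (L ⧸ S) ∣ 2 := by
    have e := f.toIntLinearMap.quotKerEquivRange
    rw [Nat.card_congr e.toEquiv]
    have := AddSubgroup.card_addSubgroup_dvd_card (LinearMap.range f.toIntLinearMap).toAddSubgroup
    rwa [Nat.card_zmod] at this
  have := Nat.le_of_dvd (by norm_num) hcard
  have : Nat.card (L ⧸ S) ^ 2 ≤ 2 ^ 2 := by gcongr
  exact Nat.mul_le_mul_left _ this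

theorem Lor.exists_isotropic {L : ILat} (hL : L.Lor) {D : ℕ}
    (hD : L.rk = D + 1) (h2 : 2 ≤ D) (hd : (8 * L.d : ℚ) < blich D ^ 2 * 2 ^ D) :
    ∃ e : L, e ≠ 0 ∧ L.form e e = 0 := by
  obtain ⟨S, hev, h2S, -, hSd⟩ := L.exists_even_sublattice
  have : ((L.res S).d : ℚ) ≤ L.d * 4 := by exact_mod_cast hSd
  obtain ⟨e, he, he2⟩ := (hL.res S two_ne_zero h2S).exists_isotropic_of_even hev (D := D)
    (by rw [rk_res L S two_ne_zero h2S, hD]) h2 (by linarith)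
  exact ⟨e, fun h => he (Subtype.ext h), he2⟩


/-! ### Unimodular lattices -/

theorem Elem.exists_two_smul {L : ILat} {p : ℤ} (hL : L.Elem p) (hp : ¬ 2 ∣ p) {x : L}
    (h : ∀ y, 2 ∣ L.form x y) : ∃ y, x = (2 : ℤ) • y := by
  by_contra hx
  obtain ⟨φ, hφ⟩ := exists_functional_not_dvd hx
  obtain ⟨z, hz⟩ := hL φ
  have := h z
  rw [L.symm, hz] at this
  rcases Int.prime_two.dvd_or_dvd this with h1 | h1
  · exact hp h1
  · exact hφ h1

theorem Isom.of_surjective {L M : ILat} (hL : L.Nondeg) (f : L →ₗ[ℤ] M)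
    (hf : ∀ x y, M.form (f x) (f y) = L.form x y) (hs : Function.Surjective f) : Isom L M := by
  refine ⟨LinearEquiv.ofBijective f ⟨(injective_iff_map_eq_zero f).2 fun x hx => ?_, hs⟩, hf⟩
  exact hL x fun y => by rw [← hf, hx]; simp

theorem prod_of_rk_zero {L M : ILat} (h : L.rk = 0) : Isom (L.prod M) M := by
  have : Subsingleton L := Module.finrank_zero_iff.1 h
  refine ⟨(AddEquiv.mk' ⟨Prod.snd, fun x => (0, x), fun x => ?_, fun x => rfl⟩
    fun _ _ => rfl).toIntLinearEquiv, fun x y => ?_⟩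
  · exact Prod.ext (Subsingleton.elim _ _) rfl
  · change M.form x.2 y.2 = L.form x.1 y.1 + M.form x.2 y.2
    rw [Subsingleton.elim x.1 0]; simp

/-- The odd unimodular Lorentzian lattice `I_{k,1}`. -/
noncomputable def I1 : ℕ → ILat
  | 0 => rk1 (-1)
  | k + 1 => (rk1 1).prod (I1 k)

theorem Lor.odd_split {X : ILat} (hX : X.Lor) (hu : X.Elem 1) {k : ℕ} (hk : X.rk = k + 1)
    (h2 : 2 ≤ k) (h18 : k ≤ 18) {g : X} (hg : ¬ 2 ∣ X.form g g) :
    ∃ M : ILat, M.Pos ∧ M.Elem 1 ∧ M.rk + 1 = k ∧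
      Isom X ((rk1 1).prod (M.prod (rk1 (-1)))) := by
  have hd : X.d = 1 := d_of_elem_one hu
  have hnum : ∀ D ∈ Finset.Icc 2 18, 8 < blich D ^ 2 * 2 ^ D := by decide +kernel
  obtain ⟨e, he, he2⟩ := hX.exists_isotropic hk h2
    (by rw [hd]; simpa using hnum k (Finset.mem_Icc.2 ⟨h2, h18⟩))
  obtain ⟨e', f, he', hf, -⟩ := exists_pair_of_elem_one hu he he2
  obtain ⟨f', hf', hodd⟩ : ∃ f', X.form e' f' = 1 ∧ ¬ 2 ∣ X.form f' f' := by
    by_cases h : 2 ∣ X.form f f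
    · refine ⟨g + (1 - X.form e' g) • f, by simp [hf], ?_⟩
      rw [form_add_sq, form_smul_sq, map_smul, smul_eq_mul]
      obtain ⟨t, ht⟩ := h
      rw [ht]
      intro hc
      apply hg
      obtain ⟨s, hs⟩ := hc
      exact ⟨s - (1 - X.form e' g) * X.form g f - (1 - X.form e' g) ^ 2 * t,
        by linear_combination hs⟩
    · exact ⟨f, hf, h⟩
  obtain ⟨M, hM⟩ := split_odd he' hf' hodd
  have hlor := hM.lor hX
  have hM' : Isom ((rk1 1).prod ((rk1 (-1)).prod M)) ((rk1 (-1)).prod ((rk1 1).prod M)) :=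
    prod_left_comm _ _ _
  refine ⟨M, ((hM'.lor hlor).right (rk1_neg (by norm_num))).right, ((hM.elem hu).right).right, ?_,
    hM.trans ((Isom.refl _).prod (prod_comm _ _))⟩
  have := hM.rk
  rw [rk_prod, rk_prod, rk_rk1, rk_rk1] at this
  omega

theorem Pos.prod_rk1_neg_one : ∀ {k : ℕ} {M : ILat}, M.Pos → M.Elem 1 → M.rk = k → k ≤ 18 →
    Isom (M.prod (rk1 (-1))) (I1 k)
  | 0, M, _, _, hk, _ => prod_of_rk_zero hk
  | 1, M, hM, hu, hk, _ => by
    obtain ⟨x, hx, hx2⟩ := hM.exists_short hk le_rfl (μ := 2)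
      (by rw [d_of_elem_one hu]; norm_num [blich])
    have hx1 : M.form x x = 1 := by
      have := hM x hx
      push_cast at hx2
      omega
    have h := split_unit (by norm_num : (1 : ℤ) * 1 = 1) hx1
    have hr : (M.res (LinearMap.ker (M.form x))).rk = 0 := by
      have := h.rk
      rw [rk_prod, rk_rk1] at this
      omega
    exact (h.prod (Isom.refl _)).trans ((prod_assoc _ _ _).trans
      ((Isom.refl _).prod (prod_of_rk_zero hr)))
  | k + 2, M, hM, hu, hk, h18 => by
    have hlor : (M.prod (rk1 (-1))).Lor :=
      (prod_comm _ _).lor ((rk1_lor (by norm_num : (-1 : ℤ) < 0)).prod hM)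
    have hel : (M.prod (rk1 (-1))).Elem 1 :=
      hu.prod (elem_one_of_d (by rw [d_rk1]; rfl))
    obtain ⟨M1, hP, hE, hr, hiso⟩ := hlor.odd_split hel (k := k + 2)
      (by rw [rk_prod, rk_rk1, hk]) (by omega) h18 (g := ((0 : M), (1 : ℤ)))
      (by rw [prod_form, rk1_form]; simp)
    exact hiso.trans ((Isom.refl _).prod (hP.prod_rk1_neg_one hE (by omega) (by omega)))

theorem Lor.odd_unimodular {X : ILat} (hX : X.Lor) (hu : X.Elem 1) {k : ℕ} (hk : X.rk = k + 1)
    (h2 : 2 ≤ k) (h18 : k ≤ 18) {g : X} (hg : ¬ 2 ∣ X.form g g) : Isom X (I1 k) := by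
  obtain ⟨M, hP, hE, hr, hiso⟩ := hX.odd_split hu hk h2 h18 hg
  obtain ⟨l, rfl⟩ : ∃ l, k = l + 1 := ⟨k - 1, by omega⟩
  exact hiso.trans ((Isom.refl _).prod (hP.prod_rk1_neg_one hE (by omega) (by omega)))

/-- Characteristic vectors. -/
def IsChar (L : ILat) (c : L) : Prop := ∀ x, 2 ∣ L.form c x - L.form x x

theorem IsChar.map {L M : ILat} {c : L} (hc : L.IsChar c) {e : L ≃ₗ[ℤ] M}
    (he : ∀ x y, M.form (e x) (e y) = L.form x y) : M.IsChar (e c) := fun x => by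
  obtain ⟨y, rfl⟩ := e.surjective x
  rw [he, he]; exact hc y

theorem IsChar.prod {L M : ILat} {c : L} {c' : M} (h : L.IsChar c) (h' : M.IsChar c') :
    (L.prod M).IsChar (c, c') := fun x => by
  change 2 ∣ (L.form c x.1 + M.form c' x.2) - (L.form x.1 x.1 + M.form x.2 x.2)
  rw [add_sub_add_comm]
  exact dvd_add (h x.1) (h' x.2)

theorem rk1_isChar {c k : ℤ} (hk : ¬ 2 ∣ k) : (rk1 c).IsChar k := fun (x : ℤ) => by
  rw [rk1_form, rk1_form]
  have h1 : c * k * x - c * x * x = c * (x * (k - 1) - x * (x - 1)) := by ring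
  rw [h1]
  refine Dvd.dvd.mul_left (dvd_sub ?_ ?_) _
  · exact Dvd.dvd.mul_left (by omega) _
  · exact even_iff_two_dvd.1 (Int.even_mul_pred_self x)

theorem IsEven.isChar_zero {L : ILat} (h : L.IsEven) : L.IsChar 0 := fun x => by
  simpa using h x

theorem IsChar.left {L M : ILat} {c : L × M} (h : (L.prod M).IsChar c) : L.IsChar c.1 := fun x => by
  have := h (x, 0)
  rw [prod_form, prod_form] at this
  simpa using this

theorem IsChar.right {L M : ILat} {c : L × M} (h : (L.prod M).IsChar c) : M.IsChar c.2 := fun x => by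
  have := h (0, x)
  rw [prod_form, prod_form] at this
  simpa using this

theorem I1_char : ∀ (k : ℕ) {c : I1 k}, (I1 k).IsChar c → 8 ∣ (I1 k).form c c - (k - 1)
  | 0, (c : ℤ), h => by
    have h1 := h (1 : ℤ)
    change (2 : ℤ) ∣ (-1) * c * 1 - (-1) * 1 * 1 at h1
    change (8 : ℤ) ∣ (-1) * c * c - _
    obtain ⟨t, ht⟩ := h1
    obtain rfl : c = 1 - 2 * t := by linarith
    obtain ⟨s, hs⟩ := Int.even_mul_pred_self t
    exact ⟨-s, by push_cast; linear_combination (-4) * hs⟩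
  | k + 1, (c : ℤ × I1 k), h => by
    have ih := I1_char k (IsChar.right (L := rk1 1) (M := I1 k) (c := c) h)
    have h1 := IsChar.left (L := rk1 1) (M := I1 k) (c := c) h (1 : ℤ)
    rw [rk1_form, rk1_form] at h1
    change 8 ∣ (1 * c.1 * c.1 + (I1 k).form c.2 c.2) - _
    obtain ⟨t, ht⟩ := h1
    obtain ⟨u, hu⟩ := ih
    have h3 : c.1 = 1 + 2 * t := by linarith
    obtain ⟨s, hs⟩ := Int.even_mul_succ_self t
    rw [h3]
    exact ⟨s + u, by push_cast; linear_combination hu + 4 * hs⟩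

/-- Characteristic vectors of unimodular lattices of signature `(n - 1, 1)`. -/
theorem Lor.isChar_sq {X : ILat} (hX : X.Lor) (hu : X.Elem 1) {n : ℕ} (hn : X.rk = n)
    (h2 : 2 ≤ n) (h18 : n ≤ 18) {c : X} (hc : X.IsChar c) : 8 ∣ X.form c c - (n - 2) := by
  have hlor : ((rk1 1).prod X).Lor := (prod_comm _ _).lor (hX.prod (rk1_pos one_pos))
  have hel : ((rk1 1).prod X).Elem 1 := (rk1_elem 1).prod hu
  obtain ⟨e, he⟩ := hlor.odd_unimodular hel (k := n) (by rw [rk_prod, rk_rk1, hn, add_comm]) h2 h18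
    (g := ((1 : ℤ), (0 : X))) (by rw [prod_form, rk1_form]; simp)
  have hch : ((rk1 1).prod X).IsChar ((1 : ℤ), c) := (rk1_isChar (by norm_num)).prod hc
  have := I1_char n (hch.map he)
  rw [he, prod_form, rk1_form] at this
  convert this using 1
  ring

theorem Pos.isChar_sq {X : ILat} (hX : X.Pos) (hu : X.Elem 1) {n : ℕ} (hn : X.rk = n)
    (h1 : 1 ≤ n) (h17 : n ≤ 17) {c : X} (hc : X.IsChar c) : 8 ∣ X.form c c - n := by
  have := ((rk1_lor (by norm_num : (-1 : ℤ) < 0)).prod hX).isChar_sq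
    ((elem_one_of_d (by rw [d_rk1]; rfl)).prod hu) (n := n + 1) (by rw [rk_prod, rk_rk1, hn, add_comm])
    (by omega) (by omega) ((rk1_isChar (c := -1) (k := 1) (by norm_num)).prod hc)
  rw [prod_form, rk1_form] at this
  convert this using 1
  push_cast
  ring

/-! ### Passing from odd to even lattices -/

/-- `M ⊕ I_{1,1}`. -/
noncomputable abbrev oddHyp (M : ILat) : ILat := (rk1 1).prod ((rk1 (-1)).prod M)

theorem oddHyp_form (M : ILat) (x y : ℤ × ℤ × M) :
    (oddHyp M).form x y = x.1 * y.1 - x.2.1 * y.2.1 + M.form x.2.2 y.2.2 := by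
  rw [prod_form, prod_form, rk1_form, rk1_form]; ring

/-- The similarity `U ⊕ M → I_{1,1} ⊕ M` of norm four. -/
noncomputable def hypEmb (M : ILat) : (hyp.prod M) →ₗ[ℤ] (oddHyp M) :=
  AddMonoidHom.toIntLinearMap
    { toFun := fun x => (x.1.2 + 2 * x.1.1, x.1.2 - 2 * x.1.1, (2 : ℤ) • x.2)
      map_zero' := by simp
      map_add' := fun x y => by
        refine Prod.ext ?_ (Prod.ext ?_ ?_)
        · change (x.1.2 + y.1.2) + 2 * (x.1.1 + y.1.1) = _ + _; ring
        · change (x.1.2 + y.1.2) - 2 * (x.1.1 + y.1.1) = _ + _; ring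
        · change (2 : ℤ) • (x.2 + y.2) = _ + _; rw [smul_add] }

theorem hypEmb_apply (M : ILat) (x : (ℤ × ℤ) × M) :
    hypEmb M x = (x.1.2 + 2 * x.1.1, x.1.2 - 2 * x.1.1, (2 : ℤ) • x.2) := rfl

theorem hypEmb_form (M : ILat) (x y : (ℤ × ℤ) × M) :
    (oddHyp M).form (hypEmb M x) (hypEmb M y) = 4 * (hyp.prod M).form x y := by
  rw [oddHyp_form, prod_form, hyp_form, hypEmb_apply, hypEmb_apply]
  simp
  ring

theorem hypEmb_injective (M : ILat) : Function.Injective (hypEmb M) := by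
  refine (injective_iff_map_eq_zero _).2 fun x hx => ?_
  rw [hypEmb_apply] at hx
  have h1 : x.1.2 + 2 * x.1.1 = 0 := congrArg Prod.fst hx
  have h2 : x.1.2 - 2 * x.1.1 = 0 := congrArg (fun z => z.2.1) hx
  have h3 : (2 : ℤ) • x.2 = 0 := congrArg (fun z => z.2.2) hx
  refine Prod.ext (Prod.ext ?_ ?_) ?_
  · change x.1.1 = 0; omega
  · change x.1.2 = 0; omega
  · exact (smul_eq_zero.1 h3).resolve_left two_ne_zero

theorem mem_range_hypEmb {M : ILat} (hM : M.IsEven) (y : ℤ × ℤ × M) :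
    y ∈ LinearMap.range (hypEmb M) ↔ ∃ (x : oddHyp M) (n : ℤ), 2 ∣ (oddHyp M).form x x ∧
      y = (2 : ℤ) • x + n • (((1 : ℤ), (1 : ℤ), (0 : M)) : oddHyp M) := by
  constructor
  · rintro ⟨z, rfl⟩
    refine ⟨(2 * z.1.1, 0, z.2), z.1.2 - 2 * z.1.1, ?_, ?_⟩
    · rw [oddHyp_form]
      obtain ⟨t, ht⟩ := hM z.2
      exact ⟨2 * z.1.1 * z.1.1 + t, by change _ + M.form z.2 z.2 = _; rw [ht]; ring⟩
    · rw [hypEmb_apply]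
      refine Prod.ext ?_ (Prod.ext ?_ ?_)
      · change _ = 2 * (2 * z.1.1) + (z.1.2 - 2 * z.1.1) * 1; ring
      · change _ = 2 * 0 + (z.1.2 - 2 * z.1.1) * 1; ring
      · change _ = (2 : ℤ) • z.2 + (z.1.2 - 2 * z.1.1) • (0 : M); simp
  · rintro ⟨x, n, hx, rfl⟩
    obtain ⟨a, b, z⟩ := x
    rw [oddHyp_form] at hx
    have h1 : 2 ∣ a - b := by
      have h2 := hM z
      have h3 : a - b = (a * a - b * b + M.form z z) - M.form z z - a * (a - 1) + b * (b - 1) := by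
        ring
      rw [h3]
      exact dvd_add (dvd_sub (dvd_sub hx h2) (even_iff_two_dvd.1 (Int.even_mul_pred_self a)))
        (even_iff_two_dvd.1 (Int.even_mul_pred_self b))
    obtain ⟨t, ht⟩ := h1
    refine ⟨((t, a + b + n), z), ?_⟩
    rw [hypEmb_apply]
    refine Prod.ext ?_ (Prod.ext ?_ ?_)
    · change a + b + n + 2 * t = 2 * a + n * 1; linarith
    · change a + b + n - 2 * t = 2 * b + n * 1; linarith
    · change (2 : ℤ) • z = (2 : ℤ) • z + n • (0 : M); simp

theorem isom_of_similar {A B X Y : ILat} {k : ℤ} (hk : k ≠ 0) (i : A →ₗ[ℤ] X) (j : B →ₗ[ℤ] Y)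
    (hi : Function.Injective i) (hj : Function.Injective j)
    (hif : ∀ x y, X.form (i x) (i y) = k * A.form x y)
    (hjf : ∀ x y, Y.form (j x) (j y) = k * B.form x y) (e : X ≃ₗ[ℤ] Y)
    (he : ∀ x y, Y.form (e x) (e y) = X.form x y)
    (hr : ∀ y, y ∈ LinearMap.range i ↔ e y ∈ LinearMap.range j) : Isom A B := by
  let f : A →ₗ[ℤ] LinearMap.range j := LinearMap.codRestrict _ (e.toLinearMap ∘ₗ i)
    fun x => (hr _).1 ⟨x, rfl⟩
  let g := (LinearEquiv.ofInjective j hj).symm.toLinearMap ∘ₗ f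
  have hg : ∀ x, j (g x) = e (i x) := fun x => by
    have := (LinearEquiv.ofInjective j hj).apply_symm_apply (f x)
    exact congrArg Subtype.val this
  refine ⟨LinearEquiv.ofBijective g ⟨fun x y hxy => ?_, fun y => ?_⟩, fun x y => ?_⟩
  · have : j (g x) = j (g y) := by rw [hxy]
    rw [hg, hg] at this
    exact hi (e.injective this)
  · obtain ⟨x, hx⟩ := (hr (e.symm (j y))).2 (by simp)
    refine ⟨x, hj ?_⟩
    rw [hg, hx]; simp
  · refine mul_left_cancel₀ hk ?_
    change k * B.form (g x) (g y) = _
    rw [← hjf, ← hif, hg, hg, he]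

theorem hyp_prod_of_oddHyp {M N : ILat} (hM : M.IsEven) (hN : N.IsEven) {p : ℤ} (hp : ¬ 2 ∣ p)
    (hNp : N.Elem p) (h : Isom (oddHyp M) (oddHyp N)) : Isom (hyp.prod M) (hyp.prod N) := by
  have hchar : ∀ M : ILat, M.IsEven → (oddHyp M).IsChar ((1 : ℤ), (1 : ℤ), (0 : M)) := fun M hM =>
    (rk1_isChar (by norm_num)).prod ((rk1_isChar (by norm_num)).prod hM.isChar_zero)
  have hE : (oddHyp N).Elem p := by
    have h1 : ∀ c : ℤ, c * c = 1 → (rk1 c).Elem p := fun c hc => by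
      have : (rk1 c).Elem 1 := elem_one_of_d (by
        rw [d_rk1]; exact Int.isUnit_iff_natAbs_eq.1 (IsUnit.of_mul_eq_one _ hc))
      simpa using this.mul p
    exact (h1 1 (by norm_num)).prod ((h1 (-1) (by norm_num)).prod hNp)
  let c : oddHyp M := ((1 : ℤ), (1 : ℤ), (0 : M))
  let c' : oddHyp N := ((1 : ℤ), (1 : ℤ), (0 : N))
  have hdiff : ∀ {e : oddHyp M ≃ₗ[ℤ] oddHyp N},
      (∀ x y, (oddHyp N).form (e x) (e y) = (oddHyp M).form x y) →
      ∃ y, e c = c' + (2 : ℤ) • y := fun {e} he => by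
    obtain ⟨y, hy⟩ := hE.exists_two_smul hp (x := e c - c') fun y => by
      have h1 := (hchar M hM).map he y
      have h2 := hchar N hN y
      rw [map_sub, LinearMap.sub_apply]
      have := dvd_sub h1 h2
      rwa [sub_sub_sub_cancel_right] at this
    exact ⟨y, by rw [← hy]; abel⟩
  have hfin : ∀ {e : oddHyp M ≃ₗ[ℤ] oddHyp N},
      (∀ x y, (oddHyp N).form (e x) (e y) = (oddHyp M).form x y) →
      (∃ y, 2 ∣ (oddHyp N).form y y ∧ e c = c' + (2 : ℤ) • y) →
      Isom (hyp.prod M) (hyp.prod N) := fun {e} he ⟨y, hy, hc⟩ => by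
    have heven : ∀ (n : ℤ) {x y : oddHyp N}, 2 ∣ (oddHyp N).form x x → 2 ∣ (oddHyp N).form y y →
        2 ∣ (oddHyp N).form (x + n • y) (x + n • y) := fun n x y hx hy => by
      rw [form_add_sq, form_smul_sq]
      exact dvd_add (dvd_add hx (dvd_mul_right _ _)) (Dvd.dvd.mul_left hy _)
    refine isom_of_similar four_ne_zero (hypEmb M) (hypEmb N) (hypEmb_injective M)
      (hypEmb_injective N) (hypEmb_form M) (hypEmb_form N) e he fun z => ?_
    rw [mem_range_hypEmb hM, mem_range_hypEmb hN]
    constructor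
    · rintro ⟨x, n, hx, rfl⟩
      refine ⟨e x + n • y, n, heven n (by rwa [he]) hy, ?_⟩
      change e ((2 : ℤ) • x + n • c) = _ + n • c'
      rw [map_add, map_smul, map_smul, hc]
      module
    · rintro ⟨x, n, hx, hxz⟩
      obtain ⟨x', hx'⟩ := e.surjective (x + (-n) • y)
      refine ⟨x', n, by rw [← he, hx']; exact heven _ hx hy, e.injective ?_⟩
      change e z = e ((2 : ℤ) • x' + n • c)
      rw [hxz, map_add, map_smul, map_smul, hx', hc]
      change (2 : ℤ) • x + n • c' = _
      module
  obtain ⟨e, he⟩ := h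
  obtain ⟨y, hy⟩ := hdiff he
  by_cases hy2 : 2 ∣ (oddHyp N).form y y
  · exact hfin he ⟨y, hy2, hy⟩
  · let σ : oddHyp N ≃ₗ[ℤ] oddHyp N :=
      ((AddEquiv.neg ℤ).prodCongr (AddEquiv.refl (ℤ × N))).toIntLinearEquiv
    have hσ : ∀ x, σ x = (-x.1, x.2) := fun x => rfl
    have hσf : ∀ x y, (oddHyp N).form (σ x) (σ y) = (oddHyp N).form x y := fun x y => by
      rw [oddHyp_form, oddHyp_form, hσ, hσ]; ring
    refine hfin (e := e.trans σ) (fun x y => (hσf _ _).trans (he x y))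
      ⟨σ y + (-1 : ℤ) • (((1 : ℤ), (0 : ℤ), (0 : N)) : oddHyp N), ?_, ?_⟩
    · rw [form_add_sq, form_smul_sq, hσf]
      have : (oddHyp N).form (((1 : ℤ), (0 : ℤ), (0 : N)) : oddHyp N) ((1 : ℤ), (0 : ℤ), (0 : N)) = 1 := by
        rw [oddHyp_form]; simp
      rw [this, map_smul, smul_eq_mul]
      omega
    · change σ (e c) = _
      rw [hy, map_add, map_smul, smul_add]
      have : σ c' = c' + (2 : ℤ) • (-1 : ℤ) • (((1 : ℤ), (0 : ℤ), (0 : N)) : oddHyp N) := by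
        rw [hσ]
        refine Prod.ext ?_ (Prod.ext ?_ ?_)
        · change (-1 : ℤ) = 1 + 2 * (-1 * 1); norm_num
        · change (1 : ℤ) = 1 + 2 * (-1 * 0); norm_num
        · change (0 : N) = 0 + (2 : ℤ) • (-1 : ℤ) • (0 : N); simp
      rw [this]; abel


/-- `i : L → L'` embeds `L` into the overlattice `L' = L + ℤ ξ` with `p ξ = x`. -/
structure Over (p : ℤ) {L L' : ILat} (i : L →ₗ[ℤ] L') (x : L) (ξ : L') : Prop where
  form : ∀ y z, L'.form (i y) (i z) = L.form y z
  inj : Function.Injective i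
  smul : p • ξ = i x
  gen : ∀ y, ∃ (z : L) (n : ℤ), y = i z + n • ξ
  rk : L'.rk = L.rk

theorem exists_over {p : ℤ} (hp : p ≠ 0) {L : ILat} {x : L} (hx : x ∈ L.R p)
    (hx2 : p ^ 2 ∣ L.form x x) : ∃ (L' : ILat) (i : L →ₗ[ℤ] L') (ξ : L'), Over p i x ξ := by
  set S : Submodule ℤ L := LinearMap.range (p • (LinearMap.id : L →ₗ[ℤ] L)) ⊔ Submodule.span ℤ {x}
    with hS
  have hmem : ∀ y, y ∈ S ↔ ∃ (z : L) (n : ℤ), y = p • z + n • x := by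
    intro y
    rw [hS, Submodule.mem_sup]
    constructor
    · rintro ⟨_, ⟨z, rfl⟩, b, hb, rfl⟩
      obtain ⟨n, rfl⟩ := Submodule.mem_span_singleton.1 hb
      exact ⟨z, n, rfl⟩
    · rintro ⟨z, n, rfl⟩
      exact ⟨_, ⟨z, rfl⟩, _, Submodule.mem_span_singleton.2 ⟨n, rfl⟩, rfl⟩
  have hdvd : ∀ y z : L.res S, p ^ 2 ∣ (L.res S).form y z := by
    rintro ⟨y, hy⟩ ⟨z, hz⟩
    obtain ⟨y, n, rfl⟩ := (hmem y).1 hy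
    obtain ⟨z, k, rfl⟩ := (hmem z).1 hz
    obtain ⟨c, hc⟩ := hx2
    obtain ⟨s, hs⟩ := hx z
    obtain ⟨t, ht⟩ := hx y
    rw [L.symm] at ht
    rw [res_form]
    refine ⟨L.form y z + k * t + n * s + n * k * c, ?_⟩
    simp only [map_add, map_smul, LinearMap.add_apply, LinearMap.smul_apply, smul_eq_mul, hc, hs, ht]
    ring
  have hin : ∀ z, p • z ∈ S := fun z => (hmem _).2 ⟨z, 0, by simp⟩
  refine ⟨(L.res S).down (p ^ 2) hdvd, LinearMap.codRestrict S (p • LinearMap.id) hin,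
    ⟨x, (hmem _).2 ⟨0, 1, by simp⟩⟩, ?_, ?_, ?_, ?_, ?_⟩
  · intro y z
    apply mul_left_cancel₀ (pow_ne_zero 2 hp)
    rw [down_form, res_form]
    simp only [LinearMap.codRestrict_apply, LinearMap.smul_apply, LinearMap.id_coe, id_eq, map_smul,
      smul_eq_mul]
    ring
  · intro y z h
    have h1 := congrArg Subtype.val h
    simp only [LinearMap.codRestrict_apply, LinearMap.smul_apply, LinearMap.id_coe, id_eq] at h1
    exact smul_cancel hp h1
  · apply Subtype.ext
    rfl
  · rintro ⟨y, hy⟩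
    obtain ⟨z, n, rfl⟩ := (hmem y).1 hy
    exact ⟨z, n, Subtype.ext rfl⟩
  · rw [rk_down]
    exact rk_res L S hp hin

/-- The index-`p` sublattice of vectors orthogonal to `w` modulo `p`. -/
def kerp (L : ILat) (p : ℤ) (w : L) : Submodule ℤ L where
  carrier := {y | p ∣ L.form w y}
  zero_mem' := by simp
  add_mem' := fun {a b} ha hb => by
    change p ∣ _
    rw [map_add]
    exact dvd_add ha hb
  smul_mem' := fun c a ha => by
    change p ∣ _
    rw [map_smul]
    exact Dvd.dvd.mul_left ha c

theorem mem_kerp {L : ILat} {p : ℤ} {w y : L} : y ∈ L.kerp p w ↔ p ∣ L.form w y := Iff.rfl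

namespace Over
variable {p : ℤ} {L L' : ILat} {i : L →ₗ[ℤ] L'} {x : L} {ξ : L'}

theorem exists_smul (h : Over p i x ξ) (y : L') : ∃ z, p • y = i z := by
  obtain ⟨z, n, rfl⟩ := h.gen y
  refine ⟨p • z + n • x, ?_⟩
  rw [map_add, map_smul, map_smul, ← h.smul, smul_add, smul_comm]

theorem pos (h : Over p i x ξ) (hp : p ≠ 0) (hL : L.Pos) : L'.Pos := by
  intro y hy
  obtain ⟨z, hz⟩ := h.exists_smul y
  have hz0 : z ≠ 0 := by
    rintro rfl
    rw [map_zero] at hz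
    exact smul_ne_zero' hp hy hz
  have h1 := hL z hz0
  rw [← h.form, ← hz, form_smul_sq] at h1
  exact pos_of_mul_pos_right h1 (sq_nonneg p)

theorem lor (h : Over p i x ξ) (hp : p ≠ 0) (hL : L.Lor) : L'.Lor := by
  obtain ⟨v, hv, hpos⟩ := hL
  refine ⟨i v, by rwa [h.form], fun y hy hyv => ?_⟩
  obtain ⟨z, hz⟩ := h.exists_smul y
  have hz0 : z ≠ 0 := by
    rintro rfl
    rw [map_zero] at hz
    exact smul_ne_zero' hp hy hz
  have h1 := hpos z hz0 (by
    rw [← h.form, ← hz, map_smul, LinearMap.smul_apply, hyv, smul_zero])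
  rw [← h.form, ← hz, form_smul_sq] at h1
  exact pos_of_mul_pos_right h1 (sq_nonneg p)

theorem sq (h : Over p i x ξ) : p ^ 2 * L'.form ξ ξ = L.form x x := by
  rw [← form_smul_sq, h.smul, h.form]

theorem form_left (h : Over p i x ξ) (z : L) : p * L'.form (i z) ξ = L.form z x := by
  rw [← smul_eq_mul, ← map_smul, h.smul, h.form]

theorem isEven (h : Over p i x ξ) (hp : p ≠ 0) (hL : L.IsEven) (hx : 2 * p ^ 2 ∣ L.form x x) :
    L'.IsEven := by
  intro y
  obtain ⟨z, n, rfl⟩ := h.gen y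
  have h2 : 2 ∣ L'.form ξ ξ := by
    rw [← h.sq, mul_comm 2] at hx
    exact (mul_dvd_mul_iff_left (pow_ne_zero 2 hp)).1 hx
  rw [form_add_sq, form_smul_sq, h.form]
  exact dvd_add (dvd_add (hL z) ⟨L'.form (i z) (n • ξ), by ring⟩) (Dvd.dvd.mul_left h2 _)

theorem elem (h : Over p i x ξ) (hp : p ≠ 0) {k : ℤ} (hL : L.Elem k) : L'.Elem k := by
  intro φ
  obtain ⟨u, hu⟩ := hL (φ ∘ₗ i)
  refine ⟨i u, fun y => ?_⟩
  obtain ⟨z, hz⟩ := h.exists_smul y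
  apply mul_left_cancel₀ hp
  rw [← smul_eq_mul, ← map_smul, hz, h.form, hu, LinearMap.comp_apply, ← hz, map_smul, smul_eq_mul]
  ring

theorem e2 (h : Over p i x ξ) (hp : p ≠ 0) (hE : L.Elem p) (hL : L.E2 p) : L'.E2 p := by
  intro s hs
  have hnd := (h.elem hp hE).nondeg hp
  choose f hf using hs
  let φ : L →ₗ[ℤ] ℤ :=
    { toFun := fun y => f (i y)
      map_add' := fun a b => by
        apply mul_left_cancel₀ hp
        rw [mul_add, ← hf, ← hf, ← hf, map_add, map_add]
      map_smul' := fun a b => by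
        apply mul_left_cancel₀ hp
        rw [← hf, map_smul, map_smul, hf, RingHom.id_apply, smul_eq_mul, smul_eq_mul]
        ring }
  obtain ⟨u, hu⟩ := hE φ
  have hus : i u = s := by
    rw [← sub_eq_zero]
    apply hnd
    intro y
    obtain ⟨z, hz⟩ := h.exists_smul y
    apply (mul_eq_zero.1 (?_ : p * _ = 0)).resolve_left hp
    rw [← smul_eq_mul, ← map_smul, hz, map_sub, LinearMap.sub_apply, h.form, hu, hf]
    exact sub_self _
  rw [← hus, h.form]
  exact hL u fun y => ⟨_, hu y⟩

theorem dvd_of_smul_mem (h : Over p i x ξ) (hp : Prime p) (hx : ¬ ∃ y, x = p • y) {n : ℤ}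
    (hn : n • ξ ∈ LinearMap.range i) : p ∣ n := by
  obtain ⟨z, hz⟩ := hn
  by_contra hpn
  obtain ⟨a, b, hab⟩ := (hp.coprime_iff_not_dvd).2 hpn
  apply hx
  refine ⟨a • x + b • z, h.inj ?_⟩
  rw [map_smul, map_add, map_smul, map_smul, hz, ← h.smul, smul_smul, smul_smul, ← add_smul, hab,
    one_smul]

theorem d_eq (h : Over p i x ξ) (hp : Prime p) (hx : ¬ ∃ y, x = p • y) :
    L.d = L'.d * p.natAbs ^ 2 := by
  have hiso : Isom L (L'.res (LinearMap.range i)) :=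
    ⟨LinearEquiv.ofInjective i h.inj, fun y z => h.form y z⟩
  have hcard : Nat.card (L' ⧸ LinearMap.range i) = p.natAbs := by
    let f : ℤ →+ L' ⧸ LinearMap.range i :=
      (LinearMap.toSpanSingleton ℤ (L' ⧸ LinearMap.range i) (Submodule.Quotient.mk ξ)).toAddMonoidHom
    have hf : ∀ n : ℤ, f n = Submodule.Quotient.mk (n • ξ) := fun n => rfl
    have hs : Function.Surjective f := by
      intro y
      obtain ⟨y, rfl⟩ := Submodule.Quotient.mk_surjective _ y
      obtain ⟨z, n, rfl⟩ := h.gen y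
      refine ⟨n, ?_⟩
      rw [hf, Submodule.Quotient.eq]
      exact ⟨-z, by rw [map_neg]; abel⟩
    have hk : f.ker = AddSubgroup.zmultiples p := by
      ext n
      rw [AddMonoidHom.mem_ker, hf, Submodule.Quotient.mk_eq_zero, Int.mem_zmultiples_iff]
      refine ⟨h.dvd_of_smul_mem hp hx, ?_⟩
      rintro ⟨k, rfl⟩
      exact ⟨k • x, by rw [map_smul, ← h.smul, smul_smul, mul_comm]⟩
    rw [← Nat.card_congr (QuotientAddGroup.quotientKerEquivOfSurjective f hs).toEquiv, hk]
    exact Int.index_zmultiples p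
  rw [hiso.d, d_res _ _ (by rw [← hiso.rk, h.rk]), hcard]

/-- The sublattice `L` of the overlattice `L'` is cut out by a congruence. -/
theorem exists_kerp (h : Over p i x ξ) (hp : Prime p) (hE : L.Elem p) (hx : ¬ ∃ y, x = p • y) :
    ∃ u ∈ L.R p, i u ∉ L'.R p ∧ Isom L (L'.res (L'.kerp p (i u))) := by
  obtain ⟨φ, hφ⟩ := exists_functional_not_dvd hx
  obtain ⟨u, hu⟩ := hE φ
  have hξ : L'.form (i u) ξ = φ x := by
    apply mul_left_cancel₀ hp.ne_zero
    rw [h.form_left, hu]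
  refine ⟨u, fun y => ⟨_, hu y⟩, fun hR => hφ (hξ ▸ hR ξ), ?_⟩
  have hker : LinearMap.range i = L'.kerp p (i u) := by
    ext y
    rw [mem_kerp]
    constructor
    · rintro ⟨z, rfl⟩
      rw [h.form, hu]
      exact dvd_mul_right _ _
    · obtain ⟨z, n, rfl⟩ := h.gen y
      intro hd
      rw [map_add, h.form, hu, map_smul, hξ, smul_eq_mul,
        dvd_add_right (dvd_mul_right _ _)] at hd
      obtain ⟨k, rfl⟩ := (hp.dvd_or_dvd hd).resolve_right hφ
      exact ⟨z + k • x, by rw [map_add, map_smul, ← h.smul, smul_smul, mul_comm]⟩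
  rw [← hker]
  exact ⟨LinearEquiv.ofInjective i h.inj, fun y z => h.form y z⟩

end Over


theorem res_isom {L M : ILat} (e : L ≃ₗ[ℤ] M) (he : ∀ x y, M.form (e x) (e y) = L.form x y)
    {S : Submodule ℤ L} {T : Submodule ℤ M} (h : ∀ x, x ∈ S ↔ e x ∈ T) :
    Isom (L.res S) (M.res T) := by
  refine ⟨e.ofSubmodules S T ?_, fun x y => he x y⟩
  ext y
  constructor
  · rintro ⟨x, hx, rfl⟩
    exact (h x).1 hx
  · intro hy
    exact ⟨e.symm y, (h _).2 (by simpa using hy), by simp⟩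

theorem kerp_isom {L M : ILat} {p : ℤ} (e : L ≃ₗ[ℤ] M)
    (he : ∀ x y, M.form (e x) (e y) = L.form x y) (w : L) :
    Isom (L.res (L.kerp p w)) (M.res (M.kerp p (e w))) :=
  res_isom e he fun x => by rw [mem_kerp, mem_kerp, he]

theorem kerp_eq {L : ILat} {p : ℤ} (hp : Prime p) {w v : L} {c : ℤ} (hc : ¬ p ∣ c)
    (h : w - c • v ∈ L.R p) : L.kerp p w = L.kerp p v := by
  ext y
  rw [mem_kerp, mem_kerp]
  have h1 := h y
  rw [map_sub, LinearMap.sub_apply, map_smul, LinearMap.smul_apply, smul_eq_mul] at h1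
  rw [← (dvd_iff_dvd_of_dvd_sub h1).symm]
  exact ⟨fun h => (hp.dvd_or_dvd h).resolve_left hc, fun h => Dvd.dvd.mul_left h c⟩

theorem mem_R_hyp_prod {M : ILat} {p α β : ℤ} {m : M} :
    (((α, β), m) : (ℤ × ℤ) × M) ∈ (hyp.prod M).R p ↔ p ∣ α ∧ p ∣ β ∧ m ∈ M.R p := by
  rw [mem_R_prod]
  constructor
  · rintro ⟨h, hm⟩
    refine ⟨?_, ?_, hm⟩
    · simpa [hyp_form] using h ((0, 1) : ℤ × ℤ)
    · simpa [hyp_form] using h ((1, 0) : ℤ × ℤ)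
  · rintro ⟨ha, hb, hm⟩
    refine ⟨fun y => ?_, hm⟩
    rw [hyp_form]
    exact dvd_add (Dvd.dvd.mul_right ha _) (Dvd.dvd.mul_right hb _)

theorem exists_swap (M : ILat) : ∃ e : hyp.prod M ≃ₗ[ℤ] hyp.prod M,
    (∀ x y, (hyp.prod M).form (e x) (e y) = (hyp.prod M).form x y) ∧
      ∀ α β m, e ((α, β), m) = ((β, α), m) := by
  let e : (ℤ × ℤ) × M ≃+ (ℤ × ℤ) × M := (AddEquiv.prodComm).prodCongr (AddEquiv.refl M)
  refine ⟨e.toIntLinearEquiv, ?_, fun _ _ _ => rfl⟩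
  rintro ⟨⟨a, b⟩, m⟩ ⟨⟨a', b'⟩, m'⟩
  change (hyp.prod M).form ((b, a), m) ((b', a'), m') = _
  rw [prod_form, prod_form, hyp_form, hyp_form]
  ring

/-- Eichler transvections of `U ⊕ M`. -/
theorem exists_eichler {M : ILat} (hM : M.IsEven) (y : M) : ∃ e : hyp.prod M ≃ₗ[ℤ] hyp.prod M,
    (∀ x y, (hyp.prod M).form (e x) (e y) = (hyp.prod M).form x y) ∧
      ∃ k, 2 * k = M.form y y ∧
        ∀ α β m, e ((α, β), m) = ((α - M.form m y - β * k, β), m + β • y) := by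
  obtain ⟨k, hk⟩ := hM y
  let e : (ℤ × ℤ) × M ≃+ (ℤ × ℤ) × M :=
    { toFun := fun x => ((x.1.1 - M.form x.2 y - x.1.2 * k, x.1.2), x.2 + x.1.2 • y)
      invFun := fun x => ((x.1.1 + M.form x.2 y - x.1.2 * k, x.1.2), x.2 - x.1.2 • y)
      left_inv := by
        rintro ⟨⟨a, b⟩, m⟩
        simp only [map_add, LinearMap.add_apply, map_smul, LinearMap.smul_apply, hk, smul_eq_mul,
          add_sub_cancel_right, Prod.mk.injEq, and_true]
        ring
      right_inv := by
        rintro ⟨⟨a, b⟩, m⟩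
        simp only [map_sub, LinearMap.sub_apply, map_smul, LinearMap.smul_apply, hk, smul_eq_mul,
          sub_add_cancel, Prod.mk.injEq, and_true]
        ring
      map_add' := by
        rintro ⟨⟨a, b⟩, m⟩ ⟨⟨a', b'⟩, m'⟩
        simp only [Prod.mk_add_mk, map_add, LinearMap.add_apply, Prod.mk.injEq]
        refine ⟨⟨by ring, trivial⟩, ?_⟩
        rw [add_smul]
        abel }
  refine ⟨e.toIntLinearEquiv, ?_, k, hk.symm, fun _ _ _ => rfl⟩
  rintro ⟨⟨a, b⟩, m⟩ ⟨⟨a', b'⟩, m'⟩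
  change (hyp.prod M).form ((a - M.form m y - b * k, b), m + b • y)
    ((a' - M.form m' y - b' * k, b'), m' + b' • y) = _
  rw [prod_form, prod_form, hyp_form, hyp_form]
  simp only [map_add, LinearMap.add_apply, map_smul, LinearMap.smul_apply, hk, smul_eq_mul, M.symm y m']
  ring

/-- All index-`p` sublattices of `U ⊕ M` defined by singular vectors are isometric. -/
theorem kerp_hyp_isom {M : ILat} (hM : M.IsEven) {p : ℤ} (hp : Prime p) {w : hyp.prod M}
    (hw : w ∉ (hyp.prod M).R p) (hw2 : 2 * p ∣ (hyp.prod M).form w w) :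
    Isom ((hyp.prod M).res ((hyp.prod M).kerp p w))
      ((hyp.prod M).res ((hyp.prod M).kerp p (((1, 0), 0) : (ℤ × ℤ) × M))) := by
  obtain ⟨es, hes, hsw⟩ := exists_swap M
  have hform : ∀ α β (m : M), (hyp.prod M).form (((α, β), m) : (ℤ × ℤ) × M) ((α, β), m) =
      2 * (α * β) + M.form m m := fun α β m => by rw [prod_form, hyp_form]; ring
  have h0 : ∀ α β (m : M), ¬ p ∣ β →
      2 * p ∣ (hyp.prod M).form (((α, β), m) : (ℤ × ℤ) × M) ((α, β), m) →
      Isom ((hyp.prod M).res ((hyp.prod M).kerp p (((α, β), m) : (ℤ × ℤ) × M)))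
        ((hyp.prod M).res ((hyp.prod M).kerp p (((1, 0), 0) : (ℤ × ℤ) × M))) := by
    intro α β m hβ h2
    obtain ⟨s, b, hb⟩ := (hp.coprime_iff_not_dvd).2 hβ
    obtain ⟨e, he, k, -, hk⟩ := exists_eichler hM (-b • m)
    have h3 := h2
    rw [← he, hk, hform] at h3
    have hm : m + β • -b • m = p • s • m := by
      rw [smul_smul, smul_smul]
      nth_rewrite 1 [← one_smul ℤ m]
      rw [← add_smul, ← hb]
      congr 1
      ring
    have hm2 : 2 * p ∣ M.form (m + β • -b • m) (m + β • -b • m) := by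
      rw [hm, form_smul_sq]
      obtain ⟨t, ht⟩ := hM (s • m)
      exact ⟨p * t, by rw [ht]; ring⟩
    rw [dvd_add_left hm2, mul_dvd_mul_iff_left two_ne_zero] at h3
    have h4 := (hp.dvd_or_dvd h3).resolve_right hβ
    refine (kerp_isom e he _).trans ((kerp_isom es hes _).trans ?_)
    rw [hk, hsw, kerp_eq (v := (((1, 0), 0) : (ℤ × ℤ) × M)) hp hβ]
    · exact Isom.refl _
    · have : ∀ A : ℤ, ∀ m' : M, (((β, A), m') : (ℤ × ℤ) × M) - β • (((1, 0), 0) : (ℤ × ℤ) × M) =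
          ((0, A), m') := fun A m' => by
        ext <;> simp
      rw [this, mem_R_hyp_prod, hm]
      exact ⟨dvd_zero _, h4, fun y => by simp⟩
  have h1 : ∀ α β (m : M), ¬ p ∣ α →
      2 * p ∣ (hyp.prod M).form (((α, β), m) : (ℤ × ℤ) × M) ((α, β), m) →
      Isom ((hyp.prod M).res ((hyp.prod M).kerp p (((α, β), m) : (ℤ × ℤ) × M)))
        ((hyp.prod M).res ((hyp.prod M).kerp p (((1, 0), 0) : (ℤ × ℤ) × M))) := by
    intro α β m hα h2
    refine (kerp_isom es hes _).trans ?_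
    rw [hsw]
    exact h0 _ _ _ hα (by rw [← hsw, hes]; exact h2)
  obtain ⟨⟨α, β⟩, m⟩ := w
  by_cases hβ : p ∣ β
  · by_cases hα : p ∣ α
    · have hm : m ∉ M.R p := fun h => hw (mem_R_hyp_prod.2 ⟨hα, hβ, h⟩)
      rw [mem_R] at hm
      push Not at hm
      obtain ⟨y, hy⟩ := hm
      obtain ⟨e, he, k, -, hk⟩ := exists_eichler hM y
      refine (kerp_isom e he _).trans ?_
      rw [← he] at hw2
      rw [hk] at hw2 ⊢
      refine h1 _ _ _ (fun h => hy ?_) hw2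
      have h5 : M.form m y = α - (α - M.form m y - β * k) - β * k := by ring
      rw [h5]
      exact dvd_sub (dvd_sub hα h) (Dvd.dvd.mul_right hβ k)
    · exact h1 _ _ _ hα hw2
  · exact h0 _ _ _ hβ hw2

theorem kerp_hyp_right {M : ILat} {p : ℤ} (w : M) :
    Isom ((hyp.prod M).res ((hyp.prod M).kerp p (((0, 0), w) : (ℤ × ℤ) × M)))
      (hyp.prod (M.res (M.kerp p w))) := by
  have hmem : ∀ x : (ℤ × ℤ) × M, x ∈ (hyp.prod M).kerp p (((0, 0), w) : (ℤ × ℤ) × M) ↔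
      x.2 ∈ M.kerp p w := fun x => by
    rw [mem_kerp, mem_kerp, prod_form, hyp_form]
    simp
  let e : (hyp.prod M).kerp p (((0, 0), w) : (ℤ × ℤ) × M) ≃+ (ℤ × ℤ) × M.kerp p w :=
    { toFun := fun x => (x.1.1, ⟨x.1.2, (hmem _).1 x.2⟩)
      invFun := fun x => ⟨(x.1, x.2.1), (hmem _).2 x.2.2⟩
      left_inv := fun x => rfl
      right_inv := fun x => rfl
      map_add' := fun x y => rfl }
  exact ⟨e.toIntLinearEquiv, fun x y => rfl⟩

theorem exists_singular {p : ℕ} (hp : p.Prime) {L : ILat} {K S : Submodule ℤ L}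
    (hpS : ∀ x ∈ S, (p : ℤ) • x ∈ K) {j : ℕ} (hj : ridx K S = p ^ j) (h3 : 3 ≤ j) {s : ℤ}
    (h1 : ∀ x ∈ S, s ∣ L.form x x)
    (h2 : ∀ x ∈ S, ∀ y ∈ S, s ∣ 2 * L.form x y) : ∃ x ∈ S, x ∉ K ∧ s * p ∣ L.form x x := by
  obtain ⟨b, hb, hind, -⟩ := quotient_basis hp hpS hj
  let i0 : Fin j := ⟨0, by omega⟩
  let i1 : Fin j := ⟨1, by omega⟩
  let i2 : Fin j := ⟨2, by omega⟩
  have h01 : i0 ≠ i1 := by simp [i0, i1]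
  have h02 : i0 ≠ i2 := by simp [i0, i2]
  have h12 : i1 ≠ i2 := by simp [i1, i2]
  obtain ⟨A, hA⟩ := h1 _ (hb i0)
  obtain ⟨B, hB⟩ := h1 _ (hb i1)
  obtain ⟨C, hC⟩ := h1 _ (hb i2)
  obtain ⟨D, hD⟩ := h2 _ (hb i0) _ (hb i1)
  obtain ⟨E, hE⟩ := h2 _ (hb i0) _ (hb i2)
  obtain ⟨F, hF⟩ := h2 _ (hb i1) _ (hb i2)
  obtain ⟨x, y, z, hnz, t, ht⟩ := ternary_isotropic hp A B C D E F
  refine ⟨x • b i0 + y • b i1 + z • b i2,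
    S.add_mem (S.add_mem (S.smul_mem _ (hb _)) (S.smul_mem _ (hb _))) (S.smul_mem _ (hb _)), ?_, t, ?_⟩
  · intro hK
    have h := hind (Pi.single i0 x + Pi.single i1 y + Pi.single i2 z) (by
      simpa [add_smul, Finset.sum_add_distrib, Pi.single_apply, ite_smul] using hK)
    apply hnz
    have e0 := h i0
    have e1 := h i1
    have e2 := h i2
    simp [h01, h02, h12, h01.symm, h02.symm, h12.symm] at e0 e1 e2
    exact ⟨e0, e1, e2⟩
  · rw [form_add_sq, form_add_sq, form_smul_sq, form_smul_sq, form_smul_sq]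
    simp only [map_add, LinearMap.add_apply, map_smul, LinearMap.smul_apply, smul_eq_mul]
    linear_combination x ^ 2 * hA + y ^ 2 * hB + z ^ 2 * hC + x * y * hD + x * z * hE + y * z * hF +
      s * ht


/-- Even Lorentzian lattices of rank `n`, determinant `p ^ a` and level `p`. -/
structure Gen (p n a : ℕ) (L : ILat) : Prop where
  even : L.IsEven
  lor : L.Lor
  rk : L.rk = n
  d : L.d = p ^ a
  elem : L.Elem p
  e2 : L.E2 p

/-- Uniqueness of `Gen p n a` up to isometry, together with the splitting of a hyperbolic plane. -/
def OneClass (p n a : ℕ) : Prop :=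
  (∀ L L', Gen p n a L → Gen p n a L' → Isom L L') ∧ ∀ L, Gen p n a L → ∃ M, Isom L (hyp.prod M)

theorem Gen.isom {p n a : ℕ} {L M : ILat} (h : Gen p n a L) (e : Isom L M) : Gen p n a M :=
  ⟨e.isEven h.even, e.lor h.lor, e.rk ▸ h.rk, e.d ▸ h.d, e.elem h.elem, e.e2 h.e2⟩

theorem Gen.mem_R_singular {p n a : ℕ} {L : ILat} (hp : p.Prime) (h : Gen p n a L) (ha : 3 ≤ a) :
    ∃ x ∈ L.R p, (¬ ∃ y, x = (p : ℤ) • y) ∧ 2 * (p : ℤ) ^ 2 ∣ L.form x x := by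
  obtain ⟨x, hx, hxp, hx2⟩ := exists_singular hp (K := L.pm p) (S := L.R p)
    (fun x _ => mem_pm.2 ⟨x, rfl⟩) ((ridx_pm_R hp.ne_zero h.elem).trans h.d) ha (s := 2 * p)
    (fun x hx => h.e2 x hx) (fun x hx y _ => mul_dvd_mul_left 2 (hx y))
  refine ⟨x, hx, fun hy => hxp (mem_pm.2 hy), ?_⟩
  rwa [sq, ← mul_assoc]

theorem Gen.over {p n a : ℕ} {L L' : ILat} (hp : p.Prime) (h : Gen p n (a + 2) L)
    {i : L →ₗ[ℤ] L'} {x : L} {ξ : L'} (ho : Over p i x ξ) (hx : ¬ ∃ y, x = (p : ℤ) • y)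
    (hx2 : 2 * (p : ℤ) ^ 2 ∣ L.form x x) : Gen p n a L' := by
  have hp0 : (p : ℤ) ≠ 0 := Int.natCast_ne_zero.2 hp.ne_zero
  refine ⟨ho.isEven hp0 h.even hx2, ho.lor hp0 h.lor, ho.rk.trans h.rk, ?_, ho.elem hp0 h.elem,
    ho.e2 hp0 h.elem h.e2⟩
  have h1 := ho.d_eq (Nat.prime_iff_prime_int.1 hp) hx
  rw [h.d, Int.natAbs_natCast, pow_add] at h1
  exact (Nat.eq_of_mul_eq_mul_right (pow_pos hp.pos 2) h1).symm

/-- Passing from `p ^ a` to `p ^ (a + 2)`. -/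
theorem OneClass.step {p n a : ℕ} (hp : p.Prime) (ha : a + 5 ≤ n) (hC : OneClass p n a)
    (hs : ∀ L, Gen p n (a + 2) L →
      ∃ x ∈ L.R p, (¬ ∃ y, x = (p : ℤ) • y) ∧ 2 * (p : ℤ) ^ 2 ∣ L.form x x) :
    OneClass p n (a + 2) := by
  have hp0 : (p : ℤ) ≠ 0 := Int.natCast_ne_zero.2 hp.ne_zero
  have hpp : Prime (p : ℤ) := Nat.prime_iff_prime_int.1 hp
  have key : ∀ L, Gen p n (a + 2) L → ∃ L', Gen p n a L' ∧ ∀ M, Isom L' (hyp.prod M) →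
      Isom L ((hyp.prod M).res ((hyp.prod M).kerp p (((1, 0), 0) : (ℤ × ℤ) × M))) := by
    intro L hL
    obtain ⟨x, hx, hxp, hx2⟩ := hs L hL
    obtain ⟨L', i, ξ, ho⟩ := exists_over hp0 hx (Dvd.dvd.trans (dvd_mul_left _ _) hx2)
    have hG := hL.over hp ho hxp hx2
    refine ⟨L', hG, fun M hM => ?_⟩
    obtain ⟨u, hu, hw, hiso⟩ := ho.exists_kerp hpp hL.elem hxp
    obtain ⟨e, he⟩ := hM
    refine hiso.trans ((kerp_isom e he _).trans (kerp_hyp_isom (hG.isom ⟨e, he⟩).even.right hpp ?_ ?_))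
    · rwa [Isom.mem_R he]
    · rw [he, ho.form]
      exact hL.e2 u hu
  have hex : ∀ L, Gen p n (a + 2) L → ∃ M, Isom L (hyp.prod M) := by
    intro L hL
    obtain ⟨L', hG, hL'⟩ := key L hL
    obtain ⟨M, hM⟩ := hC.2 L' hG
    have hGM := hG.isom hM
    have hrk : M.rk = a + (n - 2 - a) := by
      have := hGM.rk
      rw [rk_prod, rk_hyp] at this
      omega
    have hd : M.d = p ^ a := by
      have := hGM.d
      rwa [d_prod, d_hyp, one_mul] at this
    obtain ⟨w, -, hw, hw2⟩ := exists_singular hp (K := M.R p) (S := ⊤)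
      (fun x _ y => by simp) (ridx_R_top hp hGM.elem.right hd hrk) (by omega) (s := 2)
      (fun x _ => hGM.even.right x) (fun x _ y _ => dvd_mul_right _ _)
    refine ⟨_, (hL' M hM).trans ((kerp_hyp_isom hGM.even.right hpp (w := (((0, 0), w) : (ℤ × ℤ) × M))
      (fun h => hw (mem_R_hyp_prod.1 h).2.2) ?_).symm.trans (kerp_hyp_right w))⟩
    rw [prod_form]
    simpa [hyp_form] using hw2
  refine ⟨fun L₁ L₂ h1 h2 => ?_, hex⟩
  obtain ⟨L₁', hG1, hL1⟩ := key L₁ h1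
  obtain ⟨L₂', hG2, hL2⟩ := key L₂ h2
  obtain ⟨M, hM⟩ := hC.2 L₁' hG1
  exact (hL1 M hM).trans (hL2 M ((hC.1 _ _ hG2 hG1).trans hM)).symm

theorem OneClass.step_of_one_le {p n a : ℕ} (hp : p.Prime) (h1 : 1 ≤ a) (ha : a + 5 ≤ n)
    (hC : OneClass p n a) : OneClass p n (a + 2) :=
  hC.step hp ha fun _ hL => hL.mem_R_singular hp (by omega)

theorem Gen.split {p n a : ℕ} {L M : ILat} (h : Gen p n a L) (e : Isom L (hyp.prod M)) :
    M.Pos ∧ M.IsEven ∧ M.Elem p ∧ M.E2 p ∧ M.rk + 2 = n ∧ M.d = p ^ a := by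
  have hG := h.isom e
  refine ⟨hG.lor.right hyp_neg, hG.even.right, hG.elem.right, hG.e2.right, ?_, ?_⟩
  · rw [← hG.rk, rk_prod, rk_hyp, add_comm]
  · rw [← hG.d, d_prod, d_hyp, one_mul]

theorem exists_hyp_of_unimodular {L : ILat} (he : L.IsEven) (hl : L.Lor) (hE : L.Elem 1) {D : ℕ}
    (hD : L.rk = D + 1) (h2 : 2 ≤ D) (hb : 2 < blich D ^ 2 * 2 ^ D) : ∃ M, Isom L (hyp.prod M) := by
  obtain ⟨e, he0, he2⟩ := hl.exists_isotropic_of_even he hD h2 (by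
    rw [d_of_elem_one hE]; simpa using hb)
  obtain ⟨e', f, he', hf, -⟩ := exists_pair_of_elem_one hE he0 he2
  exact split_hyp he he' hf

theorem oddHyp_lor {M : ILat} (hM : M.Pos) : (oddHyp M).Lor :=
  (prod_comm _ _).lor (((rk1_lor (by norm_num)).prod hM).prod (rk1_pos (by norm_num)))

theorem rk_oddHyp (M : ILat) : (oddHyp M).rk = M.rk + 2 := by
  rw [rk_prod, rk_prod, rk_rk1, rk_rk1]
  omega

theorem d_oddHyp (M : ILat) : (oddHyp M).d = M.d := by
  rw [d_prod, d_prod, d_rk1, d_rk1]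
  simp

theorem oneClass_zero {p n : ℕ} (h3 : 3 ≤ n) (h19 : n ≤ 19)
    (hb : 2 < blich (n - 1) ^ 2 * 2 ^ (n - 1)) : OneClass p n 0 := by
  have hex : ∀ L, Gen p n 0 L → ∃ M, Isom L (hyp.prod M) := fun L hL =>
    exists_hyp_of_unimodular hL.even hL.lor (elem_one_of_d (by rw [hL.d, pow_zero]))
      (by rw [hL.rk]; omega) (by omega) hb
  refine ⟨fun L L' h h' => ?_, hex⟩
  have key : ∀ L M, Gen p n 0 L → Isom L (hyp.prod M) → Isom (oddHyp M) (I1 (n - 1)) := by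
    intro L M hL hM
    obtain ⟨hP, hev, -, -, hrk, hd⟩ := hL.split hM
    refine (oddHyp_lor hP).odd_unimodular (elem_one_of_d (by rw [d_oddHyp, hd, pow_zero]))
      (by rw [rk_oddHyp]; omega) (by omega) (by omega) (g := ((1 : ℤ), (0 : ℤ), (0 : M))) ?_
    rw [oddHyp_form]
    simp
  obtain ⟨M, hM⟩ := hex L h
  obtain ⟨M', hM'⟩ := hex L' h'
  obtain ⟨-, hev, -, -, -, -⟩ := h.split hM
  obtain ⟨-, hev', -, -, -, hd⟩ := h'.split hM'
  exact hM.trans ((hyp_prod_of_oddHyp hev hev' (p := 1) (by norm_num)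
    (elem_one_of_d (by rw [hd, pow_zero])) ((key L M h hM).trans (key L' M' h' hM').symm)).trans hM'.symm)


theorem exists_isChar_I1 : ∀ k, ∃ c, (I1 k).IsChar c
  | 0 => ⟨(1 : ℤ), rk1_isChar (c := -1) (by norm_num)⟩
  | k + 1 => by
    obtain ⟨c, hc⟩ := exists_isChar_I1 k
    exact ⟨((1 : ℤ), c), (rk1_isChar (c := 1) (k := 1) (by norm_num)).prod hc⟩

theorem Gen.singular_two {L : ILat} (h : Gen 2 18 2 L) :
    ∃ x ∈ L.R (2 : ℕ), (¬ ∃ y, x = ((2 : ℕ) : ℤ) • y) ∧ 2 * ((2 : ℕ) : ℤ) ^ 2 ∣ L.form x x := by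
  obtain ⟨b, hb, hind, -⟩ := quotient_basis Nat.prime_two (K := L.pm (2 : ℕ)) (S := L.R (2 : ℕ))
    (fun x _ => mem_pm.2 ⟨x, rfl⟩) ((ridx_pm_R two_ne_zero h.elem).trans h.d)
  set x := b 0 with hx
  have hx2 : ¬ ∃ y, x = ((2 : ℕ) : ℤ) • y := by
    intro hy
    have := hind (Pi.single 0 1) (by simpa [Pi.single_apply, ite_smul] using mem_pm.2 hy) 0
    norm_num at this
  by_cases h8 : 2 * ((2 : ℕ) : ℤ) ^ 2 ∣ L.form x x
  · exact ⟨x, hb 0, hx2, h8⟩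
  have h4 : (2 : ℤ) ^ 2 ∣ L.form x x := by
    have := h.e2 x (hb 0)
    norm_num at this ⊢
    exact this
  norm_num at h8
  obtain ⟨X, i, ξ, ho⟩ := exists_over two_ne_zero (by exact_mod_cast hb 0) h4
  have hξ : ¬ 2 ∣ X.form ξ ξ := by
    intro hd
    apply h8
    rw [← ho.sq]
    obtain ⟨t, ht⟩ := hd
    exact ⟨t, by rw [ht]; ring⟩
  have hd : X.d = 1 := by
    have := ho.d_eq Int.prime_two (by exact_mod_cast hx2)
    rw [h.d] at this
    simpa using this.symm
  have hXE := elem_one_of_d hd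
  have hXL := ho.lor two_ne_zero h.lor
  have hXr : X.rk = 18 := ho.rk.trans h.rk
  obtain ⟨e, he⟩ := (hXL.odd_unimodular hXE (k := 17) hXr (by norm_num) (by norm_num) hξ).symm
  obtain ⟨c', hc'⟩ := exists_isChar_I1 17
  have hc := hc'.map he
  have hc8 := hXL.isChar_sq hXE hXr (by norm_num) (by norm_num) hc
  set c := e c'
  have hc8' : 8 ∣ X.form c c := by omega
  obtain ⟨z, n, hzn⟩ := ho.gen c
  have hn : 2 ∣ n := by
    have h1 : 2 ∣ X.form c c := Dvd.dvd.trans (by norm_num) hc8'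
    rw [hzn, form_add_sq, form_smul_sq, ho.form] at h1
    have h2 := h.even z
    have h3 : 2 ∣ n ^ 2 * X.form ξ ξ := by
      rw [dvd_add_right] at h1
      · exact h1
      · exact dvd_add h2 (dvd_mul_right _ _)
    exact Int.prime_two.dvd_of_dvd_pow ((Int.prime_two.dvd_or_dvd h3).resolve_right hξ)
  obtain ⟨k, rfl⟩ := hn
  have hci : c = i (z + k • x) := by
    rw [hzn, map_add, map_smul, ← ho.smul, smul_smul, mul_comm k]
  refine ⟨z + k • x, fun y => ?_, ?_, ?_⟩
  · have := hc (i y)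
    rw [hci, ho.form, ho.form] at this
    have h2 := h.even y
    rw [Nat.cast_ofNat]
    omega
  · rintro ⟨y, hy⟩
    have := hc ξ
    rw [hci, hy, map_smul, map_smul, LinearMap.smul_apply, smul_eq_mul, Nat.cast_ofNat] at this
    apply hξ
    omega
  · rw [← ho.form, ← hci]
    norm_num
    exact hc8'

theorem oneClass_two : OneClass 2 18 8 := by
  have h0 : OneClass 2 18 0 := oneClass_zero (by norm_num) (by norm_num) (by decide +kernel)
  have h2 : OneClass 2 18 2 := h0.step Nat.prime_two (by norm_num) fun L hL => hL.singular_two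
  exact ((h2.step_of_one_le Nat.prime_two (by norm_num) (by norm_num)).step_of_one_le Nat.prime_two
    (by norm_num) (by norm_num)).step_of_one_le Nat.prime_two (by norm_num) (by norm_num)

theorem Over.isChar {p : ℤ} {L L' : ILat} {i : L →ₗ[ℤ] L'} {x : L} {ξ : L'} (h : Over p i x ξ)
    (hp : ¬ 2 ∣ p) {c : L} (hc : L.IsChar c) : L'.IsChar (i c) := by
  intro y
  obtain ⟨z, hz⟩ := h.exists_smul y
  have h1 := hc z
  rw [← h.form, ← h.form, ← hz, map_smul, form_smul_sq, smul_eq_mul] at h1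
  obtain ⟨k, rfl⟩ : ∃ k, p = 2 * k + 1 := Int.odd_iff.2 (Int.two_dvd_ne_zero.1 hp)
  obtain ⟨t, ht⟩ := h1
  exact ⟨t - k * L'.form (i c) y + (2 * k ^ 2 + 2 * k) * L'.form y y, by linear_combination ht⟩


theorem binary_five : ∀ A B C : ZMod 5,
    (∃ s t : ZMod 5, (s ≠ 0 ∨ t ≠ 0) ∧ A * s ^ 2 + 2 * B * s * t + C * t ^ 2 = 0) ∨
    ∃ s t s' t' : ZMod 5, A * s ^ 2 + 2 * B * s * t + C * t ^ 2 + 1 = 0 ∧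
      A * s' ^ 2 + 2 * B * s' * t' + C * t' ^ 2 + 2 = 0 ∧
      A * s * s' + B * (s * t' + t * s') + C * t * t' = 0 := by
  decide +kernel

/-- A binary lattice of determinant five. -/
abbrev bin5 : ILat := ofMatrix !![2, 1; 1, 3] (by decide)

theorem bin5_form (x y : Fin 2 → ℤ) :
    bin5.form x y = 2 * x 0 * y 0 + x 0 * y 1 + x 1 * y 0 + 3 * x 1 * y 1 := by
  rw [ofMatrix_form]
  simp [Matrix.mulVec, dotProduct, Fin.sum_univ_two]
  ring

theorem Gen.singular_five {L : ILat} (h : Gen 5 10 2 L) :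
    ∃ x ∈ L.R (5 : ℕ), (¬ ∃ y, x = ((5 : ℕ) : ℤ) • y) ∧ 2 * ((5 : ℕ) : ℤ) ^ 2 ∣ L.form x x := by
  obtain ⟨b, hb, hind, -⟩ := quotient_basis Nat.prime_five (K := L.pm (5 : ℕ)) (S := L.R (5 : ℕ))
    (fun x _ => mem_pm.2 ⟨x, rfl⟩) ((ridx_pm_R (by norm_num) h.elem).trans h.d)
  obtain ⟨A, hA⟩ := hb 0 (b 0)
  obtain ⟨B, hB⟩ := hb 0 (b 1)
  obtain ⟨C, hC⟩ := hb 1 (b 1)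
  have hB' : L.form (b 1) (b 0) = (5 : ℕ) * B := by rw [L.symm, hB]
  have hF : ∀ s t s' t' : ℤ, L.form (s • b 0 + t • b 1) (s' • b 0 + t' • b 1) =
      5 * (A * s * s' + B * (s * t' + t * s') + C * t * t') := by
    intro s t s' t'
    simp only [map_add, LinearMap.add_apply, map_smul, LinearMap.smul_apply, smul_eq_mul, hA, hB, hB', hC]
    push_cast
    ring
  have hR : ∀ s t : ℤ, s • b 0 + t • b 1 ∈ L.R (5 : ℕ) := fun s t =>
    (L.R _).add_mem ((L.R _).smul_mem _ (hb 0)) ((L.R _).smul_mem _ (hb 1))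
  have hlift : ∀ z : ZMod 5, ∃ s : ℤ, (s : ZMod 5) = z := ZMod.intCast_surjective
  have hz : ∀ s : ℤ, (5 : ℤ) ∣ s ↔ (s : ZMod 5) = 0 := fun s =>
    (ZMod.intCast_zmod_eq_zero_iff_dvd s 5).symm
  rcases binary_five A B C with ⟨s, t, hst, h0⟩ | ⟨s, t, s', t', h1, h2, h3⟩
  · obtain ⟨s, rfl⟩ := hlift s
    obtain ⟨t, rfl⟩ := hlift t
    refine ⟨s • b 0 + t • b 1, hR s t, ?_, ?_⟩
    · intro hy
      have := hind ![s, t] (by simpa using mem_pm.2 hy)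
      have h5 := this 0
      have h6 := this 1
      simp at h5 h6
      rw [hz] at h5 h6
      tauto
    · have he := h.even (s • b 0 + t • b 1)
      rw [hF] at he ⊢
      have h5 : (5 : ℤ) ∣ (A * s * s + B * (s * t + t * s) + C * t * t) := by
        rw [hz, ← h0]
        push_cast
        ring
      push_cast
      omega
  · exfalso
    obtain ⟨s, rfl⟩ := hlift s
    obtain ⟨t, rfl⟩ := hlift t
    obtain ⟨s', rfl⟩ := hlift s'
    obtain ⟨t', rfl⟩ := hlift t'
    set x := s • b 0 + t • b 1 with hx
    set x' := s' • b 0 + t' • b 1 with hx'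
    let Y := L.prod ((rk1 5).prod bin5)
    have hY : ∀ (a a' : L) (m m' : ℤ) (k k' : Fin 2 → ℤ), Y.form (a, m, k) (a', m', k') =
        L.form a a' + (5 * m * m' + bin5.form k k') := fun a a' m m' k k' => rfl
    have hxx : ∃ g, L.form x x = 25 * g - 5 := by
      have h5 : (5 : ℤ) ∣ (A * s * s + B * (s * t + t * s) + C * t * t) + 1 := by
        rw [hz, ← h1]
        push_cast
        ring
      obtain ⟨g, hg⟩ := h5
      exact ⟨g, by rw [hF]; linear_combination 5 * hg⟩
    have hxx' : ∃ g, L.form x' x' = 25 * g - 10 := by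
      have h5 : (5 : ℤ) ∣ (A * s' * s' + B * (s' * t' + t' * s') + C * t' * t') + 2 := by
        rw [hz, ← h2]
        push_cast
        ring
      obtain ⟨g, hg⟩ := h5
      exact ⟨g, by rw [hF]; linear_combination 5 * hg⟩
    have hxy : ∃ g, L.form x' x = 25 * g := by
      have h5 : (5 : ℤ) ∣ (A * s * s' + B * (s * t' + t * s') + C * t * t') := by
        rw [hz, ← h3]
        push_cast
        ring
      obtain ⟨g, hg⟩ := h5
      exact ⟨g, by rw [L.symm, hF]; linear_combination 5 * hg⟩
    obtain ⟨g, hg⟩ := hxx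
    obtain ⟨g', hg'⟩ := hxx'
    obtain ⟨g'', hg''⟩ := hxy
    have h5p : Prime (5 : ℤ) := by norm_num
    obtain ⟨Y', i, ξ, ho⟩ := exists_over (p := 5) (L := Y) (x := (x, (1 : ℤ), (0 : Fin 2 → ℤ)))
      (by norm_num) (by
        rintro ⟨a, m, k⟩
        rw [hY, map_zero, LinearMap.zero_apply]
        obtain ⟨q, hq⟩ := hR s t a
        exact ⟨q + m, by rw [hq]; push_cast; ring⟩)
      (by rw [hY, hg, map_zero]; exact ⟨g, by ring⟩)
    have hv2 : Y.form (x', (0 : ℤ), ![1, -2]) (x', (0 : ℤ), ![1, -2]) = 25 * g' := by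
      rw [hY, hg', bin5_form]
      simp
    obtain ⟨Y'', i', ξ', ho'⟩ := exists_over (p := 5) (L := Y') (x := i (x', (0 : ℤ), ![1, -2]))
      (by norm_num) (by
        intro y
        obtain ⟨⟨a, m, k⟩, n, rfl⟩ := ho.gen y
        rw [map_add, map_smul, ho.form, hY]
        have e1 : 5 * Y'.form (i (x', (0 : ℤ), ![1, -2])) ξ = 25 * g'' := by
          rw [ho.form_left, hY, hg'', map_zero]
          ring
        have e2 : Y'.form (i (x', (0 : ℤ), ![1, -2])) ξ = 5 * g'' := by omega
        obtain ⟨q, hq⟩ := hR s' t' a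
        rw [e2, hq, bin5_form]
        refine ⟨q - k 1 + n * g'', ?_⟩
        simp
        ring)
      (by rw [ho.form, hv2]; exact ⟨g', by ring⟩)
    have hd1 := ho.d_eq h5p (by
      rintro ⟨⟨a, m, k⟩, hy⟩
      have : (1 : ℤ) = 5 * m := congrArg (fun z => z.2.1) hy
      omega)
    have hd2 := ho'.d_eq h5p (by
      rintro ⟨y, hy⟩
      obtain ⟨⟨a, m, k⟩, n, rfl⟩ := ho.gen y
      have hy' : (x', (0 : ℤ), ![1, -2]) = (5 : ℤ) • ((a, m, k) : L × ℤ × (Fin 2 → ℤ)) +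
          n • (x, (1 : ℤ), (0 : Fin 2 → ℤ)) := by
        apply ho.inj
        rw [hy, map_add, map_smul, map_smul, ← ho.smul, smul_add, smul_comm n]
      have : (1 : ℤ) = 5 * k 0 + n * 0 := congrArg (fun z => z.2.2 0) hy'
      omega)
    have hYd : Y.d = 5 ^ 4 := by
      rw [d_prod, d_prod, h.d, d_rk1, d_ofMatrix]
      simp [Matrix.det_fin_two]
    have hE : Y''.Elem 1 := elem_one_of_d (by
      rw [hYd, hd2] at hd1
      norm_num at hd1
      omega)
    have hpos : bin5.Pos := by
      intro k hk
      rw [bin5_form]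
      by_cases h0 : k 1 = 0
      · have : k 0 ≠ 0 := fun h => hk (by ext j; fin_cases j <;> assumption)
        rw [h0]
        have := mul_self_pos.2 this
        linarith
      · have := mul_self_pos.2 h0
        nlinarith [sq_nonneg (2 * k 0 + k 1)]
    have hLor : Y''.Lor := ho'.lor (by norm_num) (ho.lor (by norm_num)
      (h.lor.prod ((rk1_pos (by norm_num)).prod hpos)))
    have hch : Y.IsChar (0, (1 : ℤ), ![1, 0]) := h.even.isChar_zero.prod
      ((rk1_isChar (by norm_num)).prod fun k => by
        rw [bin5_form, bin5_form]
        obtain ⟨q, hq⟩ := Int.even_mul_pred_self (k 1)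
        refine ⟨k 0 - k 0 * k 0 - k 0 * k 1 - q - k 1 * k 1, ?_⟩
        simp
        linear_combination -hq)
    have hsq := hLor.isChar_sq hE (n := 13)
      (by rw [ho'.rk, ho.rk, rk_prod, rk_prod, h.rk, rk_rk1, rk_ofMatrix]) (by norm_num) (by norm_num)
      (ho'.isChar (by norm_num) (ho.isChar (by norm_num) hch))
    rw [ho'.form, ho.form, hY, bin5_form] at hsq
    simp at hsq

theorem oneClass_five : OneClass 5 10 4 := by
  have h0 : OneClass 5 10 0 := oneClass_zero (by norm_num) (by norm_num) (by decide +kernel)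
  have h2 : OneClass 5 10 2 := h0.step Nat.prime_five (by norm_num) fun L hL => hL.singular_five
  exact h2.step_of_one_le Nat.prime_five (by norm_num) (by norm_num)


/-- A ternary lattice of determinant seven. -/
abbrev ter7 : ILat := ofMatrix !![2, -1, 0; -1, 2, -1; 0, -1, 3] (by decide)

theorem ter7_form (x y : Fin 3 → ℤ) : ter7.form x y = 2 * x 0 * y 0 + 2 * x 1 * y 1 + 3 * x 2 * y 2
    - x 0 * y 1 - x 1 * y 0 - x 1 * y 2 - x 2 * y 1 := by
  rw [ofMatrix_form]
  simp [Matrix.mulVec, dotProduct, Fin.sum_univ_three]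
  ring

theorem unary_seven : ∀ t : ZMod 7, t = 0 ∨ (∃ s, t * s ^ 2 + 3 = 0) ∨ ∃ s, t * s ^ 2 + 1 = 0 := by
  decide +kernel

theorem Gen.seven_not_residue {L : ILat} (h : Gen 7 8 1 L) {x : L} (hx : x ∈ L.R (7 : ℕ)) {g : ℤ}
    (hg : L.form x x = 49 * g - 21) : False := by
  let Y := L.prod ter7
  have hY : ∀ (a a' : L) (k k' : Fin 3 → ℤ), Y.form (a, k) (a', k') =
      L.form a a' + ter7.form k k' := fun a a' k k' => rfl
  have h7p : Prime (7 : ℤ) := by norm_num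
  obtain ⟨Y', i, ξ, ho⟩ := exists_over (p := 7) (L := Y) (x := (x, ![1, 2, 3]))
    (by norm_num) (by
      rintro ⟨a, k⟩
      rw [hY, ter7_form]
      obtain ⟨q, hq⟩ := hx a
      refine ⟨q + k 2, ?_⟩
      rw [hq]
      simp
      ring)
    (by rw [hY, hg, ter7_form]; exact ⟨g, by simp⟩)
  have hd1 := ho.d_eq h7p (by
    rintro ⟨⟨a, k⟩, hy⟩
    have : (1 : ℤ) = 7 * k 0 := congrArg (fun z => z.2 0) hy
    omega)
  have hYd : Y.d = 7 ^ 2 := by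
    rw [d_prod, h.d, d_ofMatrix]
    simp [Matrix.det_fin_three]
  have hE : Y'.Elem 1 := elem_one_of_d (by
    rw [hYd] at hd1
    norm_num at hd1
    omega)
  have hpos : ter7.Pos := by
    intro k hk
    rw [ter7_form]
    have hne : k 0 ≠ 0 ∨ k 1 ≠ 0 ∨ k 2 ≠ 0 := by
      by_contra! hc
      exact hk (by ext j; fin_cases j; exacts [hc.1, hc.2.1, hc.2.2])
    have h0 : 0 ≤ k 0 * k 0 := mul_self_nonneg _
    have h1 : 0 ≤ k 2 * k 2 := mul_self_nonneg _
    rcases hne with hh | hh | hh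
    · have := mul_self_pos.2 hh
      nlinarith [sq_nonneg (k 0 - k 1), sq_nonneg (k 1 - k 2)]
    · have := mul_self_pos.2 hh
      nlinarith [sq_nonneg (2 * k 0 - k 1), sq_nonneg (k 1 - k 2)]
    · have := mul_self_pos.2 hh
      nlinarith [sq_nonneg (k 0 - k 1), sq_nonneg (k 1 - k 2)]
  have hLor : Y'.Lor := ho.lor (by norm_num) (h.lor.prod hpos)
  have hch : Y.IsChar (0, ![1, 0, 1]) := h.even.isChar_zero.prod fun k => by
    rw [ter7_form, ter7_form]
    obtain ⟨q, hq⟩ := Int.even_mul_pred_self (k 2)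
    refine ⟨k 0 - k 1 + k 2 - k 0 * k 0 - k 1 * k 1 - k 2 * k 2 + k 0 * k 1 + k 1 * k 2 - q, ?_⟩
    simp
    linear_combination -hq
  have hsq := hLor.isChar_sq hE (n := 11)
    (by rw [ho.rk, rk_prod, h.rk, rk_ofMatrix]) (by norm_num) (by norm_num)
    (ho.isChar (by norm_num) hch)
  rw [ho.form, hY, ter7_form] at hsq
  simp at hsq

theorem Gen.exists_seven {L : ILat} (h : Gen 7 8 1 L) :
    ∃ x ∈ L.R (7 : ℕ), ∃ g, L.form x x = 49 * g - 7 := by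
  have h7 : Nat.Prime 7 := by norm_num
  obtain ⟨b, hb, hind, -⟩ := quotient_basis h7 (K := L.pm (7 : ℕ)) (S := L.R (7 : ℕ))
    (fun x _ => mem_pm.2 ⟨x, rfl⟩) ((ridx_pm_R (by norm_num) h.elem).trans h.d)
  obtain ⟨t, ht⟩ := hb 0 (b 0)
  have hz : ∀ s : ℤ, (7 : ℤ) ∣ s ↔ (s : ZMod 7) = 0 := fun s =>
    (ZMod.intCast_zmod_eq_zero_iff_dvd s 7).symm
  rcases unary_seven t with h0 | ⟨s, h0⟩ | ⟨s, h0⟩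
  · exfalso
    obtain ⟨g, rfl⟩ := (hz t).2 h0
    obtain ⟨Y', i, ξ, ho⟩ := exists_over (p := 7) (L := L) (x := b 0) (by norm_num) (hb 0)
      ⟨g, by rw [ht]; push_cast; ring⟩
    have := ho.d_eq (by norm_num) (by
      intro hy
      have := hind (Pi.single 0 1) (by simpa [Pi.single_apply, ite_smul] using mem_pm.2 hy) 0
      norm_num at this)
    rw [h.d] at this
    norm_num at this
    omega
  · exfalso
    obtain ⟨s, rfl⟩ := ZMod.intCast_surjective s
    obtain ⟨g, hg⟩ := (hz (t * s ^ 2 + 3)).2 (by push_cast; exact h0)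
    exact h.seven_not_residue (x := s • b 0) ((L.R _).smul_mem _ (hb 0)) (g := g) (by
      rw [form_smul_sq, ht]
      push_cast
      linear_combination 7 * hg)
  · obtain ⟨s, rfl⟩ := ZMod.intCast_surjective s
    obtain ⟨g, hg⟩ := (hz (t * s ^ 2 + 1)).2 (by push_cast; exact h0)
    exact ⟨s • b 0, (L.R _).smul_mem _ (hb 0), g, by
      rw [form_smul_sq, ht]
      push_cast
      linear_combination 7 * hg⟩

theorem exists_pair_of_elem {L : ILat} {p : ℤ} (hp : Prime p) (hE : L.Elem p) {e : L} (he : e ≠ 0)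
    (he2 : L.form e e = 0) (han : ∀ x ∈ L.R p, L.form x x = 0 → ∃ y, x = p • y) :
    ∃ e' f : L, L.form e' e' = 0 ∧ L.form e' f = 1 := by
  obtain ⟨k, e0, φ, hk, hφ⟩ := exists_primitive he
  have hk0 : k ≠ 0 := by rintro rfl; rw [zero_smul] at hk; exact he hk
  have h0 : L.form e0 e0 = 0 := by
    rw [hk, form_smul_sq] at he2
    exact (mul_eq_zero.1 he2).resolve_left (pow_ne_zero 2 hk0)
  obtain ⟨u, hu⟩ := hE φ
  have hnR : e0 ∉ L.R p := by
    intro hR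
    obtain ⟨y, hy⟩ := han e0 hR h0
    rw [hy, map_smul, smul_eq_mul] at hφ
    exact hp.not_isUnit (IsUnit.of_mul_eq_one _ hφ)
  rw [mem_R] at hnR
  push Not at hnR
  obtain ⟨y, hy⟩ := hnR
  obtain ⟨a, b, hab⟩ := (hp.coprime_iff_not_dvd).2 hy
  refine ⟨e0, a • u + b • y, h0, ?_⟩
  rw [map_add, map_smul, map_smul, L.symm e0 u, hu, hφ, smul_eq_mul, smul_eq_mul, mul_one, hab]


/-- The standard lattice `ℤ ^ k`. -/
abbrev std (k : ℕ) : ILat := ofMatrix (1 : Matrix (Fin k) (Fin k) ℤ) Matrix.isSymm_one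

theorem std_form {k : ℕ} (x y : Fin k → ℤ) : (std k).form x y = ∑ j, x j * y j := by
  rw [ofMatrix_form, Matrix.one_mulVec]
  rfl

theorem rk1_prod_std (k : ℕ) : Isom ((rk1 1).prod (std k)) (std (k + 1)) := by
  refine ⟨(AddEquiv.mk' ⟨fun x : ℤ × (Fin k → ℤ) => (Fin.cons x.1 x.2 : Fin (k + 1) → ℤ),
    fun y => (y 0, Fin.tail y), fun x => by simp, fun y => by simp⟩ fun x y => ?_).toIntLinearEquiv,
    ?_⟩
  · funext j
    refine Fin.cases ?_ (fun j => ?_) j <;> simp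
  · rintro ⟨a, x⟩ ⟨b, y⟩
    change (std (k + 1)).form (Fin.cons a x : Fin (k + 1) → ℤ) (Fin.cons b y : Fin (k + 1) → ℤ) = _
    rw [prod_form, rk1_form, std_form, std_form, Fin.sum_univ_succ]
    simp

theorem Pos.isom_std : ∀ {k : ℕ} {M : ILat}, M.Pos → M.Elem 1 → M.rk = k →
    (∀ j, 1 ≤ j → j ≤ k → 1 < blich j ^ 2) → Isom M (std k)
  | 0, M, _, _, hk, _ => by
    have h0 : (std 0).rk = 0 := rk_ofMatrix _ _
    exact ((prod_of_rk_zero h0).symm.trans (prod_comm _ _)).trans (prod_of_rk_zero hk)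
  | k + 1, M, hM, hu, hk, hb => by
    obtain ⟨x, hx, hx2⟩ := hM.exists_short hk (by omega) (μ := 2)
      (by rw [d_of_elem_one hu]; simpa using hb (k + 1) (by omega) le_rfl)
    have hx1 : M.form x x = 1 := by
      have := hM x hx
      push_cast at hx2
      omega
    have h := split_unit (by norm_num : (1 : ℤ) * 1 = 1) hx1
    have hr := h.rk
    rw [rk_prod, rk_rk1] at hr
    exact (h.trans ((Isom.refl _).prod (Pos.isom_std (hM.res _) (h.elem hu).right (by omega)
      fun j h1 hj => hb j h1 (by omega)))).trans (rk1_prod_std k)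

theorem std_char_isom {k : ℕ} {M : ILat} (hM : Isom M (std k)) {w : M} (hw : M.IsChar w)
    (hw2 : M.form w w = k) :
    Isom (M.res (LinearMap.ker (M.form w))) ((std k).res (LinearMap.ker ((std k).form 1))) := by
  obtain ⟨e, he⟩ := hM
  set c : Fin k → ℤ := e w with hc
  have hch : (std k).IsChar c := hw.map he
  have hodd : ∀ j, 1 ≤ c j ^ 2 := by
    intro j
    have h := hch (Pi.single j 1)
    rw [std_form, std_form] at h
    simp only [Pi.single_apply, mul_ite, mul_one, mul_zero, Finset.sum_ite_eq', Finset.mem_univ,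
      if_true] at h
    have h0 : c j ≠ 0 := by
      intro h0
      rw [h0] at h
      norm_num at h
    have := pow_pos (abs_pos.2 h0) 2
    rw [sq_abs] at this
    omega
  have hsum : ∑ j, c j ^ 2 = ∑ _j : Fin k, (1 : ℤ) := by
    have h := he w w
    rw [hw2, ← hc, std_form] at h
    simpa [sq] using h
  have h1 : ∀ j, c j * c j = 1 := fun j => by
    rw [← sq]
    exact ((Finset.sum_eq_sum_iff_of_le fun j _ => hodd j).1 hsum.symm j (Finset.mem_univ _)).symm
  let σ : (std k) ≃ₗ[ℤ] (std k) := (AddEquiv.mk' ⟨fun x : Fin k → ℤ => c * x, fun x => c * x,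
    fun x => by
      funext j
      simp [← mul_assoc, h1],
    fun x => by
      funext j
      simp [← mul_assoc, h1]⟩ fun x y => mul_add c x y).toIntLinearEquiv
  have hσ : ∀ x y, (std k).form (σ x) (σ y) = (std k).form x y := by
    intro x y
    rw [std_form, std_form]
    refine Finset.sum_congr rfl fun j _ => ?_
    change (c j * x j) * (c j * y j) = _
    linear_combination (x j * y j) * h1 j
  refine res_isom (e.trans σ) (fun x y => (hσ _ _).trans (he x y)) fun x => ?_
  have hσc : σ c = (1 : Fin k → ℤ) := funext fun j => h1 j
  rw [LinearMap.mem_ker, LinearMap.mem_ker, LinearEquiv.trans_apply, ← hσc, hσ, hc, he]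

theorem seven_isom {M : ILat} (hM : M.Pos) (he : M.IsEven) (hr : M.rk = 6)
    (hd : M.d = 7) {m : M} (hm : m ∈ M.R (7 : ℕ)) {g : ℤ} (hg : M.form m m = 49 * g - 7) :
    Isom M ((std 7).res (LinearMap.ker ((std 7).form 1))) := by
  let Y := M.prod (rk1 7)
  have hY : ∀ (a a' : M) (k k' : ℤ), Y.form (a, k) (a', k') = M.form a a' + 7 * k * k' :=
    fun a a' k k' => rfl
  have h7p : Prime (7 : ℤ) := by norm_num
  obtain ⟨Y', i, ξ, ho⟩ := exists_over (p := 7) (L := Y) (x := (m, (1 : ℤ)))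
    (by norm_num) (by
      rintro ⟨a, k⟩
      rw [hY]
      obtain ⟨q, hq⟩ := hm a
      exact ⟨q + k, by rw [hq]; push_cast; ring⟩)
    (by rw [hY, hg]; exact ⟨g, by ring⟩)
  have hd1 := ho.d_eq h7p (by
    rintro ⟨⟨a, k⟩, hy⟩
    have : (1 : ℤ) = 7 * k := congrArg (fun z => z.2) hy
    omega)
  have hYd : Y.d = 7 ^ 2 := by
    rw [d_prod, hd, d_rk1]
    rfl
  have hE : Y'.Elem 1 := elem_one_of_d (by
    rw [hYd] at hd1
    norm_num at hd1
    omega)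
  have hYp : Y.Pos := hM.prod (rk1_pos (by norm_num))
  have hst : Isom Y' (std 7) := (ho.pos (by norm_num) hYp).isom_std hE
    (by rw [ho.rk, rk_prod, hr, rk_rk1]) (by decide +kernel)
  have hw := std_char_isom hst (ho.isChar (by norm_num)
    (he.isChar_zero.prod (rk1_isChar (c := 7) (k := 1) (by norm_num)))) (by
      rw [ho.form, hY]
      simp)
  refine Isom.trans (Isom.of_surjective hM.nondeg (LinearMap.codRestrict _
    (i ∘ₗ LinearMap.inl ℤ M ℤ) fun x => ?_) (fun x y => ?_) ?_) hw
  · rw [LinearMap.mem_ker]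
    change Y'.form (i (0, 1)) (i (x, 0)) = 0
    rw [ho.form, hY]
    simp
  · rw [res_form]
    change Y'.form (i (x, 0)) (i (y, 0)) = _
    rw [ho.form, hY]
    simp
  · rintro ⟨y, hy⟩
    obtain ⟨⟨z, k⟩, n, rfl⟩ := ho.gen y
    rw [LinearMap.mem_ker, map_add, map_smul, ho.form, hY, map_zero, LinearMap.zero_apply] at hy
    have h1 := ho.form_left (0, (1 : ℤ))
    rw [hY, map_zero, LinearMap.zero_apply] at h1
    have h2 : Y'.form (i (0, (1 : ℤ))) ξ = 1 := by omega
    rw [h2, smul_eq_mul] at hy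
    refine ⟨z - k • m, Subtype.ext ?_⟩
    change i (z - k • m, (0 : ℤ)) = i (z, k) + n • ξ
    have hn : n = -k * 7 := by linarith
    rw [hn, mul_smul, ho.smul, ← map_smul, ← map_add]
    congr 1
    refine Prod.ext ?_ ?_
    · change z - k • m = z + (-k) • m
      rw [neg_smul, sub_eq_add_neg]
    · change (0 : ℤ) = k + (-k) * 1
      ring

theorem oneClass_seven : OneClass 7 8 3 := by
  have h7 : Nat.Prime 7 := by norm_num
  have hex : ∀ L, Gen 7 8 1 L → ∃ M, Isom L (hyp.prod M) := by
    intro L h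
    obtain ⟨e, he, he2⟩ := h.lor.exists_isotropic_of_even h.even (D := 7) h.rk (by norm_num)
      (by rw [h.d]; norm_num; decide +kernel)
    obtain ⟨e', f, he', hf⟩ := exists_pair_of_elem (p := (7 : ℕ)) (by norm_num) h.elem he he2 (by
      intro x hx hx2
      by_contra hc
      obtain ⟨Y', i, ξ, ho⟩ := exists_over (p := (7 : ℕ)) (by norm_num) hx (by rw [hx2]; exact dvd_zero _)
      have := ho.d_eq (by norm_num) hc
      rw [h.d] at this
      norm_num at this
      omega)
    exact split_hyp h.even he' hf
  have key : ∀ L, Gen 7 8 1 L →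
      Isom L (hyp.prod ((std 7).res (LinearMap.ker ((std 7).form 1)))) := by
    intro L h
    obtain ⟨M, hM⟩ := hex L h
    obtain ⟨hP, hev, hE, -, hrk, hd⟩ := h.split hM
    obtain ⟨⟨⟨α, β⟩, m⟩, hm, g, hg⟩ := (h.isom hM).exists_seven
    obtain ⟨⟨a, rfl⟩, ⟨b, rfl⟩, hm'⟩ := mem_R_hyp_prod.1 hm
    refine hM.trans ((Isom.refl _).prod (seven_isom hP hev (by omega) hd hm'
      (g := g - 2 * a * b) ?_))
    rw [prod_form, hyp_form] at hg
    push_cast at hg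
    linear_combination hg
  have h1 : OneClass 7 8 1 := ⟨fun L L' h h' => (key L h).trans (key L' h').symm, hex⟩
  exact h1.step_of_one_le h7 le_rfl (by norm_num)


/-- The discriminant form at three is anisotropic. -/
def Aniso (L : ILat) : Prop := ∀ x ∈ L.R (3 : ℕ), 9 ∣ L.form x x → ∃ y, x = (3 : ℤ) • y

theorem Aniso.isom {L M : ILat} (h : L.Aniso) (e : Isom L M) : M.Aniso := by
  obtain ⟨e, he⟩ := e
  intro x hx hx2
  obtain ⟨x, rfl⟩ := e.surjective x
  rw [he] at hx2
  obtain ⟨y, rfl⟩ := h x ((Isom.mem_R he).1 hx) hx2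
  exact ⟨e y, map_smul e _ _⟩

theorem Aniso.right {L M : ILat} (h : (L.prod M).Aniso) : M.Aniso := fun x hx hx2 => by
  obtain ⟨⟨a, b⟩, hy⟩ := h (0, x) (mem_R_prod.2 ⟨(L.R _).zero_mem, hx⟩) (by
    rw [prod_form, map_zero, zero_add]; exact hx2)
  exact ⟨b, congrArg Prod.snd hy⟩

theorem Aniso.prod_neg {M : ILat} (h : M.Aniso) : (M.prod (rk1 (-1))).Aniso := by
  rintro ⟨m, (b : ℤ)⟩ hx hx2
  obtain ⟨hm, hb⟩ := mem_R_prod.1 hx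
  have h1 := hb (1 : ℤ)
  change (3 : ℤ) ∣ (-1) * b * 1 at h1
  obtain ⟨k, rfl⟩ : (3 : ℤ) ∣ b := by omega
  rw [prod_form, rk1_form] at hx2
  obtain ⟨y, rfl⟩ := h m hm (by
    obtain ⟨t, ht⟩ := hx2
    exact ⟨t + k * k, by linear_combination ht⟩)
  exact ⟨(y, k), rfl⟩

/-- Positive definite lattices with discriminant form of type `3 ^ 2` anisotropic. -/
structure Ter (k : ℕ) (M : ILat) : Prop where
  pos : M.Pos
  rk : M.rk = k
  elem : M.Elem (3 : ℕ)
  d : M.d = 9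
  aniso : M.Aniso

theorem Ter.lor {k : ℕ} {M : ILat} (h : Ter k M) : (M.prod (rk1 (-1))).Lor :=
  (prod_comm _ _).lor ((rk1_lor (by norm_num : (-1 : ℤ) < 0)).prod h.pos)

theorem Ter.prod_elem {k : ℕ} {M : ILat} (h : Ter k M) : (M.prod (rk1 (-1))).Elem (3 : ℕ) := by
  have h1 : (rk1 (-1)).Elem 1 := elem_one_of_d (by rw [d_rk1]; rfl)
  exact h.elem.prod (by simpa using h1.mul 3)

theorem Ter.prod_rk {k : ℕ} {M : ILat} (h : Ter k M) : (M.prod (rk1 (-1))).rk = k + 1 := by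
  rw [rk_prod, rk_rk1, h.rk]

theorem Ter.prod_d {k : ℕ} {M : ILat} (h : Ter k M) : (M.prod (rk1 (-1))).d = 9 := by
  rw [d_prod, d_rk1, h.d]
  rfl

theorem exists_odd_pair {X : ILat} {e f g : X} (hf : X.form e f = 1) (hg : ¬ 2 ∣ X.form g g) :
    ∃ f', X.form e f' = 1 ∧ ¬ 2 ∣ X.form f' f' := by
  by_cases h2 : 2 ∣ X.form f f
  · refine ⟨g + (1 - X.form e g) • f, ?_, ?_⟩
    · rw [map_add, map_smul, hf, smul_eq_mul]
      ring
    · rw [form_add_sq, form_smul_sq]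
      have : (2 : ℤ) ∣ (1 - X.form e g) ^ 2 * X.form f f := Dvd.dvd.mul_left h2 _
      omega
  · exact ⟨f, hf, h2⟩

theorem Ter.step {k : ℕ} {M : ILat} (h : Ter (k + 1) M)
    (hiso : ∃ e : M.prod (rk1 (-1)), e ≠ 0 ∧ (M.prod (rk1 (-1))).form e e = 0) :
    ∃ M', Ter k M' ∧ Isom (M.prod (rk1 (-1))) ((rk1 1).prod (M'.prod (rk1 (-1)))) := by
  obtain ⟨e, he, he2⟩ := hiso
  have han := h.aniso.prod_neg
  obtain ⟨e', f, he', hf⟩ := exists_pair_of_elem (p := (3 : ℕ)) (by norm_num) h.prod_elem he he2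
    fun x hx hx2 => han x hx (by rw [hx2]; exact dvd_zero _)
  have hg : ¬ 2 ∣ (M.prod (rk1 (-1))).form ((0, (1 : ℤ)) : M × ℤ) ((0, (1 : ℤ)) : M × ℤ) := by
    rw [prod_form, rk1_form]
    simp
  obtain ⟨f', hf', hodd⟩ := exists_odd_pair hf hg
  set X := M.prod (rk1 (-1)) with hX
  obtain ⟨M', hM'⟩ := split_odd he' hf' hodd
  have hM2 : Isom X ((rk1 1).prod (M'.prod (rk1 (-1)))) :=
    hM'.trans ((Isom.refl _).prod (prod_comm _ _))
  have hM3 : Isom X (((rk1 1).prod (rk1 (-1))).prod M') := hM'.trans (prod_assoc _ _ _).symm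
  refine ⟨M', ⟨?_, ?_, ?_, ?_, ?_⟩, hM2⟩
  · refine (hM3.lor h.lor).right (v := ((0 : ℤ), (1 : ℤ))) ?_
    rw [prod_form, rk1_form, rk1_form]
    norm_num
  · have := hM3.rk
    rw [h.prod_rk, rk_prod, rk_prod, rk_rk1, rk_rk1] at this
    omega
  · exact (hM3.elem h.prod_elem).right
  · have := hM3.d
    rw [h.prod_d, d_prod, d_prod, d_rk1, d_rk1] at this
    simpa using this.symm
  · exact (han.isom hM3).right

theorem exists_isotropic_of_three {X : ILat} (hX : X.Lor) (hE : X.Elem (3 : ℕ)) (hd : X.d = 9) {D : ℕ}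
    (hD : X.rk = D + 1) (h3 : 3 ≤ D) (hb : 8 * 3 ^ (D - 3) < blich D ^ 2 * 2 ^ D) {x : X}
    (hx : x ∉ X.R (3 : ℕ)) (hx2 : 3 ∣ X.form x x) : ∃ e : X, e ≠ 0 ∧ X.form e e = 0 := by
  have hin : ∀ y : X, (3 : ℤ) • y ∈ X.R (3 : ℕ) := fun y => pm_le_R _ _ (mem_pm.2 ⟨y, rfl⟩)
  have hdv : ∀ y z : X.res (X.R (3 : ℕ)), (3 : ℤ) ∣ (X.res (X.R (3 : ℕ))).form y z :=
    fun y z => y.2 z.1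
  have hrr := rk_res X _ (by norm_num) hin
  have hrd := d_res X _ hrr
  have hc := card_R (p := (3 : ℕ)) (by norm_num) hE
  rw [hd, hD, Int.natAbs_natCast] at hc
  obtain ⟨D, rfl⟩ := Nat.exists_eq_add_of_le' h3
  have hcard : Nat.card (X ⧸ X.R (3 : ℕ)) = 3 ^ (D + 2) := by
    have : (3 : ℕ) ^ (D + 3 + 1) = 3 ^ (D + 2) * 9 := by ring
    omega
  set Rr := (X.res (X.R (3 : ℕ))).down 3 hdv with hRr
  have hRd : Rr.d = 3 ^ (D + 2) := by
    have h1 := d_down _ hdv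
    rw [hrr, hD, hrd, hcard, hd] at h1
    have h2 : 9 * (3 ^ (D + 2)) ^ 2 = (3 : ℤ).natAbs ^ (D + 3 + 1) * 3 ^ (D + 2) := by
      norm_num
      ring
    rw [h2] at h1
    exact Nat.eq_of_mul_eq_mul_left (pow_pos (by norm_num) _) h1
  have hRf : ∀ y z : Rr, 3 * Rr.form y z = X.form y.1 z.1 := fun y z => down_form _ hdv y z
  have hRl : Rr.Lor := (hX.res _ (by norm_num) hin).down (by norm_num) hdv
  let ζ : Rr := ⟨(3 : ℤ) • x, hin x⟩
  have hζ : ∀ y : Rr, Rr.form ζ y = X.form x y.1 := fun y => by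
    have := hRf ζ y
    change 3 * Rr.form ζ y = X.form ((3 : ℤ) • x) y.1 at this
    rw [map_smul, LinearMap.smul_apply, smul_eq_mul] at this
    omega
  obtain ⟨Z, i, ξ, ho⟩ := exists_over (p := 3) (L := Rr) (x := ζ) (by norm_num) (by
      intro y
      rw [hζ, X.symm]
      exact y.2 x)
    (by
      rw [hζ]
      change (3 : ℤ) ^ 2 ∣ X.form x ((3 : ℤ) • x)
      rw [map_smul, smul_eq_mul, sq]
      exact mul_dvd_mul_left _ hx2)
  have hZd := ho.d_eq (by norm_num) (by
    rintro ⟨y, hy⟩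
    have h1 : (3 : ℤ) • x = (3 : ℤ) • y.1 := congrArg Subtype.val hy
    rw [smul_cancel (by norm_num) h1] at hx
    exact hx y.2)
  have hZd' : Z.d = 3 ^ D := by
    rw [hRd] at hZd
    norm_num [pow_add] at hZd
    omega
  obtain ⟨e, he, he2⟩ := (ho.lor (by norm_num) hRl).exists_isotropic (D := D + 3)
    (by rw [ho.rk]; exact hrr.trans hD) (by omega) (by rw [hZd']; exact_mod_cast hb)
  obtain ⟨z, hz⟩ := ho.exists_smul e
  refine ⟨z.1, fun h0 => ?_, ?_⟩
  · have : z = 0 := Subtype.ext h0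
    rw [this, map_zero] at hz
    exact smul_ne_zero' (by norm_num) he hz
  · rw [← hRf, ← ho.form, ← hz, form_smul_sq, he2]
    ring

theorem Ter.two {M : ILat} (h : Ter 2 M) :
    Isom (M.prod (rk1 (-1))) ((I1 0).prod ((rk1 3).prod (rk1 3))) := by
  refine (prod_comm _ _).trans ((Isom.refl _).prod ?_)
  have hc := card_R (p := (3 : ℕ)) (by norm_num) h.elem
  rw [h.d, h.rk, Int.natAbs_natCast] at hc
  have h1 : Nat.card (M ⧸ M.R (3 : ℕ)) = 1 := by omega
  have hR : M.R (3 : ℕ) = ⊤ := by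
    have := (Nat.card_eq_one_iff_unique.1 h1).1
    exact Submodule.Quotient.subsingleton_iff.1 this
  have hdv : ∀ y z : M, (3 : ℤ) ∣ M.form y z := fun y z => by
    have : y ∈ M.R (3 : ℕ) := hR ▸ Submodule.mem_top
    exact this z
  have hd := d_down _ hdv
  rw [h.d, h.rk] at hd
  obtain ⟨e, he⟩ := (h.pos.down (by norm_num) hdv).isom_std (k := 2)
    (elem_one_of_d (by norm_num at hd; omega)) h.rk (by decide +kernel)
  refine ⟨(AddEquiv.trans e.toAddEquiv (AddEquiv.mk' ⟨fun x : Fin 2 → ℤ => (x 0, x 1),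
    fun x => ![x.1, x.2], fun x => ?_, fun x => rfl⟩ fun x y => rfl)).toIntLinearEquiv, fun x y => ?_⟩
  · funext j
    fin_cases j <;> rfl
  · change 3 * (e x) 0 * (e y) 0 + 3 * (e x) 1 * (e y) 1 = _
    rw [← M.down_form hdv, ← he, std_form, Fin.sum_univ_two]
    ring

theorem binary_three : ∀ a b c : ZMod 3, a * c - b ^ 2 = 1 ∨
    ∃ s t, (s ≠ 0 ∨ t ≠ 0) ∧ a * s ^ 2 + 2 * b * s * t + c * t ^ 2 = 0 := by
  decide +kernel

theorem residue_three : ∀ t u w : ZMod 3, t ≠ 0 → t * u = w ^ 2 → u = 1 → t = 1 := by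
  decide +kernel

theorem Pos.gram_det_pos {L : ILat} (h : L.Pos) {ι : Type*} [Fintype ι] [DecidableEq ι]
    (b : Module.Basis ι ℤ L) : 0 < (L.gram b).det := by
  refine lt_of_le_of_ne ?_ fun h0 => gram_det_ne_zero h.nondeg b (by convert h0.symm)
  have h1 := (posSemidef_of_int (L.gram b) (Matrix.ext fun i j => L.symm _ _) fun x => by
    rw [← form_sum_basis]
    exact h.nonneg _).det_nonneg
  have h2 : ((L.gram b).map (Int.cast : ℤ → ℝ)).det = ((L.gram b).det : ℝ) :=
    (RingHom.map_det (Int.castRingHom ℝ) _).symm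
  rw [h2] at h1
  exact_mod_cast h1

theorem Ter.exists_three {M : ILat} (h : Ter 3 M) : ∃ x : M.prod (rk1 (-1)),
    x ∉ (M.prod (rk1 (-1))).R (3 : ℕ) ∧ 3 ∣ (M.prod (rk1 (-1))).form x x := by
  have h3 : Nat.Prime 3 := Nat.prime_three
  have hz : ∀ s : ℤ, (3 : ℤ) ∣ s ↔ (s : ZMod 3) = 0 := fun s =>
    (ZMod.intCast_zmod_eq_zero_iff_dvd s 3).symm
  obtain ⟨y, hy⟩ : ∃ y, y ∉ M.R (3 : ℕ) := by
    by_contra! hc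
    have hc' : M.R (3 : ℕ) = ⊤ := Submodule.eq_top_iff'.2 hc
    have := ridx_R_top h3 h.elem (a := 2) (k := 1) h.d h.rk
    rw [hc', ridx_top] at this
    have hs : Subsingleton (M ⧸ (⊤ : Submodule ℤ M)) := Submodule.Quotient.subsingleton_iff.2 rfl
    rw [Nat.card_unique] at this
    norm_num at this
  by_cases hy2 : 3 ∣ M.form y y
  · refine ⟨(y, (0 : ℤ)), fun hR => hy (mem_R_prod.1 hR).1, ?_⟩
    rw [prod_form, map_zero, add_zero]
    exact hy2
  refine ⟨(y, (1 : ℤ)), fun hR => ?_, ?_⟩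
  · have := (mem_R_prod.1 hR).2 (1 : ℤ)
    rw [rk1_form] at this
    norm_num at this
  obtain ⟨b, hb, hind, -⟩ := quotient_basis h3 (K := M.pm (3 : ℕ)) (S := M.R (3 : ℕ))
    (fun x _ => mem_pm.2 ⟨x, rfl⟩) (j := 2) ((ridx_pm_R (by norm_num) h.elem).trans h.d)
  obtain ⟨A, hA⟩ := hb 0 (b 0)
  obtain ⟨B, hB⟩ := hb 0 (b 1)
  obtain ⟨C, hC⟩ := hb 1 (b 1)
  obtain ⟨P, hP⟩ := hb 0 y
  obtain ⟨Q, hQ⟩ := hb 1 y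
  push_cast at hA hB hC hP hQ
  have hdisc : (A : ZMod 3) * C - (B : ZMod 3) ^ 2 = 1 := by
    rcases binary_three A B C with h1 | ⟨s, t, hst, h0⟩
    · exact h1
    · exfalso
      obtain ⟨s, rfl⟩ := ZMod.intCast_surjective s
      obtain ⟨t, rfl⟩ := ZMod.intCast_surjective t
      obtain ⟨g, hg⟩ := (hz (A * s ^ 2 + 2 * B * s * t + C * t ^ 2)).2 (by push_cast; exact h0)
      obtain ⟨w, hw⟩ := h.aniso (s • b 0 + t • b 1)
        ((M.R _).add_mem ((M.R _).smul_mem _ (hb 0)) ((M.R _).smul_mem _ (hb 1))) ⟨g, by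
          rw [form_add_sq, form_smul_sq, form_smul_sq, map_smul, map_smul, LinearMap.smul_apply, hA,
            hB, hC, smul_eq_mul, smul_eq_mul]
          linear_combination 3 * hg⟩
      have hi := hind ![s, t] (by
        rw [Fin.sum_univ_two]
        exact mem_pm.2 ⟨w, hw⟩)
      have h0 := hi 0
      have h1 := hi 1
      simp only [Matrix.cons_val_zero, Matrix.cons_val_one] at h0 h1
      rcases hst with hst | hst
      · exact hst ((hz s).1 h0)
      · exact hst ((hz t).1 h1)
  let β : Module.Basis (Fin 3) ℤ M := Module.finBasisOfFinrankEq ℤ M h.rk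
  have hG : (M.gram β).det = 9 := by
    have h1 := h.pos.gram_det_pos β
    have h2 := M.d_eq β
    rw [h.d] at h2
    omega
  have hdet := congrArg Matrix.det (M.gram_toMatrix β ![y, b 0, b 1])
  rw [Matrix.det_mul, Matrix.det_mul, Matrix.det_transpose, hG] at hdet
  set T := (β.toMatrix ![y, b 0, b 1]).det
  have hl : (M.gram ![y, b 0, b 1]).det =
      9 * (M.form y y * (A * C - B ^ 2) + 3 * (2 * P * Q * B - P ^ 2 * C - Q ^ 2 * A)) := by
    rw [Matrix.det_fin_three]
    simp only [gram, Matrix.of_apply, Matrix.cons_val_zero, Matrix.cons_val_one, Matrix.cons_val]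
    rw [M.symm y (b 0), M.symm y (b 1), M.symm (b 1) (b 0), hA, hB, hC, hP, hQ]
    ring
  rw [hl] at hdet
  have hd2 : M.form y y * (A * C - B ^ 2) + 3 * (2 * P * Q * B - P ^ 2 * C - Q ^ 2 * A) = T ^ 2 := by
    linarith
  have hd3 : ((M.form y y : ℤ) : ZMod 3) * ((A : ZMod 3) * C - (B : ZMod 3) ^ 2) = (T : ZMod 3) ^ 2 := by
    have h1 := congrArg (Int.cast : ℤ → ZMod 3) hd2
    push_cast at h1
    have h30 : (3 : ZMod 3) = 0 := rfl
    rw [h30, zero_mul, add_zero] at h1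
    exact h1
  have := residue_three _ _ _ (fun h0 => hy2 ((hz _).2 h0)) hd3 hdisc
  rw [prod_form, rk1_form]
  refine (hz _).2 ?_
  push_cast
  rw [this]
  ring

theorem Ter.exists_isotropic {k : ℕ} {M : ILat} (h : Ter k M) (h3 : 3 ≤ k) (h12 : k ≤ 12) :
    ∃ e : M.prod (rk1 (-1)), e ≠ 0 ∧ (M.prod (rk1 (-1))).form e e = 0 := by
  by_cases h5 : 5 ≤ k
  · have hnum : ∀ D ∈ Finset.Icc 5 12, 72 < blich D ^ 2 * 2 ^ D := by decide +kernel
    exact h.lor.exists_isotropic h.prod_rk (by omega) (by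
      rw [h.prod_d]
      have := hnum k (Finset.mem_Icc.2 ⟨h5, h12⟩)
      norm_num
      exact this)
  · obtain ⟨x, hx, hx2⟩ : ∃ x : M.prod (rk1 (-1)),
        x ∉ (M.prod (rk1 (-1))).R (3 : ℕ) ∧ 3 ∣ (M.prod (rk1 (-1))).form x x := by
      obtain rfl | rfl : k = 3 ∨ k = 4 := by omega
      · exact h.exists_three
      · obtain ⟨x, -, hx, hx2⟩ := exists_singular Nat.prime_three
          (K := (M.prod (rk1 (-1))).R (3 : ℕ)) (S := ⊤)
          (fun x _ => pm_le_R _ _ (mem_pm.2 ⟨x, rfl⟩))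
          (ridx_R_top Nat.prime_three h.prod_elem (a := 2) (k := 3) h.prod_d h.prod_rk) le_rfl
          (s := 1) (fun _ _ => one_dvd _) (fun _ _ _ _ => one_dvd _)
        exact ⟨x, hx, by simpa using hx2⟩
    refine exists_isotropic_of_three h.lor h.prod_elem h.prod_d h.prod_rk h3 ?_ hx hx2
    obtain rfl | rfl : k = 3 ∨ k = 4 := by omega
    · decide +kernel
    · decide +kernel

theorem Ter.isom : ∀ {k : ℕ} {M : ILat}, Ter (k + 2) M → k + 2 ≤ 12 →
    Isom (M.prod (rk1 (-1))) ((I1 k).prod ((rk1 3).prod (rk1 3)))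
  | 0, _, h, _ => h.two
  | k + 1, _, h, h12 => by
    obtain ⟨M', hM', hiso⟩ := h.step (h.exists_isotropic (by omega) h12)
    exact hiso.trans (((Isom.refl _).prod (Ter.isom hM' (by omega))).trans (prod_assoc _ _ _).symm)

theorem oneClass_three : OneClass 3 14 6 := by
  have h3 : Nat.Prime 3 := Nat.prime_three
  have han : ∀ L, Gen 3 14 2 L → L.Aniso := by
    intro L h x hx hx2
    by_contra hc
    have h18 : 2 * (3 : ℤ) ^ 2 ∣ L.form x x := by
      have := h.even x
      omega
    obtain ⟨L', i, ξ, ho⟩ := exists_over (p := (3 : ℕ)) (by norm_num) hx (by simpa using hx2)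
    have hg : Gen 3 14 0 L' := Gen.over h3 (a := 0) h ho hc h18
    have := hg.lor.isChar_sq (elem_one_of_d hg.d) hg.rk (by norm_num) (by norm_num) hg.even.isChar_zero
    rw [map_zero] at this
    norm_num at this
  have hex : ∀ L, Gen 3 14 2 L → ∃ M, Isom L (hyp.prod M) := by
    intro L h
    obtain ⟨e, he, he2⟩ := h.lor.exists_isotropic_of_even h.even (D := 13) h.rk (by norm_num)
      (by rw [h.d]; norm_num; decide +kernel)
    obtain ⟨e', f, he', hf⟩ := exists_pair_of_elem (p := (3 : ℕ)) (by norm_num) h.elem he he2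
      fun x hx hx2 => han L h x hx (by rw [hx2]; exact dvd_zero _)
    exact split_hyp h.even he' hf
  have key : ∀ L M, Gen 3 14 2 L → Isom L (hyp.prod M) →
      Isom (oddHyp M) ((rk1 1).prod ((I1 10).prod ((rk1 3).prod (rk1 3)))) := by
    intro L M h hM
    obtain ⟨hP, -, hE, -, hrk, hd⟩ := h.split hM
    have ht : Ter 12 M := ⟨hP, by omega, hE, hd, ((han L h).isom hM).right⟩
    exact (Isom.refl _).prod ((prod_comm (rk1 (-1)) M).trans (ht.isom le_rfl))
  have h2 : OneClass 3 14 2 := by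
    refine ⟨fun L L' h h' => ?_, hex⟩
    obtain ⟨M, hM⟩ := hex L h
    obtain ⟨M', hM'⟩ := hex L' h'
    obtain ⟨-, hev, -, -, -, -⟩ := h.split hM
    obtain ⟨-, hev', hE', -, -, -⟩ := h'.split hM'
    exact (hM.trans (hyp_prod_of_oddHyp hev hev' (p := (3 : ℕ)) (by norm_num) hE'
      ((key L M h hM).trans (key L' M' h' hM').symm))).trans hM'.symm
  exact (h2.step_of_one_le h3 (by norm_num) (by norm_num)).step_of_one_le h3 (by norm_num)
    (by norm_num)


theorem isEven_of_basis {L : ILat} {ι : Type*} (b : Module.Basis ι ℤ L)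
    (h : ∀ i, 2 ∣ L.form (b i) (b i)) : L.IsEven := by
  intro x
  have hx : x ∈ Submodule.span ℤ (Set.range b) := by rw [b.span_eq]; trivial
  induction hx using Submodule.span_induction with
  | mem x hx => obtain ⟨i, rfl⟩ := hx; exact h i
  | zero => simp
  | add x y _ _ hx hy =>
    have h1 : L.form (x + y) (x + y) = L.form x x + L.form y y + 2 * L.form x y := by
      simp only [map_add, LinearMap.add_apply, L.symm y x]; ring
    rw [h1]; exact dvd_add (dvd_add hx hy) (dvd_mul_right _ _)
  | smul a x _ hx =>
    have h1 : L.form (a • x) (a • x) = a * a * L.form x x := by simp; ring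
    rw [h1]; exact hx.mul_left _

theorem ofMatrix_isEven {n : ℕ} {G : Matrix (Fin n) (Fin n) ℤ} (hG : G.IsSymm)
    (h : ∀ i, 2 ∣ G i i) : (ofMatrix G hG).IsEven := by
  refine isEven_of_basis (L := ofMatrix G hG) (Pi.basisFun ℤ (Fin n)) fun i => ?_
  have := congrFun (congrFun (gram_ofMatrix G hG) i) i
  rw [gram, of_apply] at this
  rw [this]; exact h i

theorem ofMatrix_form_single {n : ℕ} {G : Matrix (Fin n) (Fin n) ℤ} (hG : G.IsSymm)
    (x : Fin n → ℤ) (i : Fin n) : (ofMatrix G hG).form (Pi.single i 1) x = (G *ᵥ x) i := by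
  rw [ofMatrix_form, single_dotProduct, one_mul]

theorem isSymm_of_mul_eq {n : ℕ} {p : ℤ} (hp : p ≠ 0) {G C : Matrix (Fin n) (Fin n) ℤ}
    (hG : G.IsSymm) (hC : G * C = p • 1) : C.IsSymm ∧ C * G = p • 1 := by
  have h1 : Cᵀ * G = p • 1 := by
    have := congrArg transpose hC
    rwa [transpose_mul, hG, transpose_smul, transpose_one] at this
  have h2 : p • C = p • Cᵀ := by
    have h : Cᵀ * G * C = p • C := by rw [h1]; simp
    rw [← h, Matrix.mul_assoc, hC, Matrix.mul_smul, Matrix.mul_one]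
  have h3 : C.IsSymm := (smul_right_injective _ hp h2).symm
  exact ⟨h3, by rw [← h1, h3]⟩

theorem ofMatrix_elem {n : ℕ} {p : ℤ} (hp : p ≠ 0) {G C : Matrix (Fin n) (Fin n) ℤ}
    (hG : G.IsSymm) (hC : G * C = p • 1) : (ofMatrix G hG).Elem p := by
  obtain ⟨hCs, hCG⟩ := isSymm_of_mul_eq hp hG hC
  intro φ
  let w : Fin n → ℤ := fun i => φ (Pi.single i 1)
  have hφ : ∀ y : Fin n → ℤ, φ y = w ⬝ᵥ y := fun y => by
    conv_lhs => rw [pi_eq_sum_univ' y]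
    rw [map_sum]
    refine Finset.sum_congr rfl fun i _ => ?_
    rw [mul_comm, ← smul_eq_mul, ← map_smul]
  refine ⟨C *ᵥ w, fun y => ?_⟩
  rw [ofMatrix_form, hφ, dotProduct_mulVec, vecMul_mulVec, ← mulVec_transpose,
    transpose_mul, hG, transpose_transpose, hC, smul_mulVec, one_mulVec, smul_dotProduct,
    smul_eq_mul]

theorem ofMatrix_e2 {n : ℕ} {p : ℤ} (hp : p ≠ 0) {G C : Matrix (Fin n) (Fin n) ℤ}
    (hG : G.IsSymm) (hC : G * C = p • 1) (h2 : ∀ i, 2 ∣ C i i) : (ofMatrix G hG).E2 p := by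
  obtain ⟨hCs, hCG⟩ := isSymm_of_mul_eq hp hG hC
  intro x hx
  have h1 : ∀ i, p ∣ (G *ᵥ x) i := fun i => by
    rw [← ofMatrix_form_single hG, (ofMatrix G hG).symm]; exact hx _
  choose z hz using h1
  have hz' : G *ᵥ x = p • z := funext hz
  have hx' : x = C *ᵥ z := by
    have h : p • x = p • (C *ᵥ z) := by
      rw [← mulVec_smul, ← hz', mulVec_mulVec, hCG]; simp
    exact smul_right_injective _ hp h
  rw [ofMatrix_form, hz', dotProduct_smul, smul_eq_mul, mul_comm 2 p]
  refine mul_dvd_mul_left p ?_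
  rw [hx', dotProduct_comm, ← ofMatrix_form C hCs]
  exact ofMatrix_isEven hCs h2 z


theorem dotProduct_diagonal_mulVec_castSucc {n : ℕ} (a b : Fin (n + 1) → ℝ) :
    a ⬝ᵥ (diagonal fun i : Fin (n + 1) => if (i : ℕ) < n then (1 : ℝ) else -1) *ᵥ b =
      ∑ i : Fin n, a i.castSucc * b i.castSucc - a (Fin.last n) * b (Fin.last n) := by
  simp [dotProduct, mulVec_diagonal, Fin.sum_univ_castSucc, sub_eq_add_neg]

theorem cast_dotProduct_mulVec {ι : Type*} [Fintype ι] (G : Matrix ι ι ℤ) (x y : ι → ℤ) :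
    ((x ⬝ᵥ G *ᵥ y : ℤ) : ℝ) =
      (fun i => (x i : ℝ)) ⬝ᵥ (G.map (Int.cast : ℤ → ℝ)) *ᵥ fun i => (y i : ℝ) := by
  simp [dotProduct, mulVec]

theorem ofMatrix_lor {m : ℕ} {B : Matrix (Fin (2 * m + 2)) (Fin (2 * m + 2)) ℤ} (hB : B.IsSymm)
    (h : HasLorentzSignature m B) : (ofMatrix B hB).Lor := by
  obtain ⟨P, hP, hPB⟩ := h
  have hPi : P * P⁻¹ = 1 := mul_nonsing_inv P hP
  set D := diagonal fun i : Fin (2 * m + 2) => if (i : ℕ) < 2 * m + 1 then (1 : ℝ) else -1 with hD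
  have key : ∀ u w : Fin (2 * m + 2) → ℝ, (P *ᵥ u) ⬝ᵥ (B.map (Int.cast : ℤ → ℝ)) *ᵥ (P *ᵥ w) =
      u ⬝ᵥ D *ᵥ w := fun u w => by
    rw [← hPB, ← mulVec_mulVec, ← mulVec_mulVec, dotProduct_mulVec u, vecMul_transpose]
  have hPP : ∀ u : Fin (2 * m + 2) → ℝ, P *ᵥ (P⁻¹ *ᵥ u) = u := fun u => by
    rw [mulVec_mulVec, hPi, one_mulVec]
  have key2 : ∀ x y : Fin (2 * m + 2) → ℤ, (((ofMatrix B hB).form x y : ℤ) : ℝ) =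
      (P⁻¹ *ᵥ fun i => (x i : ℝ)) ⬝ᵥ D *ᵥ (P⁻¹ *ᵥ fun i => (y i : ℝ)) := fun x y => by
    rw [← key, hPP, hPP, ofMatrix_form, cast_dotProduct_mulVec]
  obtain ⟨v, hv⟩ : ∃ v : Fin (2 * m + 2) → ℤ, v ⬝ᵥ B *ᵥ v < 0 := by
    by_contra! hcon
    have h1 := (posSemidef_of_int B hB hcon).dotProduct_mulVec_nonneg (P *ᵥ Pi.single (Fin.last _) 1)
    rw [star_trivial, key, hD, dotProduct_diagonal_mulVec_castSucc] at h1
    simp at h1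
    linarith
  refine ⟨v, hv, fun x hx hxv => ?_⟩
  have e1 := key2 x v
  have e2 := key2 v v
  have e3 := key2 x x
  have hv' : (((ofMatrix B hB).form v v : ℤ) : ℝ) < 0 := by exact_mod_cast hv
  rw [hxv] at e1
  have ha : (P⁻¹ *ᵥ fun i => (x i : ℝ)) ≠ 0 := fun h0 => hx <| by
    have : P *ᵥ (P⁻¹ *ᵥ fun i => (x i : ℝ)) = 0 := by rw [h0, mulVec_zero]
    rw [hPP] at this
    funext i
    have h := congrFun this i
    exact Int.cast_injective (α := ℝ) (h.trans Int.cast_zero.symm)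
  generalize (P⁻¹ *ᵥ fun i => (x i : ℝ)) = a at *
  generalize (P⁻¹ *ᵥ fun i => (v i : ℝ)) = b at *
  rw [hD, dotProduct_diagonal_mulVec_castSucc] at e1 e2 e3
  rw [e2] at hv'
  have cs := Finset.sum_mul_sq_le_sq_mul_sq Finset.univ (fun i : Fin (2 * m + 1) => a i.castSucc)
    (fun i => b i.castSucc)
  have goal : (0 : ℝ) < ((ofMatrix B hB).form x x : ℤ) := by
    rw [e3]
    by_contra! hle
    simp only [← pow_two] at hle hv'
    push_cast at e1
    have e1' : ∑ i : Fin (2 * m + 1), a i.castSucc * b i.castSucc =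
      a (Fin.last _) * b (Fin.last _) := by linarith
    rw [e1'] at cs
    have hs : 0 ≤ ∑ i : Fin (2 * m + 1), a i.castSucc ^ 2 :=
      Finset.sum_nonneg fun i _ => sq_nonneg _
    have hs2 : 0 ≤ ∑ i : Fin (2 * m + 1), b i.castSucc ^ 2 :=
      Finset.sum_nonneg fun i _ => sq_nonneg _
    have hl : a (Fin.last _) ^ 2 = 0 := by
      by_contra hne
      have : 0 < a (Fin.last (2 * m + 1)) ^ 2 := lt_of_le_of_ne (sq_nonneg _) (Ne.symm hne)
      nlinarith
    have hs0 : ∑ i : Fin (2 * m + 1), a i.castSucc ^ 2 = 0 := by linarith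
    rw [Finset.sum_eq_zero_iff_of_nonneg fun i _ => sq_nonneg _] at hs0
    refine ha (funext fun i => ?_)
    refine Fin.lastCases (pow_eq_zero_iff two_ne_zero |>.mp hl) (fun i => ?_) i
    exact pow_eq_zero_iff two_ne_zero |>.mp (hs0 i (Finset.mem_univ i))
  exact_mod_cast goal

theorem gen_of_inGenus {p m : ℕ} (hp : p ≠ 0)
    {B : Matrix (Fin (2 * m + 2)) (Fin (2 * m + 2)) ℤ} (h : InGenusIIpm p m B) :
    Gen p (2 * m + 2) m (ofMatrix B h.1) := by
  obtain ⟨hB, he, hs, hd, C, hC, hC2⟩ := h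
  have hp' : (p : ℤ) ≠ 0 := by exact_mod_cast hp
  refine ⟨ofMatrix_isEven hB he, ofMatrix_lor hB hs, rk_ofMatrix B hB, ?_,
    ofMatrix_elem hp' hB hC, ofMatrix_e2 hp' hB hC hC2⟩
  rw [d_ofMatrix, hd]; simp [Int.natAbs_neg, Int.natAbs_pow]

theorem exists_of_isom {n : ℕ} {B₁ B₂ : Matrix (Fin n) (Fin n) ℤ} (h₁ : B₁.IsSymm)
    (h₂ : B₂.IsSymm) (h : Isom (ofMatrix B₁ h₁) (ofMatrix B₂ h₂)) :
    ∃ V : Matrix (Fin n) (Fin n) ℤ, IsUnit V.det ∧ Vᵀ * B₁ * V = B₂ := by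
  obtain ⟨e, he⟩ := h.symm
  let e' : (Fin n → ℤ) ≃ₗ[ℤ] (Fin n → ℤ) := e
  refine ⟨LinearMap.toMatrix' e'.toLinearMap, ?_, ?_⟩
  · rw [LinearMap.det_toMatrix']
    exact LinearEquiv.isUnit_det' e'
  · have hk : ∀ j, (LinearMap.toMatrix' e'.toLinearMap).col j = e' (Pi.single j 1) := fun j => by
      ext i; simp [LinearMap.toMatrix'_apply]
    ext i j
    have h1 := he (Pi.single i 1) (Pi.single j 1)
    rw [ofMatrix_form, ofMatrix_form, single_dotProduct, one_mul, mulVec_single_one] at h1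
    have h2 : B₂ i j = e' (Pi.single i 1) ⬝ᵥ B₁ *ᵥ e' (Pi.single j 1) := by
      rw [show B₂ i j = B₂.col j i from rfl, ← h1]
    rw [h2, ← hk, ← hk]
    simp only [mul_apply, transpose_apply, dotProduct, mulVec, col_apply, Finset.sum_mul, Finset.mul_sum]
    rw [Finset.sum_comm]
    exact Finset.sum_congr rfl fun _ _ => Finset.sum_congr rfl fun _ _ => by ring

theorem exists_of_inGenus {p m : ℕ} (hp : p ≠ 0) (h : OneClass p (2 * m + 2) m)
    {B₁ B₂ : Matrix (Fin (2 * m + 2)) (Fin (2 * m + 2)) ℤ} (h₁ : InGenusIIpm p m B₁)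
    (h₂ : InGenusIIpm p m B₂) :
    ∃ V : Matrix (Fin (2 * m + 2)) (Fin (2 * m + 2)) ℤ, IsUnit V.det ∧ Vᵀ * B₁ * V = B₂ :=
  exists_of_isom h₁.1 h₂.1 (h.1 _ _ (gen_of_inGenus hp h₁) (gen_of_inGenus hp h₂))


/-- The orthogonal sum of `A` and a binary form `M`, indexed by `Fin (k + 2)`. -/
def addHyp {R : Type*} [Zero R] {k : ℕ} (A : Matrix (Fin k) (Fin k) R) (M : Matrix (Fin 2) (Fin 2) R) :
    Matrix (Fin (k + 2)) (Fin (k + 2)) R :=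
  reindex finSumFinEquiv finSumFinEquiv (fromBlocks A 0 0 M)

section addHyp
variable {R : Type*} {k : ℕ}

theorem addHyp_mul [Ring R] (A A' : Matrix (Fin k) (Fin k) R) (M M' : Matrix (Fin 2) (Fin 2) R) :
    addHyp A M * addHyp A' M' = addHyp (A * A') (M * M') := by
  simp [addHyp, submatrix_mul_equiv, fromBlocks_multiply]

theorem addHyp_transpose [Ring R] (A : Matrix (Fin k) (Fin k) R) (M : Matrix (Fin 2) (Fin 2) R) :
    (addHyp A M)ᵀ = addHyp Aᵀ Mᵀ := by
  simp [addHyp, fromBlocks_transpose, transpose_submatrix]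

theorem addHyp_map [Ring R] {S : Type*} [Ring S] (f : R →+* S) (A : Matrix (Fin k) (Fin k) R)
    (M : Matrix (Fin 2) (Fin 2) R) : (addHyp A M).map f = addHyp (A.map f) (M.map f) := by
  rw [addHyp, addHyp, reindex_apply, reindex_apply, ← submatrix_map, fromBlocks_map]
  simp

theorem addHyp_det [CommRing R] (A : Matrix (Fin k) (Fin k) R) (M : Matrix (Fin 2) (Fin 2) R) :
    (addHyp A M).det = A.det * M.det := by
  simp [addHyp, det_submatrix_equiv_self, det_fromBlocks_zero₂₁]

theorem addHyp_smul_one [Ring R] (c : R) : addHyp (c • (1 : Matrix (Fin k) (Fin k) R)) (c • 1) =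
    c • 1 := by
  have : fromBlocks (c • (1 : Matrix (Fin k) (Fin k) R)) 0 0 (c • (1 : Matrix (Fin 2) (Fin 2) R)) =
    c • 1 := by rw [← fromBlocks_one, fromBlocks_smul]; simp
  rw [addHyp, this]
  ext i j
  simp [one_apply]

theorem addHyp_dvd_diag {A : Matrix (Fin k) (Fin k) ℤ} {M : Matrix (Fin 2) (Fin 2) ℤ}
    (hA : ∀ i, 2 ∣ A i i) (hM : ∀ i, 2 ∣ M i i) (i : Fin (k + 2)) : 2 ∣ addHyp A M i i := by
  obtain ⟨i, rfl⟩ := finSumFinEquiv.surjective i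
  rcases i with i | i
  · simpa [addHyp] using hA i
  · simpa [addHyp] using hM i

theorem addHyp_one_diag (k : ℕ) : addHyp (1 : Matrix (Fin k) (Fin k) ℝ) !![1, 0; 0, -1] =
    diagonal fun i : Fin (k + 2) => if (i : ℕ) < k + 1 then (1 : ℝ) else -1 := by
  ext i j
  obtain ⟨i, rfl⟩ := finSumFinEquiv.surjective i
  obtain ⟨j, rfl⟩ := finSumFinEquiv.surjective j
  rw [addHyp, reindex_apply, submatrix_apply, Equiv.symm_apply_apply, Equiv.symm_apply_apply,
    diagonal_apply]
  simp only [finSumFinEquiv.injective.eq_iff]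
  rcases i with i | i <;> rcases j with j | j
  · have : (i : ℕ) < k + 1 := by omega
    simp [one_apply, this]
  · simp
  · simp
  · fin_cases i <;> fin_cases j <;> simp

end addHyp

theorem inGenus_addHyp {p m : ℕ} {A C : Matrix (Fin (2 * m)) (Fin (2 * m)) ℤ} {c c' : ℤ}
    (hp : p ≠ 0) (hA : A.IsSymm) (hAe : ∀ i, 2 ∣ A i i) (hA0 : ∀ x, 0 ≤ x ⬝ᵥ A *ᵥ x)
    (hAC : A * C = (p : ℤ) • 1) (hCe : ∀ i, 2 ∣ C i i) (hc : 0 < c) (hcc : c * c' = p)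
    (hd : A.det * c ^ 2 = (p : ℤ) ^ m) : InGenusIIpm p m (addHyp A !![0, c; c, 0]) := by
  refine ⟨?_, addHyp_dvd_diag hAe (by simp [Fin.forall_fin_two]), ?_, ?_, addHyp C !![0, c'; c', 0], ?_,
    addHyp_dvd_diag hCe (by simp [Fin.forall_fin_two])⟩
  · rw [IsSymm, addHyp_transpose, hA]
    congr 1
    ext i j; fin_cases i <;> fin_cases j <;> rfl
  · obtain ⟨X, hX⟩ := exists_eq_transpose_mul_self (posSemidef_of_int A hA hA0)
    have hXd : IsUnit X.det := by
      rw [isUnit_iff_ne_zero]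
      intro h0
      have h1 := congrArg det hX
      rw [det_mul, h0, mul_zero] at h1
      have h2 : ((A.det : ℤ) : ℝ) = 0 := by
        rw [← h1]; exact (Int.castRingHom ℝ).map_det A
      rw [Int.cast_eq_zero] at h2
      rw [h2, zero_mul] at hd
      exact pow_ne_zero m (Int.natCast_ne_zero.mpr hp) hd.symm
    obtain ⟨s, hs⟩ : ∃ s : ℝ, 2 * c * (s * s) = 1 := by
      have hc' : (0 : ℝ) < 2 * c := by positivity
      refine ⟨√(1 / (2 * c)), ?_⟩
      rw [Real.mul_self_sqrt (by positivity)]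
      field_simp
    have hs0 : s ≠ 0 := by rintro rfl; simp at hs
    refine ⟨addHyp X⁻¹ !![s, s; s, -s], ?_, ?_⟩
    · rw [addHyp_det, isUnit_iff_ne_zero]
      refine mul_ne_zero ?_ ?_
      · exact ((isUnit_nonsing_inv_det_iff).mpr hXd).ne_zero
      · rw [det_fin_two]; simp
        intro h
        apply hs0
        nlinarith
    · rw [show (Int.cast : ℤ → ℝ) = Int.castRingHom ℝ from rfl, addHyp_map, addHyp_transpose,
        addHyp_mul, addHyp_mul, ← addHyp_one_diag]
      congr 1
      · rw [show (⇑(Int.castRingHom ℝ)) = (Int.cast : ℤ → ℝ) from rfl, hX, ← Matrix.mul_assoc,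
          ← transpose_mul, Matrix.mul_assoc, mul_nonsing_inv _ hXd, transpose_one, one_mul]
      · ext i j
        fin_cases i <;> fin_cases j <;> simp [Matrix.mul_apply, Fin.sum_univ_two] <;> linarith
  · rw [addHyp_det, det_fin_two, ← hd]
    simp; left; ring
  · rw [addHyp_mul, hAC, ← addHyp_smul_one]
    congr 1
    ext i j; fin_cases i <;> fin_cases j <;> simp [hcc, Matrix.mul_apply, Fin.sum_univ_two]

theorem exists_level_matrix {n : ℕ} {p : ℤ} (hp : p ≠ 0) {A : Matrix (Fin n) (Fin n) ℤ}
    (hA : A.IsSymm) (h : (ofMatrix A hA).Elem p) (h2 : (ofMatrix A hA).E2 p) :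
    ∃ C : Matrix (Fin n) (Fin n) ℤ, A * C = p • 1 ∧ ∀ i, 2 ∣ C i i := by
  choose x hx using fun i : Fin n => h (LinearMap.proj (R := ℤ) (φ := fun _ : Fin n => ℤ) i)
  let x' : Fin n → Fin n → ℤ := x
  have hx' : ∀ i, A *ᵥ x' i = p • Pi.single i 1 := fun i => by
    ext k
    rw [← ofMatrix_form_single hA, (ofMatrix A hA).symm]
    refine (hx i _).trans ?_
    simp [Pi.single_apply, eq_comm]
  refine ⟨of fun k i => x' i k, ?_, fun i => ?_⟩
  · ext k i
    have := congrFun (hx' i) k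
    simp only [mulVec, dotProduct] at this
    simp only [Matrix.mul_apply, of_apply, this, Pi.smul_apply, Matrix.smul_apply, one_apply,
      Pi.single_apply]
  · have h1 : x' i ∈ (ofMatrix A hA).R p := fun y => ⟨_, hx i y⟩
    have h3 := h2 _ h1
    rw [ofMatrix_form, hx', dotProduct_smul, dotProduct_single_one, smul_eq_mul, mul_comm] at h3
    exact (mul_dvd_mul_iff_left hp).mp h3


section FixedRank
variable {n p m : ℕ} {U : Matrix (Fin n) (Fin n) ℤ}

theorem rootMultiplicity_one_of_charpoly (hp : p ≠ 0)
    (hU : U.charpoly = (X - 1) ^ m * (X ^ p - 1) ^ m) :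
    (U.map (Int.castRingHom ℚ)).charpoly.rootMultiplicity 1 = 2 * m := by
  have h1 : (U.map (Int.castRingHom ℚ)).charpoly =
      (∑ i ∈ Finset.range p, X ^ i) ^ m * (X - C 1) ^ (2 * m) := by
    rw [charpoly_map, hU]
    simp only [Polynomial.map_mul, Polynomial.map_pow, Polynomial.map_sub, Polynomial.map_X,
      Polynomial.map_one, C_1]
    rw [← geom_sum_mul, mul_pow, two_mul, pow_add]
    ring
  have h2 : (∑ i ∈ Finset.range p, (X : ℚ[X]) ^ i).eval 1 = p := by
    simp [eval_finsetSum]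
  have h3 : ((∑ i ∈ Finset.range p, (X : ℚ[X]) ^ i) ^ m).eval 1 ≠ 0 := by
    rw [eval_pow, h2]
    exact pow_ne_zero _ (Nat.cast_ne_zero.2 hp)
  have h4 : (∑ i ∈ Finset.range p, (X : ℚ[X]) ^ i) ^ m ≠ 0 := fun h => h3 (by rw [h]; simp)
  rw [h1, rootMultiplicity_mul_X_sub_C_pow h4, rootMultiplicity_eq_zero h3, zero_add]

theorem finrank_fixed (hp : p ≠ 0) (hUp : U ^ p = 1)
    (hU : U.charpoly = (X - 1) ^ m * (X ^ p - 1) ^ m) :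
    Module.finrank ℚ (Module.End.eigenspace (toLin' (U.map (Int.castRingHom ℚ))) 1) = 2 * m := by
  have hss : Module.End.IsSemisimple (toLin' (U.map (Int.castRingHom ℚ))) := by
    refine Module.End.isSemisimple_of_squarefree_aeval_eq_zero (p := (X : ℚ[X]) ^ p - 1)
      (Polynomial.Separable.squarefree (X_pow_sub_one_separable_iff.2 (Nat.cast_ne_zero.2 hp))) ?_
    have h1 : (U.map (Int.castRingHom ℚ)) ^ p = 1 := by
      rw [← Matrix.map_pow, hUp]
      simp
    simp only [map_sub, map_pow, aeval_X, map_one]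
    rw [← toLin'_pow, h1, toLin'_one, sub_eq_zero]
    rfl
  rw [← (Module.End.isFinitelySemisimple_iff_isSemisimple.2 hss).maxGenEigenspace_eq_eigenspace,
    LinearMap.finrank_maxGenEigenspace_eq, charpoly_toLin', rootMultiplicity_one_of_charpoly hp hU]

theorem linearIndependent_of_span_fixed (hp : p ≠ 0) (hUp : U ^ p = 1)
    (hU : U.charpoly = (X - 1) ^ m * (X ^ p - 1) ^ m) (b : Fin (2 * m) → Fin n → ℤ)
    (hb : ∀ v : Fin n → ℤ, U *ᵥ v = v → ∃ c : Fin (2 * m) → ℤ, v = ∑ i, c i • b i) :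
    LinearIndependent ℤ b := by
  let f : (Fin n → ℤ) →ₗ[ℤ] (Fin n → ℚ) :=
    { toFun := fun v i => v i
      map_add' := fun v w => by ext; simp
      map_smul' := fun c v => by ext; simp }
  have key : LinearIndependent ℚ (f ∘ b) := by
    rw [linearIndependent_iff_card_le_finrank_span, Fintype.card_fin, Set.finrank]
    refine (finrank_fixed hp hUp hU).ge.trans ?_
    refine Submodule.finrank_mono fun v hv => ?_
    rw [Module.End.mem_eigenspace_iff, toLin'_apply, one_smul] at hv
    obtain ⟨N, hN⟩ := IsLocalization.exist_integer_multiples_of_finite (nonZeroDivisors ℤ) v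
    choose w hw using hN
    have hN0 : ((N : ℤ) : ℚ) ≠ 0 := by exact_mod_cast nonZeroDivisors.ne_zero N.2
    have hw' : f w = ((N : ℤ) : ℚ) • v := by
      ext i
      have := hw i
      simp only [algebraMap_int_eq, eq_intCast, zsmul_eq_mul] at this
      simpa [f] using this
    have hfU : ∀ x, f (U *ᵥ x) = (U.map (Int.castRingHom ℚ)) *ᵥ f x := fun x => by
      ext i
      simp [f, mulVec, dotProduct]
    have hUw : U *ᵥ w = w := by
      have h1 : f (U *ᵥ w) = f w := by rw [hfU, hw', mulVec_smul, hv]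
      ext i
      exact Int.cast_injective (α := ℚ) (congrFun h1 i)
    obtain ⟨c, hc⟩ := hb w hUw
    have h2 : v = ((N : ℤ) : ℚ)⁻¹ • f w := by rw [hw', smul_smul, inv_mul_cancel₀ hN0, one_smul]
    rw [h2, hc, map_sum]
    refine Submodule.smul_mem _ _ (Submodule.sum_mem _ fun i _ => ?_)
    rw [map_smul, ← Int.cast_smul_eq_zsmul ℚ]
    exact Submodule.smul_mem _ _ (Submodule.subset_span ⟨i, rfl⟩)
  exact (((LinearIndependent.iff_fractionRing ℤ ℚ).2 key).of_comp f)

end FixedRank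

theorem pow_eq_one_of_isometry {L : ILat} (hL : L.Pos) {w : Module.End ℤ L}
    (hw : ∀ x y, L.form (w x) (w y) = L.form x y) {k : ℕ} (hk : (w - 1) ^ k = 0) : w = 1 := by
  have h2 : ∀ x : L, (w - 1) ((w - 1) x) = 0 → (w - 1) x = 0 := fun x hx => by
    by_contra hne
    have h3 : w ((w - 1) x) = (w - 1) x := sub_eq_zero.1 hx
    have h4 : (w - 1) x = w x - x := rfl
    have h5 : L.form ((w - 1) x) ((w - 1) x) = 0 := by
      conv_lhs => arg 2; rw [h4]
      rw [map_sub]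
      conv_lhs => arg 1; rw [← h3]
      rw [hw, sub_self]
    exact (hL _ hne).ne' h5
  have h3 : ∀ (j : ℕ) (x : L), ((w - 1) ^ (j + 1)) x = 0 → (w - 1) x = 0 := by
    intro j
    induction j with
    | zero => intro x hx; simpa using hx
    | succ j ih =>
      intro x hx
      rw [pow_succ, Module.End.mul_apply] at hx
      exact h2 x (ih _ hx)
  rw [← sub_eq_zero]
  ext x
  refine h3 k x ?_
  rw [pow_succ', hk, mul_zero, LinearMap.zero_apply]


section Fixed
variable {L : ILat} {u : Module.End ℤ L} {p : ℕ}

/-- The sublattice of fixed vectors. -/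
def fixed (u : Module.End ℤ L) : Submodule ℤ L := LinearMap.ker (u - 1)

/-- The trace `1 + u + ⋯ + u ^ (p - 1)`. -/
def norm (u : Module.End ℤ L) (p : ℕ) : Module.End ℤ L := ∑ i ∈ Finset.range p, u ^ i

theorem mem_fixed {x : L} : x ∈ fixed u ↔ u x = x := by
  rw [fixed, LinearMap.mem_ker, LinearMap.sub_apply, sub_eq_zero]; rfl

theorem norm_mem (hup : u ^ p = 1) (x : L) : norm u p x ∈ fixed u := by
  rw [fixed, LinearMap.mem_ker, ← Module.End.mul_apply, norm, mul_geom_sum, hup, sub_self,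
    LinearMap.zero_apply]

theorem norm_form (hu : ∀ x y, L.form (u x) (u y) = L.form x y) (x : L) {f : L}
    (hf : f ∈ fixed u) : L.form (norm u p x) f = p * L.form x f := by
  rw [mem_fixed] at hf
  have h1 : ∀ i : ℕ, L.form ((u ^ i) x) f = L.form x f := fun i => by
    induction i with
    | zero => rfl
    | succ i ih =>
      rw [pow_succ', Module.End.mul_apply]
      conv_lhs => rw [← hf]
      rw [hu, ih]
  rw [norm, LinearMap.sum_apply, map_sum, LinearMap.sum_apply]
  simp [h1]

theorem exists_extend_fixed (φ : fixed u →ₗ[ℤ] ℤ) : ∃ ψ : L →ₗ[ℤ] ℤ, ∀ x : fixed u, ψ x = φ x := by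
  let f := (u - 1).rangeRestrict
  obtain ⟨s, hs⟩ := Module.projective_lifting_property f LinearMap.id
    (LinearMap.surjective_rangeRestrict _)
  have hs' : ∀ y, f (s y) = y := fun y => LinearMap.congr_fun hs y
  have hmem : ∀ x, x - s (f x) ∈ fixed u := fun x => by
    have h1 : f (x - s (f x)) = 0 := by rw [map_sub, hs', sub_self]
    exact congrArg Subtype.val h1
  let π : L →ₗ[ℤ] fixed u := LinearMap.codRestrict (fixed u) (LinearMap.id - s ∘ₗ f) hmem
  refine ⟨φ ∘ₗ π, fun x => ?_⟩
  have hx : f x = 0 := Subtype.ext x.2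
  have : π x = x := Subtype.ext (by
    change (x : L) - s (f x) = x
    rw [hx, map_zero, sub_zero])
  rw [LinearMap.comp_apply, this]

theorem exists_norm_form (hu : ∀ x y, L.form (u x) (u y) = L.form x y) (hL : L.Elem 1)
    (φ : fixed u →ₗ[ℤ] ℤ) : ∃ y : L, ∀ f : fixed u, L.form (norm u p y) f = p * φ f := by
  obtain ⟨ψ, hψ⟩ := exists_extend_fixed φ
  obtain ⟨y, hy⟩ := hL ψ
  refine ⟨y, fun f => ?_⟩
  rw [norm_form hu y f.2, hy, one_mul, hψ]

theorem fixed_elem (hu : ∀ x y, L.form (u x) (u y) = L.form x y) (hup : u ^ p = 1)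
    (hL : L.Elem 1) : (L.res (fixed u)).Elem p := fun φ => by
  obtain ⟨y, hy⟩ := exists_norm_form (p := p) hu hL φ
  exact ⟨⟨norm u p y, norm_mem hup y⟩, hy⟩

theorem mem_R_fixed (hp : p ≠ 0) (hu : ∀ x y, L.form (u x) (u y) = L.form x y) (hup : u ^ p = 1)
    (hL : L.Elem 1) (hpos : L.Pos) (x : fixed u) :
    x ∈ (L.res (fixed u)).R p ↔ ∃ y, (x : L) = norm u p y := by
  constructor
  · intro hx
    choose g hg using hx
    have hp' : (p : ℤ) ≠ 0 := by exact_mod_cast hp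
    let φ : fixed u →ₗ[ℤ] ℤ :=
      { toFun := g
        map_add' := fun a b => mul_left_cancel₀ hp' (by
          rw [mul_add, ← hg, ← hg, ← hg, map_add])
        map_smul' := fun c a => mul_left_cancel₀ hp' (by
          rw [← hg, map_smul, hg]; simp; ring) }
    obtain ⟨y, hy⟩ := exists_norm_form (p := p) hu hL φ
    refine ⟨y, ?_⟩
    have h0 : x - ⟨norm u p y, norm_mem hup y⟩ = 0 := by
      refine (hpos.res (fixed u)).nondeg _ fun f => ?_
      rw [map_sub, LinearMap.sub_apply, hg f, res_form]
      exact sub_eq_zero.2 (hy f).symm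
    exact congrArg Subtype.val (sub_eq_zero.1 h0)
  · rintro ⟨y, hy⟩ f
    rw [res_form, hy, norm_form hu y f.2]
    exact dvd_mul_right _ _

theorem smul_mem_fixed {k : ℤ} (hk : k ≠ 0) {x : L} (h : k • x ∈ fixed u) : x ∈ fixed u := by
  rw [mem_fixed, map_smul] at *
  exact smul_cancel hk h

end Fixed

section ModP
variable {n p : ℕ} [Fact p.Prime] {B U : Matrix (Fin n) (Fin n) ℤ}

theorem d_fixed (hB : B.IsSymm) (hpos : (ofMatrix B hB).Pos) (hL : (ofMatrix B hB).Elem 1)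
    {u : Module.End ℤ (ofMatrix B hB)} (hU : ∀ x : Fin n → ℤ, u x = U *ᵥ x)
    (hu : ∀ x y, (ofMatrix B hB).form (u x) (u y) = (ofMatrix B hB).form x y) (hup : u ^ p = 1) :
    ((ofMatrix B hB).res (fixed u)).d = p ^ Module.finrank (ZMod p)
      (LinearMap.range (∑ i ∈ Finset.range p,
        (toLin' (U.map (Int.castRingHom (ZMod p))) : Module.End (ZMod p) (Fin n → ZMod p)) ^ i)) := by
  have hp : p.Prime := Fact.out
  set Ub : Module.End (ZMod p) (Fin n → ZMod p) := toLin' (U.map (Int.castRingHom (ZMod p))) with hUb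
  set Tb := ∑ i ∈ Finset.range p, Ub ^ i with hTb
  let red : (Fin n → ℤ) →+ (Fin n → ZMod p) :=
    { toFun := fun v i => v i
      map_zero' := by ext; simp
      map_add' := fun v w => by ext; simp }
  have hred : ∀ x : Fin n → ℤ, red (u x) = Ub (red x) := fun x => by
    rw [hU]
    ext i
    simp [red, Ub, mulVec, dotProduct]
  have hredi : ∀ (i : ℕ) (x : Fin n → ℤ), red ((u ^ i) x) = (Ub ^ i) (red x) := fun i x => by
    induction i with
    | zero => rfl
    | succ i ih => rw [pow_succ', pow_succ', Module.End.mul_apply, Module.End.mul_apply, hred, ih]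
  have hredT : ∀ x : Fin n → ℤ, red (norm u p x) = Tb (red x) := fun x => by
    rw [norm, LinearMap.sum_apply, hTb, LinearMap.sum_apply]
    refine (map_sum red _ _).trans ?_
    exact Finset.sum_congr rfl fun i _ => hredi i x
  have hsurj : Function.Surjective red := fun v => by
    choose w hw using fun i => ZMod.intCast_surjective (v i)
    exact ⟨w, funext hw⟩
  set F := (ofMatrix B hB).res (fixed u) with hF
  let g : (F.R p).toAddSubgroup →+ (Fin n → ZMod p) :=
    red.comp ((fixed u).subtype.toAddMonoidHom.comp (F.R p).toAddSubgroup.subtype)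
  have hker : (F.pm p).toAddSubgroup.addSubgroupOf (F.R p).toAddSubgroup = g.ker := by
    ext x
    rw [AddSubgroup.mem_addSubgroupOf, Submodule.mem_toAddSubgroup, mem_pm, AddMonoidHom.mem_ker]
    constructor
    · rintro ⟨y, hy⟩
      change red ((x : F) : Fin n → ℤ) = 0
      rw [hy]
      ext i
      change (((p : ℤ) * (y : Fin n → ℤ) i : ℤ) : ZMod p) = 0
      simp
    · intro h
      have h1 : ∀ i, (p : ℤ) ∣ ((x : F) : Fin n → ℤ) i := fun i =>
        (ZMod.intCast_zmod_eq_zero_iff_dvd _ p).1 (congrFun h i)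
      choose z hz using h1
      have hz' : ((x : F) : Fin n → ℤ) = (p : ℤ) • z := funext hz
      have hmem : z ∈ fixed u := smul_mem_fixed (L := ofMatrix B hB)
        (Int.natCast_ne_zero.2 hp.ne_zero) (by
          have := (x : F).2
          rwa [hz'] at this)
      exact ⟨⟨z, hmem⟩, Subtype.ext hz'⟩
  have hrange : (g.range : Set (Fin n → ZMod p)) = LinearMap.range Tb := by
    ext v
    constructor
    · rintro ⟨x, rfl⟩
      obtain ⟨y, hy⟩ := (mem_R_fixed hp.ne_zero hu hup hL hpos (x : F)).1 x.2
      refine ⟨red y, ?_⟩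
      rw [← hredT, ← hy]; rfl
    · rintro ⟨w, rfl⟩
      obtain ⟨y, rfl⟩ := hsurj w
      refine ⟨⟨⟨norm u p y, norm_mem hup y⟩,
        (mem_R_fixed hp.ne_zero hu hup hL hpos _).2 ⟨y, rfl⟩⟩, ?_⟩
      rw [← hredT]; rfl
  have h1 := ridx_pm_R hp.ne_zero (fixed_elem hu hup hL)
  rw [← h1, ridx, AddSubgroup.relIndex]
  refine (congrArg AddSubgroup.index hker).trans ?_
  rw [AddSubgroup.index_ker, show Nat.card g.range = Nat.card (LinearMap.range Tb) from
    Nat.card_congr (Equiv.setCongr hrange), Module.natCard_eq_pow_finrank (K := ZMod p),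
    Nat.card_zmod]

end ModP

section Nilpotent
variable {K V : Type*} [Field K] [AddCommGroup V] [Module K V] [FiniteDimensional K V]

theorem finrank_range_pow_add_le (f : Module.End K V) {q : ℕ} (hf : f ^ (q + 1) = 0) {i : ℕ}
    (hi : i ≤ q) : Module.finrank K (LinearMap.range (f ^ (i + 1))) +
      Module.finrank K (LinearMap.range (f ^ q)) ≤ Module.finrank K (LinearMap.range (f ^ i)) := by
  have h1 := LinearMap.finrank_range_add_finrank_ker (f.domRestrict (LinearMap.range (f ^ i)))
  rw [← h1, LinearMap.range_domRestrict, ← LinearMap.range_comp, pow_succ']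
  refine Nat.add_le_add_left ?_ _
  have hle : LinearMap.range (f ^ q) ≤ LinearMap.range (f ^ i) := by
    obtain ⟨j, rfl⟩ := Nat.exists_eq_add_of_le hi
    rw [pow_add]
    exact LinearMap.range_comp_le_range _ _
  refine LinearMap.finrank_le_finrank_of_injective (f := LinearMap.codRestrict _
    (Submodule.inclusion hle) fun x => ?_) ?_
  · obtain ⟨y, hy⟩ := x.2
    rw [LinearMap.mem_ker]
    change f (x : V) = 0
    rw [← hy, ← Module.End.mul_apply, ← pow_succ', hf, LinearMap.zero_apply]
  · intro x y h
    exact Submodule.inclusion_injective hle (congrArg Subtype.val h)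

theorem mul_finrank_range_pow_add_finrank_ker_le (f : Module.End K V) {q : ℕ}
    (hf : f ^ (q + 1) = 0) : q * Module.finrank K (LinearMap.range (f ^ q)) +
      Module.finrank K (LinearMap.ker f) ≤ Module.finrank K V := by
  have h : ∀ i ≤ q, i * Module.finrank K (LinearMap.range (f ^ q)) +
      Module.finrank K (LinearMap.range (f ^ (i + 1))) ≤ Module.finrank K (LinearMap.range f) := by
    intro i hi
    induction i with
    | zero => rw [zero_mul, zero_add, zero_add, pow_one]
    | succ i ih =>
      have h1 := ih (by omega)
      have h2 := finrank_range_pow_add_le f hf hi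
      rw [add_mul]
      omega
  have h1 := LinearMap.finrank_range_add_finrank_ker f
  have h2 := h q le_rfl
  omega

theorem geom_sum_eq_sub_one_pow {p : ℕ} [Fact p.Prime] {A : Type*} [Ring A] [Algebra (ZMod p) A]
    (x : A) : ∑ i ∈ Finset.range p, x ^ i = (x - 1) ^ (p - 1) := by
  have hp : p.Prime := Fact.out
  have h1 : ∑ i ∈ Finset.range p, (X : (ZMod p)[X]) ^ i = (X - 1) ^ (p - 1) := by
    have hX : (X - 1 : (ZMod p)[X]) ≠ 0 := by simpa using X_sub_C_ne_zero (1 : ZMod p)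
    apply mul_right_cancel₀ hX
    rw [geom_sum_mul, ← pow_succ, Nat.sub_add_cancel hp.one_le, sub_pow_char, one_pow]
  have h2 := congrArg (aeval x) h1
  simpa using h2

end Nilpotent


section Auto
variable {n m p : ℕ} {B U : Matrix (Fin n) (Fin n) ℤ}

theorem ofMatrix_pos (hB : B.IsSymm) (hpos : (B.map (Int.cast : ℤ → ℚ)).PosDef) :
    (ofMatrix B hB).Pos := fun x hx => by
  have hx' : (fun i => ((x i : ℤ) : ℚ)) ≠ 0 := fun h => hx (funext fun i => by
    have h1 : ((x i : ℤ) : ℚ) = 0 := congrFun h i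
    have h2 : x i = 0 := by exact_mod_cast h1
    exact h2)
  have h := hpos.dotProduct_mulVec_pos hx'
  have h2 : ((x ⬝ᵥ B *ᵥ x : ℤ) : ℚ) = (star fun i => ((x i : ℤ) : ℚ)) ⬝ᵥ
      B.map (Int.cast : ℤ → ℚ) *ᵥ fun i => ((x i : ℤ) : ℚ) := by
    simp [dotProduct, mulVec]
  rw [← h2] at h
  exact_mod_cast h

theorem transpose_pow_mul (hU : Uᵀ * B * U = B) (k : ℕ) : (U ^ k)ᵀ * B * U ^ k = B := by
  induction k with
  | zero => simp
  | succ k ih =>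
    rw [pow_succ', transpose_mul]
    calc (U ^ k)ᵀ * Uᵀ * B * (U * U ^ k) = (U ^ k)ᵀ * (Uᵀ * B * U) * U ^ k := by
          simp only [Matrix.mul_assoc]
      _ = B := by rw [hU, ih]

theorem ofMatrix_isometry (hB : B.IsSymm) (hU : Uᵀ * B * U = B) (x y : Fin n → ℤ) :
    (ofMatrix B hB).form (U *ᵥ x) (U *ᵥ y) = (ofMatrix B hB).form x y := by
  rw [ofMatrix_form, ofMatrix_form, mulVec_mulVec, dotProduct_comm, dotProduct_mulVec,
    ← mulVec_transpose, mulVec_mulVec, ← Matrix.mul_assoc, hU, dotProduct_comm]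

theorem pow_eq_one_of_charpoly (hB : B.IsSymm) (hpos : (ofMatrix B hB).Pos)
    (hU : Uᵀ * B * U = B) (hcp : U.charpoly = (X - 1) ^ m * (X ^ p - 1) ^ m) : U ^ p = 1 := by
  have h1 : (U - 1) ^ m * (U ^ p - 1) ^ m = 0 := by
    have := aeval_self_charpoly U
    rw [hcp] at this
    simpa using this
  have h2 : (U ^ p - 1) ^ (2 * m) = 0 := by
    have hc : Commute (∑ i ∈ Finset.range p, U ^ i) (U - 1) :=
      (Commute.sum_left _ _ _ fun i _ => ((Commute.refl U).pow_left i).sub_right (Commute.one_right _))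
    rw [two_mul, pow_add]
    nth_rewrite 1 [← geom_sum_mul]
    rw [hc.mul_pow, Matrix.mul_assoc, h1, Matrix.mul_zero]
  have h3 := pow_eq_one_of_isometry hpos (w := toLin' (U ^ p)) (k := 2 * m)
    (fun x y => by
      have := ofMatrix_isometry hB (transpose_pow_mul hU p) x y
      simpa only [toLin'_apply] using this)
    (by
      have h4 : (toLin' (U ^ p) - 1 : Module.End ℤ (Fin n → ℤ)) ^ (2 * m) = 0 := by
        rw [Module.End.one_eq_id, ← toLin'_one, ← map_sub, ← toLin'_pow, h2, map_zero]
      exact h4)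
  have h4 : toLin' (U ^ p) = toLin' (1 : Matrix (Fin n) (Fin n) ℤ) := by
    rw [toLin'_one]; exact h3
  exact toLin'.injective h4

theorem pow_end_eq_one {hB : B.IsSymm} {u : Module.End ℤ (ofMatrix B hB)}
    (hu : ∀ x : Fin n → ℤ, u x = U *ᵥ x) (hup : U ^ p = 1) : u ^ p = 1 := by
  have h : ∀ (k : ℕ) (x : Fin n → ℤ), (u ^ k) x = (U ^ k) *ᵥ x := fun k => by
    induction k with
    | zero => intro x; rw [pow_zero, pow_zero, one_mulVec]; rfl
    | succ k ih => intro x; rw [pow_succ', pow_succ', Module.End.mul_apply, ih, hu, mulVec_mulVec]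
  refine LinearMap.ext fun x => ?_
  rw [h p x, hup, one_mulVec]; rfl

/-- A basis of the fixed lattice. -/
theorem exists_basis_fixed (hB : B.IsSymm) {u : Module.End ℤ (ofMatrix B hB)}
    (hu : ∀ x : Fin n → ℤ, u x = U *ᵥ x) {ι : Type*} [Fintype ι] {b : ι → Fin n → ℤ}
    (hb : ∀ i, U *ᵥ b i = b i)
    (hs : ∀ v : Fin n → ℤ, U *ᵥ v = v → ∃ c : ι → ℤ, v = ∑ i, c i • b i)
    (hl : LinearIndependent ℤ b) :
    ∃ e : Module.Basis ι ℤ (fixed u), ∀ i, ((e i : fixed u) : Fin n → ℤ) = b i := by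
  let b' : ι → fixed u := fun i => ⟨b i, mem_fixed.2 ((hu _).trans (hb i))⟩
  have hl' : LinearIndependent ℤ b' := by
    apply LinearIndependent.of_comp (fixed u).subtype
    exact hl
  refine ⟨Module.Basis.mk hl' fun x _ => ?_, fun i => by rw [Module.Basis.mk_apply]⟩
  obtain ⟨c, hc⟩ := hs x ((hu _).symm.trans (mem_fixed.1 x.2))
  have hx : x = ∑ i, c i • b' i := by
    apply Subtype.ext
    rw [Submodule.coe_sum]
    exact hc
  rw [hx]
  exact Submodule.sum_mem _ fun i _ => Submodule.smul_mem _ _ (Submodule.subset_span ⟨i, rfl⟩)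

theorem le_finrank_ker [Fact p.Prime] {k : ℕ} {b : Fin k → Fin n → ℤ}
    (hb : ∀ i, U *ᵥ b i = b i)
    (hs : ∀ v : Fin n → ℤ, U *ᵥ v = v → ∃ c : Fin k → ℤ, v = ∑ i, c i • b i)
    (hl : LinearIndependent ℤ b) :
    k ≤ Module.finrank (ZMod p) (LinearMap.ker
      (toLin' (U.map (Int.castRingHom (ZMod p))) - 1 : Module.End (ZMod p) (Fin n → ZMod p))) := by
  have hp : p.Prime := Fact.out
  set f : Module.End (ZMod p) (Fin n → ZMod p) := toLin' (U.map (Int.castRingHom (ZMod p))) - 1 with hf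
  let b' : Fin k → LinearMap.ker f := fun i => ⟨fun j => (b i j : ZMod p), by
    rw [LinearMap.mem_ker, hf, LinearMap.sub_apply, sub_eq_zero, toLin'_apply]
    ext j
    have h1 : (((U *ᵥ b i) j : ℤ) : ZMod p) = ((b i j : ℤ) : ZMod p) := by rw [hb]
    rw [Module.End.one_apply, ← h1]
    simp [mulVec, dotProduct]⟩
  have hl' : LinearIndependent (ZMod p) b' := by
    rw [Fintype.linearIndependent_iff]
    intro g hg
    choose c hc using fun i => ZMod.intCast_surjective (g i)
    have h1 : ∀ j, (p : ℤ) ∣ (∑ i, c i • b i) j := fun j => by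
      rw [← ZMod.intCast_zmod_eq_zero_iff_dvd]
      have := congrFun (congrArg Subtype.val hg) j
      rw [Submodule.coe_sum, Finset.sum_apply] at this
      rw [Finset.sum_apply]
      push_cast
      simpa [hc, b'] using this
    choose y hy using h1
    have h2 : ∑ i, c i • b i = (p : ℤ) • y := funext hy
    have h3 : U *ᵥ y = y := by
      have h4 : (p : ℤ) • (U *ᵥ y) = (p : ℤ) • y := by
        rw [← mulVec_smul, ← h2, mulVec_sum]
        exact Finset.sum_congr rfl fun i _ => by rw [mulVec_smul, hb]
      funext i
      have := congrFun h4 i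
      simpa [hp.ne_zero] using this
    obtain ⟨e, he⟩ := hs y h3
    have h5 : ∑ i, (c i - p * e i) • b i = 0 := by
      simp only [sub_smul, mul_smul, Finset.sum_sub_distrib, ← Finset.smul_sum]
      rw [h2, ← he, sub_self]
    intro i
    have h6 := (Fintype.linearIndependent_iff.1 hl) _ h5 i
    rw [← hc, sub_eq_zero.1 h6]
    simp
  simpa using hl'.fintype_card_le_finrank

theorem exists_d_fixed [Fact p.Prime] (hB : B.IsSymm) (hpos : (ofMatrix B hB).Pos)
    (hL : (ofMatrix B hB).Elem 1) {u : Module.End ℤ (ofMatrix B hB)}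
    (hu : ∀ x : Fin n → ℤ, u x = U *ᵥ x) (hU : Uᵀ * B * U = B) (hup : U ^ p = 1)
    {k : ℕ} {b : Fin k → Fin n → ℤ} (hb : ∀ i, U *ᵥ b i = b i)
    (hs : ∀ v : Fin n → ℤ, U *ᵥ v = v → ∃ c : Fin k → ℤ, v = ∑ i, c i • b i)
    (hl : LinearIndependent ℤ b) :
    ∃ a, ((ofMatrix B hB).res (fixed u)).d = p ^ a ∧ (p - 1) * a + k ≤ n := by
  have hp : p.Prime := Fact.out
  have h1 := d_fixed hB hpos hL hu (fun x y => by
    rw [hu, hu]; exact ofMatrix_isometry hB hU x y) (pow_end_eq_one hu hup)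
  rw [geom_sum_eq_sub_one_pow] at h1
  refine ⟨_, h1, ?_⟩
  have h2 := mul_finrank_range_pow_add_finrank_ker_le (q := p - 1)
    (toLin' (U.map (Int.castRingHom (ZMod p))) - 1 : Module.End (ZMod p) (Fin n → ZMod p)) (by
      rw [pow_succ, ← geom_sum_eq_sub_one_pow, geom_sum_mul, ← toLin'_pow,
        ← Matrix.map_pow, hup]
      simp [Module.End.one_eq_id])
  have h3 := le_finrank_ker (p := p) hb hs hl
  rw [Module.finrank_fintype_fun_eq_card, Fintype.card_fin] at h2
  omega

end Auto

theorem exists_over_three {L : ILat} (hpos : L.Pos) (he : L.IsEven) (hE : L.Elem 3) {j : ℕ}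
    (hd : L.d = 3 ^ (j + 2)) (hj : 1 ≤ j) :
    ∃ L' : ILat, L'.Pos ∧ L'.IsEven ∧ L'.Elem 3 ∧ L'.d = 3 ^ j ∧ L'.rk = L.rk := by
  have h3 : (3 : ℤ) ≠ 0 := by norm_num
  have hE2 := E2_of_odd (p := 3) (by norm_num) he
  obtain ⟨x, hx, hx1, hx2⟩ := exists_singular (p := 3) Nat.prime_three (K := L.pm (3 : ℕ)) (S := L.R (3 : ℕ))
    (fun x _ => mem_pm.2 ⟨x, rfl⟩) ((ridx_pm_R (p := 3) (by norm_num) hE).trans hd) (by omega) (s := 6)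
    (fun x hx => hE2 x hx) (fun x hx y _ => by
      obtain ⟨k, hk⟩ := hx y
      exact ⟨k, by rw [hk]; push_cast; ring⟩)
  have hx2' : 2 * (3 : ℤ) ^ 2 ∣ L.form x x := by simpa using hx2
  obtain ⟨L', i, ξ, ho⟩ := exists_over h3 (L := L) (x := x) hx (dvd_of_mul_left_dvd hx2')
  have h1 := ho.d_eq Int.prime_three (fun h => hx1 (mem_pm.2 h))
  refine ⟨L', ho.pos h3 hpos, ho.isEven h3 he hx2', ho.elem h3 hE, ?_, ho.rk⟩
  rw [hd, pow_add] at h1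
  exact (Nat.eq_of_mul_eq_mul_right (by norm_num) h1).symm

/-- The root lattice `A₂`. -/
abbrev rootA2 : ILat := ofMatrix !![2, -1; -1, 2] (by decide)

theorem rootA2_pos : rootA2.Pos := fun (x : Fin 2 → ℤ) hx => by
  have h : rootA2.form x x = x 0 ^ 2 + x 1 ^ 2 + (x 0 - x 1) ^ 2 := by
    rw [ofMatrix_form]
    simp [dotProduct, mulVec, Fin.sum_univ_two]; ring
  rw [h]
  by_contra! h1
  have h2 : x 0 = 0 := by nlinarith [sq_nonneg (x 0), sq_nonneg (x 1), sq_nonneg (x 0 - x 1)]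
  have h3 : x 1 = 0 := by nlinarith [sq_nonneg (x 0), sq_nonneg (x 1), sq_nonneg (x 0 - x 1)]
  refine hx (funext fun i => ?_)
  fin_cases i
  · exact h2
  · exact h3

theorem not_d_eq_three {L : ILat} (hpos : L.Pos) (he : L.IsEven) (hE : L.Elem 3) (hd : L.d = 3)
    (hrk : L.rk = 12) : False := by
  have h3 : (3 : ℤ) ≠ 0 := by norm_num
  have hE2 := E2_of_odd (p := 3) (by norm_num) he
  obtain ⟨x, hx, hx1⟩ : ∃ x ∈ L.R 3, x ∉ L.pm 3 := by
    by_contra! h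
    have h1 := ridx_pm_R (p := 3) (by norm_num) hE
    rw [ridx, AddSubgroup.relIndex_eq_one.2 h, hd] at h1
    norm_num at h1
  obtain ⟨k, hk⟩ := hE2 x hx
  obtain h0 | h0 | h0 : k % 3 = 0 ∨ k % 3 = 1 ∨ k % 3 = 2 := by omega
  · obtain ⟨L', i, ξ, ho⟩ := exists_over h3 hx (by rw [hk]; omega)
    have h1 := ho.d_eq Int.prime_three (fun h => hx1 (mem_pm.2 h))
    rw [hd] at h1
    norm_num at h1
    omega
  · let M := L.prod (rk1 3)
    let w : M := (x, (1 : ℤ))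
    have hw : w ∈ M.R 3 := mem_R_prod.2 ⟨hx, fun y => by rw [rk1_form]; exact ⟨y, by ring⟩⟩
    have hw2 : M.form w w = 6 * k + 3 := by rw [prod_form, rk1_form, hk]; ring
    obtain ⟨L', i, ξ, ho⟩ := exists_over h3 hw (by rw [hw2]; omega)
    have h1 := ho.d_eq Int.prime_three (fun ⟨y, hy⟩ => hx1 (mem_pm.2 ⟨y.1, congrArg Prod.fst hy⟩))
    rw [d_prod, hd, d_rk1] at h1
    have h2 : L'.d = 1 := by norm_num at h1; omega
    have h4 := ho.isChar (by norm_num) (he.isChar_zero.prod (rk1_isChar (c := 3) (k := 1) (by norm_num)))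
    have h5 := (ho.pos h3 (hpos.prod (rk1_pos (by norm_num)))).isChar_sq (elem_one_of_d h2) (n := 13)
      (by rw [ho.rk, rk_prod, rk_rk1, hrk]) (by norm_num) (by norm_num) h4
    rw [ho.form, prod_form, rk1_form] at h5
    simp at h5
  · let M := L.prod rootA2
    let w : M := (x, (![1, -1] : Fin 2 → ℤ))
    have hw : w ∈ M.R 3 := mem_R_prod.2 ⟨hx, fun (y : Fin 2 → ℤ) => by
      rw [ofMatrix_form]
      refine ⟨y 0 - y 1, ?_⟩
      simp [dotProduct, mulVec, Fin.sum_univ_two, w]; ring⟩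
    have hw2 : M.form w w = 6 * k + 6 := by
      rw [prod_form, ofMatrix_form, hk]
      simp [dotProduct, mulVec, Fin.sum_univ_two, w]
    obtain ⟨L', i, ξ, ho⟩ := exists_over h3 hw (by rw [hw2]; omega)
    have h1 := ho.d_eq Int.prime_three (fun ⟨y, hy⟩ => hx1 (mem_pm.2 ⟨y.1, congrArg Prod.fst hy⟩))
    rw [d_prod, hd, d_ofMatrix] at h1
    have h2 : L'.d = 1 := by norm_num [det_fin_two] at h1; omega
    have hA : rootA2.IsEven := ofMatrix_isEven _ (by decide)
    have h4 := ho.isChar (by norm_num) (he.prod hA).isChar_zero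
    have h5 := (ho.pos h3 (hpos.prod rootA2_pos)).isChar_sq (elem_one_of_d h2) (n := 14)
      (by rw [ho.rk, rk_prod, rk_ofMatrix, hrk]) (by norm_num) (by norm_num) h4
    rw [map_zero, map_zero] at h5
    norm_num at h5

theorem le_four {L : ILat} (hpos : L.Pos) (he : L.IsEven) (h2 : ∀ x, L.form x x ≠ 2) (x : L)
    (hx : x ≠ 0) : ((4 : ℕ) : ℤ) ≤ L.form x x := by
  have := he x
  have := h2 x
  have := hpos x hx
  push_cast
  omega

theorem le_exponent {L : ILat} (hpos : L.Pos) (he : L.IsEven) (h2 : ∀ x, L.form x x ≠ 2) {p m a : ℕ}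
    (hd : L.d = p ^ a) (hrk : L.rk = 2 * m) (hE : L.Elem p)
    (hpm : p = 3 ∧ m = 6 ∨ p = 5 ∧ m = 4 ∨ p = 7 ∧ m = 3) : m ≤ a := by
  have hle := le_four hpos he h2
  by_contra! ha
  obtain ⟨rfl, rfl⟩ | ⟨rfl, rfl⟩ | ⟨rfl, rfl⟩ := hpm
  · have h1 := hpos.blich_le hrk (by norm_num) hle
    have h3 : (81 : ℚ) < blich (2 * 6) ^ 2 * (((4 : ℕ) : ℚ) / 2) ^ (2 * 6) := by decide +kernel
    rw [hd] at h1
    have h4 : (81 : ℚ) < ((3 ^ a : ℕ) : ℚ) := h3.trans_le h1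
    have h5 : 3 ^ 4 < 3 ^ a := by exact_mod_cast h4
    have h6 : 4 < a := (Nat.pow_lt_pow_iff_right (by norm_num)).1 h5
    obtain rfl : a = 5 := by omega
    obtain ⟨L', a1, a2, a3, a4, a5⟩ := exists_over_three hpos he hE (j := 3) hd (by norm_num)
    obtain ⟨L'', b1, b2, b3, b4, b5⟩ := exists_over_three a1 a2 a3 (j := 1) a4 (by norm_num)
    exact not_d_eq_three b1 b2 b3 b4 (by rw [b5, a5, hrk])
  · have h1 := hpos.blich_le hrk (by norm_num) hle
    have h3 : (125 : ℚ) < blich (2 * 4) ^ 2 * (((4 : ℕ) : ℚ) / 2) ^ (2 * 4) := by decide +kernel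
    rw [hd] at h1
    have h4 : (125 : ℚ) < ((5 ^ a : ℕ) : ℚ) := h3.trans_le h1
    have h5 : 5 ^ 3 < 5 ^ a := by exact_mod_cast h4
    have h6 : 3 < a := (Nat.pow_lt_pow_iff_right (by norm_num)).1 h5
    omega
  · have h1 := hpos.blich_le hrk (by norm_num) hle
    have h3 : (49 : ℚ) < blich (2 * 3) ^ 2 * (((4 : ℕ) : ℚ) / 2) ^ (2 * 3) := by decide +kernel
    rw [hd] at h1
    have h4 : (49 : ℚ) < ((7 ^ a : ℕ) : ℚ) := h3.trans_le h1
    have h5 : 7 ^ 2 < 7 ^ a := by exact_mod_cast h4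
    have h6 : 2 < a := (Nat.pow_lt_pow_iff_right (by norm_num)).1 h5
    omega

theorem card_kerp_dvd (L : ILat) (p : ℕ) (w : L) : Nat.card (L ⧸ L.kerp p w) ∣ p := by
  let f : L →+ ZMod p := (Int.castAddHom _).comp (L.form w).toAddMonoidHom
  have hS : L.kerp p w = LinearMap.ker f.toIntLinearMap := by
    ext x
    exact (ZMod.intCast_zmod_eq_zero_iff_dvd (L.form w x) p).symm
  rw [hS, Nat.card_congr f.toIntLinearMap.quotKerEquivRange.toEquiv]
  have := AddSubgroup.card_addSubgroup_dvd_card (LinearMap.range f.toIntLinearMap).toAddSubgroup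
  rwa [Nat.card_zmod] at this

/-- The two-neighbour of a unimodular lattice at a vector of norm divisible by four. -/
theorem exists_neighbour {M : ILat} (hu : M.Elem 1) {w : M} (hw : 4 ∣ M.form w w)
    (hw2 : ¬ ∃ y, w = (2 : ℤ) • y) :
    ∃ (w' : M.kerp 2 w) (L' : ILat) (i : M.res (M.kerp 2 w) →ₗ[ℤ] L') (ξ : L'),
      (w' : M) = w ∧ Over 2 (L := M.res (M.kerp 2 w)) i w' ξ ∧ L'.Elem 1 ∧ L'.rk = M.rk := by
  have h2 : ∀ x : M, (2 : ℤ) • x ∈ M.kerp 2 w := fun x => by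
    rw [mem_kerp, map_smul]; exact ⟨_, rfl⟩
  have hrk := rk_res M (M.kerp 2 w) two_ne_zero h2
  let w' : M.kerp 2 w := ⟨w, mem_kerp.2 (dvd_trans (by norm_num) hw)⟩
  obtain ⟨L', i, ξ, ho⟩ := exists_over two_ne_zero (L := M.res (M.kerp 2 w)) (x := w') (p := 2)
    (fun y => y.2) (by norm_num; exact hw)
  have hd := ho.d_eq Int.prime_two fun ⟨y, hy⟩ => hw2 ⟨y, congrArg Subtype.val hy⟩
  rw [d_res M _ hrk, d_of_elem_one hu, one_mul] at hd
  refine ⟨w', L', i, ξ, rfl, ho, elem_one_of_d ?_, ho.rk.trans hrk⟩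
  have hc := card_kerp_dvd M 2 w
  obtain h1 | h1 := (Nat.dvd_prime Nat.prime_two).1 hc
  · have h1' : Nat.card (M ⧸ M.kerp 2 w) = 1 := h1
    rw [h1'] at hd; norm_num at hd; omega
  · have h1' : Nat.card (M ⧸ M.kerp 2 w) = 2 := h1
    rw [h1'] at hd; norm_num at hd; omega

theorem eight_dvd_sq_of_odd {c : Fin 8 → ℤ} (h : ∀ j, ¬ 2 ∣ c j) : 8 ∣ ∑ j, c j * c j := by
  have h1 : ∀ j, 8 ∣ c j * c j - 1 := fun j => by
    obtain ⟨k, hk⟩ := Int.odd_iff.2 (Int.two_dvd_ne_zero.1 (h j))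
    obtain ⟨l, hl⟩ := Int.even_mul_succ_self k
    exact ⟨l, by rw [hk]; linear_combination 4 * hl⟩
  have h2 : ∑ j, c j * c j = ∑ j, (c j * c j - 1) + 8 := by
    rw [Finset.sum_sub_distrib]; simp
  rw [h2]
  exact dvd_add (Finset.dvd_sum fun j _ => h1 j) dvd_rfl

/-- A unimodular lattice of rank eight without vectors of norm one is even. -/
theorem Pos.isEven_of_rk_eight {M : ILat} (hM : M.Pos) (hu : M.Elem 1) (hrk : M.rk = 8)
    (h1 : ∀ x, M.form x x ≠ 1) : M.IsEven := by
  obtain ⟨S, hSe, hS2, -, hSd⟩ := exists_even_sublattice M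
  rw [d_of_elem_one hu] at hSd
  have hSrk : (M.res S).rk = 8 := (rk_res M S two_ne_zero hS2).trans hrk
  obtain ⟨r, hr, hr4⟩ := (hM.res S).exists_short hSrk (by norm_num) (μ := 4) (by
    have h3 : (4 : ℚ) < blich 8 ^ 2 * (((4 : ℕ) : ℚ) / 2) ^ 8 := by decide +kernel
    exact lt_of_le_of_lt (by exact_mod_cast hSd) h3)
  have hr2 : (M.res S).form r r = 2 := by
    have := hM.res S r hr
    have := hSe r
    have : (M.res S).form r r < 4 := hr4
    omega
  obtain ⟨j, -, hj, hjd, hjrk⟩ := orthogonal_complement (M.res S) hr2 two_ne_zero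
  set T := LinearMap.ker ((M.res S).form r) with hT
  obtain ⟨t, ht, ht4⟩ := ((hM.res S).res T).exists_short (D := 7) (by omega) (by norm_num) (μ := 4) (by
    have h3 : (8 : ℚ) < blich 7 ^ 2 * (((4 : ℕ) : ℚ) / 2) ^ 7 := by decide +kernel
    refine lt_of_le_of_lt ?_ h3
    have h4 : j ≤ 2 := Nat.le_of_dvd (by norm_num) hj
    have h5 : j ^ 2 ≤ 4 := by nlinarith
    have h6 : ((M.res S).res T).d ≤ 8 := by
      norm_num at hjd
      nlinarith
    exact_mod_cast h6)
  have ht2 : ((M.res S).res T).form t t = 2 := by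
    have := (hM.res S).res T t ht
    have := hSe.res T t
    have : ((M.res S).res T).form t t < 4 := ht4
    omega
  have hrt : (M.res S).form r t = 0 := t.2
  have hw4 : M.form ((r : M) + (t : S)) ((r : M) + (t : S)) = 4 := by
    have e1 : M.form r r = 2 := hr2
    have e2 : M.form (t : S) (t : S) = 2 := ht2
    have e3 : M.form r (t : S) = 0 := hrt
    rw [form_add_sq, e1, e2, e3]; norm_num
  set w : M := (r : M) + (t : S) with hw
  have hw2 : ¬ ∃ y, w = (2 : ℤ) • y := fun ⟨y, hy⟩ => by
    rw [hy, form_smul_sq] at hw4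
    exact h1 y (by omega)
  obtain ⟨w', L', i, ξ, hw', ho, hL', hrk'⟩ := exists_neighbour hu (by rw [hw4]) hw2
  have hξ : L'.form ξ ξ = 1 := by
    have := ho.sq
    rw [res_form, hw', hw4] at this
    omega
  have hpos' := ho.pos two_ne_zero (hM.res _)
  have hiso := split_unit (L := L') (ε := 1) (by norm_num) hξ
  obtain ⟨e, he⟩ := (hiso.trans ((Isom.refl (rk1 1)).prod ((hiso.pos hpos').right.isom_std (k := 7)
    (hiso.elem hL').right (by
      have := hiso.rk
      rw [rk_prod, rk_rk1, hrk', hrk] at this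
      omega) (by decide +kernel)))).trans (rk1_prod_std 7)
  have hodd : ∀ s : M, ¬ 2 ∣ M.form w s → 2 ∣ M.form s s := fun s hs => by
    let u : M.kerp 2 w := ⟨(2 : ℤ) • s, by rw [mem_kerp, map_smul]; exact ⟨_, rfl⟩⟩
    let c : Fin 8 → ℤ := e (i u)
    have hc : ∀ j, ¬ 2 ∣ c j := fun j hj => by
      obtain ⟨z, hz⟩ := e.surjective (Pi.single j 1 : Fin 8 → ℤ)
      have hz1 : L'.form z z = 1 := by
        rw [← he, hz, std_form]; simp [Pi.single_apply]
      have hzu : 2 ∣ L'.form z (i u) := by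
        rw [← he, hz, std_form]
        simpa [Pi.single_apply] using hj
      obtain ⟨t, n, rfl⟩ := ho.gen z
      have h3 : L'.form (i u) ξ = M.form w s := by
        have h4 := ho.form_left u
        rw [res_form, hw', M.symm, map_smul, smul_eq_mul] at h4
        omega
      rw [map_add, LinearMap.add_apply, ho.form, map_smul, LinearMap.smul_apply, L'.symm ξ, h3,
        res_form, map_smul, smul_eq_mul, smul_eq_mul] at hzu
      have hn : 2 ∣ n :=
        (Int.prime_two.dvd_or_dvd ((dvd_add_right (Dvd.intro _ rfl)).1 hzu)).resolve_right hs
      obtain ⟨k, rfl⟩ := hn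
      rw [mul_comm, mul_smul, ho.smul, ← map_smul, ← map_add, ho.form] at hz1
      exact h1 _ hz1
    have h3 := eight_dvd_sq_of_odd hc
    have h4 : ∑ j, c j * c j = 4 * M.form s s := by
      rw [← std_form, he, ho.form, res_form, form_smul_sq]; norm_num
    rw [h4] at h3
    omega
  obtain ⟨φ, hφ⟩ := exists_functional_not_dvd hw2
  obtain ⟨t, ht⟩ := hu φ
  have ht2 : ¬ 2 ∣ M.form w t := by rwa [M.symm, ht, one_mul]
  intro s
  by_cases hs : 2 ∣ M.form w s
  · have h3 := hodd (s + t) (by rw [map_add]; omega)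
    have h4 := hodd t ht2
    rw [form_add_sq] at h3
    omega
  · exact hodd s hs

theorem finrank_fixed_neg_add {L : ILat} {u : Module.End ℤ L} (hup : u ^ 2 = 1) :
    (L.res (fixed (-u))).rk + (L.res (fixed u)).rk = L.rk := by
  have h1 := Submodule.finrank_quotient_add_finrank (LinearMap.ker (u - 1 : Module.End ℤ L))
  rw [(LinearMap.quotKerEquivRange (u - 1 : Module.End ℤ L)).finrank_eq] at h1
  have huu : ∀ x, u (u x) = x := fun x => by
    rw [← Module.End.mul_apply, ← sq, hup]; rfl
  have h2 : (L.res (fixed (-u))).rk = Module.finrank ℤ (LinearMap.range (u - 1 : Module.End ℤ L)) := by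
    apply le_antisymm
    · let f : fixed (-u) →ₗ[ℤ] LinearMap.range (u - 1 : Module.End ℤ L) :=
        (u - 1 : Module.End ℤ L).rangeRestrict ∘ₗ (fixed (-u)).subtype
      refine LinearMap.finrank_le_finrank_of_injective (f := f) ((injective_iff_map_eq_zero _).2 fun x hx => ?_)
      have h3 : u (x : L) - x = 0 := congrArg Subtype.val hx
      have h4 : -u (x : L) = x := mem_fixed.1 x.2
      have h5 : (x : L) + x = 0 := by
        nth_rewrite 1 [← h4]
        rw [sub_eq_zero.1 h3, neg_add_cancel]
      exact Subtype.ext ((smul_eq_zero.1 ((two_smul ℤ (x : L)).trans h5)).resolve_left two_ne_zero)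
    · refine Submodule.finrank_mono ?_
      rintro _ ⟨x, rfl⟩
      change (u - 1 : Module.End ℤ L) x ∈ fixed (-u)
      rw [mem_fixed]
      change -u (u x - x) = u x - x
      rw [map_sub, huu, neg_sub]
  have h3 : (L.res (fixed u)).rk = Module.finrank ℤ (LinearMap.ker (u - 1 : Module.End ℤ L)) := rfl
  rw [h2, h3, h1]; rfl

section Auto
variable {n m p : ℕ} {B U : Matrix (Fin n) (Fin n) ℤ}

/-- The fixed lattice and the lattice of vectors mapped to their negative have the same
determinant. -/
theorem d_fixed_neg (hB : B.IsSymm) (hpos : (ofMatrix B hB).Pos)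
    (hL : (ofMatrix B hB).Elem 1) {u : Module.End ℤ (ofMatrix B hB)}
    (hu : ∀ x : Fin n → ℤ, u x = U *ᵥ x) (hU : Uᵀ * B * U = B) (hup : U ^ 2 = 1) :
    ((ofMatrix B hB).res (fixed (-u))).d = ((ofMatrix B hB).res (fixed u)).d := by
  have hiso : ∀ x y, (ofMatrix B hB).form (u x) (u y) = (ofMatrix B hB).form x y := fun x y => by
    rw [hu, hu]; exact ofMatrix_isometry hB hU x y
  have hup' := pow_end_eq_one hu hup
  have h1 := d_fixed hB hpos hL hu hiso hup'
  have h2 := d_fixed (p := 2) hB hpos hL (u := -u) (U := -U)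
    (fun x => by rw [LinearMap.neg_apply, hu, neg_mulVec])
    (fun x y => by
      rw [LinearMap.neg_apply, LinearMap.neg_apply, map_neg, map_neg, LinearMap.neg_apply, neg_neg, hiso])
    (by rw [neg_sq, hup'])
  have h3 : (-U).map (Int.castRingHom (ZMod 2)) = U.map (Int.castRingHom (ZMod 2)) := by
    ext i j
    have : ∀ a : ZMod 2, -a = a := by decide
    simp [this]
  rw [h1, h2, h3]

theorem eight_le_exponent {K : ILat} (hpos : K.Pos) (he : K.IsEven) (h2 : ∀ x, K.form x x ≠ 2)
    (hrk : K.rk = 8) {a : ℕ} (hd : K.d = 2 ^ a) : 8 ≤ a := by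
  have h1 := hpos.blich_le hrk (by norm_num) (le_four hpos he h2)
  have h3 : (128 : ℚ) < blich 8 ^ 2 * (((4 : ℕ) : ℚ) / 2) ^ 8 := by decide +kernel
  rw [hd] at h1
  have h4 : (128 : ℚ) < ((2 ^ a : ℕ) : ℚ) := h3.trans_le h1
  have h5 : 2 ^ 7 < 2 ^ a := by exact_mod_cast h4
  exact (Nat.pow_lt_pow_iff_right (by norm_num)).1 h5

theorem four_dvd_sq {K : ILat} (hpos : K.Pos) (h2 : ∀ x, K.form x x ≠ 2)
    (hrk : K.rk = 8) (hE : K.Elem 2) (hd : K.d = 2 ^ 8) (x : K) : 4 ∣ K.form x x := by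
  have hc := card_R (p := (2 : ℕ)) (by norm_num) hE
  rw [hd, hrk, Int.natAbs_natCast] at hc
  have h1 : Nat.card (K ⧸ K.R (2 : ℕ)) = 1 := by omega
  have hR : K.R (2 : ℕ) = ⊤ := by
    have := (Nat.card_eq_one_iff_unique.1 h1).1
    exact Submodule.Quotient.subsingleton_iff.1 this
  have hdv : ∀ y z : K, (2 : ℤ) ∣ K.form y z := fun y z => by
    have : y ∈ K.R (2 : ℕ) := hR ▸ Submodule.mem_top
    exact this z
  have hd' := d_down _ hdv
  rw [hd, hrk] at hd'
  have h3 := (hpos.down (by norm_num) hdv).isEven_of_rk_eight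
    (elem_one_of_d (by norm_num at hd'; omega)) hrk (fun y hy => h2 y (by
      rw [← K.down_form hdv, hy]; norm_num)) x
  rw [← K.down_form hdv]
  obtain ⟨k, hk⟩ := h3
  rw [hk]
  exact ⟨k, by ring⟩

theorem fixed_E2 {L : ILat} {u : Module.End ℤ L}
    (hu : ∀ x y, L.form (u x) (u y) = L.form x y) (hup : u ^ 2 = 1) (hL : L.Elem 1) (hpos : L.Pos)
    (h : ∀ x : fixed (-u), 4 ∣ L.form x x) : (L.res (fixed u)).E2 2 := fun x hx => by
  obtain ⟨y, hy⟩ := (mem_R_fixed (p := 2) two_ne_zero hu hup hL hpos x).1 hx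
  have huu : u (u y) = y := by rw [← Module.End.mul_apply, ← sq, hup]; rfl
  have hy' : (x : L) = y + u y := by
    rw [hy, norm, Finset.sum_range_succ, Finset.sum_range_one, pow_zero, pow_one]; rfl
  have h1 := h ⟨y - u y, mem_fixed.2 (by
    change -u (y - u y) = y - u y
    rw [map_sub, huu, neg_sub])⟩
  rw [res_form, hy', form_add_sq, hu]
  change 4 ∣ L.form (y - u y) (y - u y) at h1
  rw [sub_eq_add_neg, form_add_sq] at h1
  simp only [map_neg, LinearMap.neg_apply, hu] at h1
  omega

/-- The fixed lattice of an automorphism of cycle shape `1ᵐpᵐ` of the Leech lattice, extended by a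
hyperbolic plane. -/
theorem inGenus_fixed {p m : ℕ} {B U : Matrix (Fin 24) (Fin 24) ℤ}
    (hpm : p = 2 ∧ m = 8 ∨ p = 3 ∧ m = 6 ∨ p = 5 ∧ m = 4 ∨ p = 7 ∧ m = 3)
    (hB : B.IsSymm) (hBeven : ∀ i, 2 ∣ B i i) (hBpos : (B.map (Int.cast : ℤ → ℚ)).PosDef)
    (hBdet : B.det = 1) (hBnoroots : ∀ v : Fin 24 → ℤ, v ≠ 0 → v ⬝ᵥ B.mulVec v ≠ 2)
    (hU : Uᵀ * B * U = B) (hUcycle : U.charpoly = (X - 1) ^ m * (X ^ p - 1) ^ m)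
    {bb : Fin (2 * m) → (Fin 24 → ℤ)} (hb : ∀ i, U.mulVec (bb i) = bb i)
    (hs : ∀ v : Fin 24 → ℤ, U.mulVec v = v → ∃ c : Fin (2 * m) → ℤ, v = ∑ i, c i • bb i)
    {A : Matrix (Fin (2 * m)) (Fin (2 * m)) ℤ}
    (hA : ∀ i j, A i j = bb i ⬝ᵥ B.mulVec (bb j)) :
    InGenusIIpm p m (addHyp A !![0, 1; 1, 0]) := by
  have hp : p.Prime := by
    obtain ⟨rfl, -⟩ | ⟨rfl, -⟩ | ⟨rfl, -⟩ | ⟨rfl, -⟩ := hpm <;> norm_num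
  have := Fact.mk hp
  have hp0 : (p : ℤ) ≠ 0 := by exact_mod_cast hp.ne_zero
  have hpos := ofMatrix_pos hB hBpos
  have heven := ofMatrix_isEven hB hBeven
  have hL : (ofMatrix B hB).Elem 1 := elem_one_of_d (by rw [d_ofMatrix, hBdet]; rfl)
  have hroot : ∀ x : ofMatrix B hB, (ofMatrix B hB).form x x ≠ 2 := fun x => by
    rcases eq_or_ne x 0 with rfl | hx
    · rw [map_zero]; norm_num
    · exact hBnoroots x hx
  have hUp := pow_eq_one_of_charpoly hB hpos hU hUcycle
  have hl := linearIndependent_of_span_fixed hp.ne_zero hUp hUcycle bb hs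
  let u : Module.End ℤ (ofMatrix B hB) := toLin' U
  have hu : ∀ x : Fin 24 → ℤ, u x = U *ᵥ x := fun x => toLin'_apply _ _
  have hiso : ∀ x y, (ofMatrix B hB).form (u x) (u y) = (ofMatrix B hB).form x y := fun x y => by
    rw [hu, hu]; exact ofMatrix_isometry hB hU x y
  have hup := pow_end_eq_one hu hUp
  set F := (ofMatrix B hB).res (fixed u) with hF
  have hFE : F.Elem p := fixed_elem hiso hup hL
  obtain ⟨e, he⟩ := exists_basis_fixed hB hu hb hs hl
  have hFrk : F.rk = 2 * m := by
    have := Module.finrank_eq_card_basis e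
    rwa [Fintype.card_fin] at this
  have hAe : F.gram e = A := by
    ext i j
    rw [hA, ← he, ← he]
    rfl
  have hFroot : ∀ x : F, F.form x x ≠ 2 := fun x => hroot x
  have hFeven : F.IsEven := heven.res _
  have hFpos : F.Pos := hpos.res _
  obtain ⟨a, ha, ham⟩ := exists_d_fixed (p := p) hB hpos hL hu hU hUp hb hs hl
  have hdE : F.d = p ^ m ∧ F.E2 p := by
    obtain ⟨rfl, rfl⟩ | h := hpm
    · have hK := finrank_fixed_neg_add hup
      rw [rk_ofMatrix, ← hF, hFrk] at hK
      have hKd := d_fixed_neg hB hpos hL hu hU hUp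
      have hKrk : ((ofMatrix B hB).res (fixed (-u))).rk = 8 := by omega
      have h8 := eight_le_exponent (hpos.res _) (heven.res _) (fun x => hroot x) hKrk (hKd.trans ha)
      obtain rfl : a = 8 := by omega
      refine ⟨ha, fixed_E2 hiso hup hL hpos ?_⟩
      refine four_dvd_sq (hpos.res _) (fun x => hroot x) hKrk (fixed_elem ?_ ?_ hL) (hKd.trans ha)
      · intro x y
        rw [LinearMap.neg_apply, LinearMap.neg_apply, map_neg, map_neg, LinearMap.neg_apply, neg_neg,
          hiso]
      · rw [neg_sq, hup]
    · have h1 := le_exponent hFpos hFeven hFroot ha hFrk hFE h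
      obtain ⟨rfl, rfl⟩ | ⟨rfl, rfl⟩ | ⟨rfl, rfl⟩ := h
      · obtain rfl : a = 6 := by omega
        exact ⟨ha, E2_of_odd (by norm_num) hFeven⟩
      · obtain rfl : a = 4 := by omega
        exact ⟨ha, E2_of_odd (by norm_num) hFeven⟩
      · obtain rfl : a = 3 := by omega
        exact ⟨ha, E2_of_odd (by norm_num) hFeven⟩
  have hAs : A.IsSymm := by
    rw [← hAe]; exact Matrix.ext fun i j => F.symm _ _
  have hI : Isom F (ofMatrix A hAs) := by
    refine ⟨e.equivFun, fun x y => ?_⟩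
    have h1 := form_sum_basis F e (e.equivFun x) (e.equivFun y)
    rw [e.sum_equivFun, e.sum_equivFun, hAe] at h1
    rw [h1, ofMatrix_form]
  obtain ⟨C, hC, hC2⟩ := exists_level_matrix hp0 hAs (hI.elem hFE) (hI.e2 hdE.2)
  refine inGenus_addHyp hp.ne_zero hAs (fun i => ?_) (fun x => ?_) hC hC2 one_pos (c' := p) (one_mul _) ?_
  · rw [← hAe]; exact hFeven _
  · exact (hI.pos hFpos).nonneg x
  · have h1 := F.d_eq e
    have h2 := hFpos.gram_det_pos e
    rw [hAe] at h1 h2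
    rw [hdE.1] at h1
    rw [one_pow, mul_one]
    zify at h1
    rw [h1, abs_of_pos h2]

end Auto

/-- An integral model, scaled by `p`, of the glue lattice `(A_{p-1}ʳ, G^⊥)`. -/
def ScaledGlue (p r : ℕ) [NeZero p] (z : Fin r → Fin p → ℤ) : Prop :=
  (∀ i, ∑ k, z i k = 0) ∧ (∀ i k, (p : ℤ) ∣ z i k - z i 0) ∧
    ∀ g ∈ glueCode p r, ∑ i, (z i 0 : ZMod p) * g i = 0

theorem clsOf_eq {p : ℕ} [NeZero p] {x : Fin p → ℚ} {z : ℤ} (h : (p : ℚ) * x 0 = z) :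
    clsOf p x = -(z : ZMod p) := by
  rw [clsOf, h, ← Int.cast_neg, Rat.num_intCast, Int.cast_neg]

theorem clsOf_orthogonal_iff {p r : ℕ} [NeZero p] {y : GVec p r} {z : Fin r → Fin p → ℤ}
    (h : ∀ i k, (p : ℚ) * y i k = z i k) (g : Fin r → ZMod p) :
    ∑ i, clsOf p (y i) * g i = 0 ↔ ∑ i, (z i 0 : ZMod p) * g i = 0 := by
  rw [← neg_eq_zero, ← Finset.sum_neg_distrib]
  simp_rw [clsOf_eq (h _ 0), neg_mul, neg_neg]

theorem memGluePerp_of_scaled {p r : ℕ} [NeZero p] {y : GVec p r} {z : Fin r → Fin p → ℤ}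
    (h : ∀ i k, (p : ℚ) * y i k = z i k) (hz : ScaledGlue p r z) : MemGluePerp p r y := by
  have hp : (p : ℚ) ≠ 0 := Nat.cast_ne_zero.2 (NeZero.ne p)
  refine ⟨fun i => ⟨?_, fun k l => ?_, fun k => ⟨z i k, (h i k).symm⟩⟩, fun g hg => ?_⟩
  · refine mul_left_cancel₀ hp ?_
    rw [Finset.mul_sum, mul_zero]
    simp_rw [h]
    exact_mod_cast hz.1 i
  · obtain ⟨a, ha⟩ := hz.2.1 i k
    obtain ⟨b, hb⟩ := hz.2.1 i l
    refine ⟨a - b, mul_left_cancel₀ hp ?_⟩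
    rw [mul_sub, h, h]
    push_cast
    rw [mul_sub]
    have ha' : (z i k : ℚ) - z i 0 = p * a := by exact_mod_cast ha
    have hb' : (z i l : ℚ) - z i 0 = p * b := by exact_mod_cast hb
    linarith
  · exact (clsOf_orthogonal_iff h g).2 (hz.2.2 g hg)

theorem exists_scaled {p r : ℕ} [NeZero p] {y : GVec p r} (hy : MemGluePerp p r y) :
    ∃ z : Fin r → Fin p → ℤ, (∀ i k, (p : ℚ) * y i k = z i k) ∧ ScaledGlue p r z := by
  choose z hz using fun i k => (hy.1 i).2.2 k
  have h : ∀ i k, (p : ℚ) * y i k = z i k := fun i k => (hz i k).symm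
  refine ⟨z, h, fun i => ?_, fun i k => ?_, fun g hg => (clsOf_orthogonal_iff h g).1 (hy.2 g hg)⟩
  · have h1 := (hy.1 i).1
    have h2 : (∑ k, (z i k : ℚ)) = 0 := by
      simp_rw [← h]
      rw [← Finset.mul_sum, h1, mul_zero]
    exact_mod_cast h2
  · obtain ⟨a, ha⟩ := (hy.1 i).2.1 k 0
    refine ⟨a, ?_⟩
    have : (z i k : ℚ) - z i 0 = p * a := by rw [← h, ← h, ha]; ring
    exact_mod_cast this

/-- A basis of the glue lattice and a hyperbolic pair give a basis of the Lorentzian lattice. -/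
theorem exists_lorentz_basis {p r m : ℕ} [NeZero p] (h : Fin (2 * m) → Fin r → Fin p → ℤ)
    (hm : ∀ i, ScaledGlue p r (h i))
    (hs : ∀ z, ScaledGlue p r z → ∃ c : Fin (2 * m) → ℤ, ∀ i k, z i k = ∑ j, c j * h j i k)
    {K : Matrix (Fin (2 * m)) (Fin (2 * m)) ℤ}
    (hK : ∀ i j, (p : ℤ) ^ 2 * K i j = ∑ a, ∑ k, h i a k * h j a k) :
    ∃ g : Fin (2 * m + 2) → GVec p r × ℤ × ℤ,
      (∀ i, MemLvec p r (g i)) ∧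
      (∀ v, MemLvec p r v → ∃ c : Fin (2 * m + 2) → ℤ, v = ∑ i, c i • g i) ∧
      (∀ i j, ((addHyp K !![0, (p : ℤ); (p : ℤ), 0] i j : ℤ) : ℚ) = blL p r (g i) (g j)) := by
  have hp : (p : ℚ) ≠ 0 := Nat.cast_ne_zero.2 (NeZero.ne p)
  let y : Fin (2 * m) → GVec p r := fun j i k => (h j i k : ℚ) / p
  have hy : ∀ j i k, (p : ℚ) * y j i k = h j i k := fun j i k => mul_div_cancel₀ _ hp
  let f : Fin (2 * m) ⊕ Fin 2 → GVec p r × ℤ × ℤ :=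
    Sum.elim (fun j => (y j, 0, 0)) ![(0, 1, 0), (0, 0, 1)]
  have hf : ∀ i, MemLvec p r (f i) := by
    rintro (j | j)
    · exact memGluePerp_of_scaled (hy j) (hm j)
    · have h0 : MemGluePerp p r (0 : GVec p r) :=
        memGluePerp_of_scaled (z := fun _ _ => 0) (fun i k => by simp) ⟨by simp, by simp, by simp⟩
      fin_cases j <;> exact h0
  refine ⟨fun i => f (finSumFinEquiv.symm i), fun i => hf _, fun v hv => ?_, fun i j => ?_⟩
  · obtain ⟨z, hz, hz'⟩ := exists_scaled hv
    obtain ⟨c, hc⟩ := hs z hz'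
    refine ⟨fun i => Sum.elim c ![v.2.1, v.2.2] (finSumFinEquiv.symm i), ?_⟩
    rw [Equiv.sum_comp finSumFinEquiv.symm
      (fun i => (Sum.elim c ![v.2.1, v.2.2] i : ℤ) • f i), Fintype.sum_sum_type]
    simp only [Sum.elim_inl, Sum.elim_inr, Fin.sum_univ_two, f, Matrix.cons_val_zero,
      Matrix.cons_val_one]
    refine Prod.ext ?_ (Prod.ext ?_ ?_)
    · funext i k
      refine mul_left_cancel₀ hp ?_
      rw [hz, hc]
      simp only [Prod.fst_add, Prod.fst_sum, Prod.smul_fst, smul_zero, add_zero, Finset.sum_apply,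
        Pi.smul_apply, Pi.add_apply, Pi.zero_apply, Finset.mul_sum]
      push_cast
      refine Finset.sum_congr rfl fun j _ => ?_
      rw [← hy, zsmul_eq_mul]; ring
    · simp [Prod.snd_sum]
    · simp [Prod.snd_sum]
  · have hb : ∀ i j, blL p r (f i) (f j) =
        ((fromBlocks K 0 0 !![0, (p : ℤ); (p : ℤ), 0] i j : ℤ) : ℚ) := by
      rintro (i | i) (j | j)
      · have h1 : ((p : ℤ) ^ 2 * K i j : ℚ) = ∑ a, ∑ k, (h i a k : ℚ) * h j a k := by
          exact_mod_cast hK i j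
        have h2 : blL p r (f (.inl i)) (f (.inl j)) = ∑ a, ∑ k, y i a k * y j a k := by
          simp [blL, f]
        rw [h2, fromBlocks_apply₁₁]
        refine mul_left_cancel₀ (pow_ne_zero 2 hp) ?_
        rw [Int.cast_natCast] at h1
        rw [h1, Finset.mul_sum]
        refine Finset.sum_congr rfl fun a _ => ?_
        rw [Finset.mul_sum]
        refine Finset.sum_congr rfl fun k _ => ?_
        rw [← hy, ← hy]; ring
      · fin_cases j <;> simp [blL, f]
      · fin_cases i <;> simp [blL, f]
      · fin_cases i <;> fin_cases j <;> simp [blL, f]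
    rw [hb]
    rfl

theorem nonneg_of_gram {p r n : ℕ} [NeZero p] {h : Fin n → Fin r → Fin p → ℤ}
    {K : Matrix (Fin n) (Fin n) ℤ}
    (hK : ∀ i j, (p : ℤ) ^ 2 * K i j = ∑ a, ∑ k, h i a k * h j a k) (x : Fin n → ℤ) :
    0 ≤ x ⬝ᵥ K *ᵥ x := by
  have hp : (0 : ℤ) < (p : ℤ) ^ 2 := pow_pos (by exact_mod_cast NeZero.pos p) 2
  refine nonneg_of_mul_nonneg_right (b := x ⬝ᵥ K *ᵥ x) ?_ hp
  have : (p : ℤ) ^ 2 * (x ⬝ᵥ K *ᵥ x) = ∑ a, ∑ k, (∑ i, x i * h i a k) ^ 2 := by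
    simp only [dotProduct, mulVec, Finset.mul_sum, sq (∑ i, _), Finset.sum_mul]
    have h1 : ∀ i j, (p : ℤ) ^ 2 * (x i * (K i j * x j)) =
        ∑ a, ∑ k, x i * h i a k * (x j * h j a k) := fun i j => by
      have : (p : ℤ) ^ 2 * (x i * (K i j * x j)) = x i * x j * ((p : ℤ) ^ 2 * K i j) := by ring
      rw [this, hK, Finset.mul_sum]
      refine Finset.sum_congr rfl fun a _ => ?_
      rw [Finset.mul_sum]
      exact Finset.sum_congr rfl fun k _ => by ring
    simp_rw [h1]
    calc _ = ∑ i, ∑ a, ∑ j, ∑ k, x i * h i a k * (x j * h j a k) :=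
          Finset.sum_congr rfl fun i _ => Finset.sum_comm
      _ = ∑ i, ∑ a, ∑ k, ∑ j, x i * h i a k * (x j * h j a k) :=
          Finset.sum_congr rfl fun i _ => Finset.sum_congr rfl fun a _ => Finset.sum_comm
      _ = ∑ a, ∑ i, ∑ k, ∑ j, x i * h i a k * (x j * h j a k) := Finset.sum_comm
      _ = ∑ a, ∑ k, ∑ i, ∑ j, x i * h i a k * (x j * h j a k) :=
          Finset.sum_congr rfl fun a _ => Finset.sum_comm
      _ = _ := Finset.sum_congr rfl fun a _ => Finset.sum_congr rfl fun k _ => by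
          rw [Finset.sum_comm]
  rw [this]
  exact Finset.sum_nonneg fun a _ => Finset.sum_nonneg fun k _ => sq_nonneg _

theorem exists_lorentz_basis_inGenus {p r m : ℕ} [NeZero p] (h : Fin (2 * m) → Fin r → Fin p → ℤ)
    (hm : ∀ i, ScaledGlue p r (h i))
    (hs : ∀ z, ScaledGlue p r z → ∃ c : Fin (2 * m) → ℤ, ∀ i k, z i k = ∑ j, c j * h j i k)
    {K C : Matrix (Fin (2 * m)) (Fin (2 * m)) ℤ}
    (hK : ∀ i j, (p : ℤ) ^ 2 * K i j = ∑ a, ∑ k, h i a k * h j a k)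
    (hKe : ∀ i, 2 ∣ K i i) (hKC : K * C = (p : ℤ) • (1 : Matrix (Fin (2 * m)) (Fin (2 * m)) ℤ))
    (hCe : ∀ i, 2 ∣ C i i) (hd : K.det * p ^ 2 = (p : ℤ) ^ m) :
    ∃ (g : Fin (2 * m + 2) → GVec p r × ℤ × ℤ) (Q : Matrix (Fin (2 * m + 2)) (Fin (2 * m + 2)) ℤ),
      (∀ i, MemLvec p r (g i)) ∧
      (∀ v, MemLvec p r v → ∃ c : Fin (2 * m + 2) → ℤ, v = ∑ i, c i • g i) ∧
      (∀ i j, (Q i j : ℚ) = blL p r (g i) (g j)) ∧ InGenusIIpm p m Q := by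
  have hp : (0 : ℤ) < p := by exact_mod_cast NeZero.pos p
  obtain ⟨g, h1, h2, h3⟩ := exists_lorentz_basis h hm hs hK
  refine ⟨g, _, h1, h2, h3, inGenus_addHyp (NeZero.ne p) (Matrix.ext fun i j => ?_) hKe
    (nonneg_of_gram hK) hKC hCe hp (c' := 1) (mul_one _) hd⟩
  refine mul_left_cancel₀ (pow_ne_zero 2 hp.ne') ?_
  rw [transpose_apply, hK, hK]
  simp_rw [mul_comm]


theorem det_mul_prod_of_triangular {n : ℕ} {K X : Matrix (Fin n) (Fin n) ℤ}
    (hX : ∀ i : Fin n × Fin n, i.1 ≤ i.2 ∨ X i.1 i.2 = 0)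
    (hY : ∀ i : Fin n × Fin n, i.2 ≤ i.1 ∨ (K * X) i.1 i.2 = 0) :
    K.det * ∏ i, X i i = ∏ i, (K * X) i i := by
  rw [← det_of_isUpperTriangular (M := X) (fun i j h => (hX (i, j)).resolve_left (not_le.2 h)),
    ← det_of_isLowerTriangular (K * X) (fun i j h => (hY (i, j)).resolve_left (not_le.2 h)), det_mul]

theorem dvd_of_single_mem {p r : ℕ} [NeZero p] {z : Fin r → Fin p → ℤ} (hz : ScaledGlue p r z)
    (i : Fin r) (h : Pi.single i 1 ∈ glueCode p r) (k : Fin p) : (p : ℤ) ∣ z i k := by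
  have h1 := hz.2.2 _ h
  simp only [Pi.single_apply, mul_ite, mul_one, mul_zero, Finset.sum_ite_eq', Finset.mem_univ,
    if_true] at h1
  exact (dvd_iff_dvd_of_dvd_sub (hz.2.1 i k)).2 ((ZMod.intCast_zmod_eq_zero_iff_dvd _ _).1 h1)

/-! ### The root lattices `A₆` and `A₄ ⊕ A₄` -/

/-- `p` times a basis of the root lattice `A_{p-1}ʳ`. -/
def rootVec (p r n : ℕ) [NeZero p] (j : Fin n) (i : Fin r) (k : Fin p) : ℤ :=
  if j.1 / (p - 1) = i then (if k.1 = j.1 % (p - 1) then p else if k.1 = p - 1 then -p else 0) else 0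

/-- The Gram matrix of `A_qʳ`. -/
def rootGram (q n : ℕ) : Matrix (Fin n) (Fin n) ℤ :=
  of fun i j => if i.1 / q = j.1 / q then (if i = j then 2 else 1) else 0

def rootDual (q n : ℕ) : Matrix (Fin n) (Fin n) ℤ :=
  of fun i j => if i.1 / q = j.1 / q then (if i = j then q else -1) else 0

def rootTri (q n : ℕ) : Matrix (Fin n) (Fin n) ℤ :=
  of fun i j => if i.1 / q = j.1 / q then
    (if i = j then i.1 % q + 1 else if i.1 < j.1 then -1 else 0) else 0

theorem exists_basis_seven :
    ∃ (g : Fin (2 * 3 + 2) → GVec 7 1 × ℤ × ℤ) (Q : Matrix (Fin (2 * 3 + 2)) (Fin (2 * 3 + 2)) ℤ),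
      (∀ i, MemLvec 7 1 (g i)) ∧
      (∀ v, MemLvec 7 1 v → ∃ c : Fin (2 * 3 + 2) → ℤ, v = ∑ i, c i • g i) ∧
      (∀ i j, (Q i j : ℚ) = blL 7 1 (g i) (g j)) ∧ InGenusIIpm 7 3 Q := by
  refine exists_lorentz_basis_inGenus (rootVec 7 1 6) (fun i => ⟨?_, ?_, fun g _ => ?_⟩)
    (fun z hz => ?_) (K := rootGram 6 6) (C := rootDual 6 6) ?_ ?_ ?_ ?_ ?_
  · revert i; decide +kernel
  · revert i; decide +kernel
  · have : ∀ (i : Fin 6) (a : Fin 1), (rootVec 7 1 6 i a 0 : ZMod 7) = 0 := by decide +kernel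
    simp only [this i, zero_mul, Finset.sum_const_zero]
  · choose w hw using fun i k => dvd_of_single_mem hz i (by simp [glueCode]) k
    refine ⟨fun j : Fin 6 => w 0 ⟨j, by omega⟩, fun i k => ?_⟩
    obtain rfl : i = 0 := Subsingleton.elim _ _
    have h0 := hz.1 0
    have h1 := hw 0
    simp only [Fin.sum_univ_succ, Fin.sum_univ_zero] at h0
    fin_cases k <;> simp [Fin.sum_univ_succ, rootVec, h1] at h0 ⊢ <;> omega
  · decide +kernel
  · decide +kernel
  · ext i j; revert i j; decide +kernel
  · decide +kernel
  · have h := det_mul_prod_of_triangular (K := rootGram 6 6) (X := rootTri 6 6)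
      (by decide +kernel) (by decide +kernel)
    have h1 : ∏ i, rootTri 6 6 i i = 720 := by decide +kernel
    have h2 : ∏ i, (rootGram 6 6 * rootTri 6 6) i i = 5040 := by decide +kernel
    rw [h1, h2] at h
    have h3 : (rootGram 6 6).det = 7 := by omega
    exact (congrArg (· * (7 : ℤ) ^ 2) h3).trans (by norm_num)

theorem exists_basis_five :
    ∃ (g : Fin (2 * 4 + 2) → GVec 5 2 × ℤ × ℤ) (Q : Matrix (Fin (2 * 4 + 2)) (Fin (2 * 4 + 2)) ℤ),
      (∀ i, MemLvec 5 2 (g i)) ∧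
      (∀ v, MemLvec 5 2 v → ∃ c : Fin (2 * 4 + 2) → ℤ, v = ∑ i, c i • g i) ∧
      (∀ i j, (Q i j : ℚ) = blL 5 2 (g i) (g j)) ∧ InGenusIIpm 5 4 Q := by
  refine exists_lorentz_basis_inGenus (rootVec 5 2 8) (fun i => ⟨?_, ?_, fun g _ => ?_⟩)
    (fun z hz => ?_) (K := rootGram 4 8) (C := rootDual 4 8) ?_ ?_ ?_ ?_ ?_
  · revert i; decide +kernel
  · revert i; decide +kernel
  · have : ∀ (i : Fin 8) (a : Fin 2), (rootVec 5 2 8 i a 0 : ZMod 5) = 0 := by decide +kernel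
    simp only [this i, zero_mul, Finset.sum_const_zero]
  · choose w hw using fun i k => dvd_of_single_mem hz i (by simp [glueCode]) k
    refine ⟨fun j : Fin 8 => w ⟨j / 4, by omega⟩ ⟨j % 4, by omega⟩, fun i k => ?_⟩
    have h0 := hz.1 i
    simp only [Fin.sum_univ_succ, Fin.sum_univ_zero] at h0
    fin_cases i <;> fin_cases k <;> simp [Fin.sum_univ_succ, rootVec, hw] at h0 ⊢ <;> omega
  · decide +kernel
  · decide +kernel
  · ext i j; revert i j; decide +kernel
  · decide +kernel
  · have h := det_mul_prod_of_triangular (K := rootGram 4 8) (X := rootTri 4 8)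
      (by decide +kernel) (by decide +kernel)
    have h1 : ∏ i, rootTri 4 8 i i = 576 := by decide +kernel
    have h2 : ∏ i, (rootGram 4 8 * rootTri 4 8) i i = 14400 := by decide +kernel
    rw [h1, h2] at h
    have h3 : (rootGram 4 8).det = 25 := by omega
    exact (congrArg (· * (5 : ℤ) ^ 2) h3).trans (by norm_num)


/-! ### The glue lattice of `A₂⁶` -/

/-- `3` times a basis of the lattice generated by `A₂⁶` and the glue vector `(1, …, 1)`. -/
def ternaryVec (j : Fin 12) (i : Fin 6) (k : Fin 3) : ℤ :=
  if j = 10 then (if k = 2 then -2 else 1)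
  else if j.1 / 2 = i then (if k.1 = j.1 % 2 then 3 else if k = 2 then -3 else 0) else 0

def ternaryGram : Matrix (Fin 12) (Fin 12) ℤ :=
  !![2, 1, 0, 0, 0, 0, 0, 0, 0, 0, 1, 0;
     1, 2, 0, 0, 0, 0, 0, 0, 0, 0, 1, 0;
     0, 0, 2, 1, 0, 0, 0, 0, 0, 0, 1, 0;
     0, 0, 1, 2, 0, 0, 0, 0, 0, 0, 1, 0;
     0, 0, 0, 0, 2, 1, 0, 0, 0, 0, 1, 0;
     0, 0, 0, 0, 1, 2, 0, 0, 0, 0, 1, 0;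
     0, 0, 0, 0, 0, 0, 2, 1, 0, 0, 1, 0;
     0, 0, 0, 0, 0, 0, 1, 2, 0, 0, 1, 0;
     0, 0, 0, 0, 0, 0, 0, 0, 2, 1, 1, 0;
     0, 0, 0, 0, 0, 0, 0, 0, 1, 2, 1, 0;
     1, 1, 1, 1, 1, 1, 1, 1, 1, 1, 4, 1;
     0, 0, 0, 0, 0, 0, 0, 0, 0, 0, 1, 2]

def ternaryDual : Matrix (Fin 12) (Fin 12) ℤ :=
  !![4, 1, 2, 2, 2, 2, 2, 2, 2, 2, -6, 3;
     1, 4, 2, 2, 2, 2, 2, 2, 2, 2, -6, 3;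
     2, 2, 4, 1, 2, 2, 2, 2, 2, 2, -6, 3;
     2, 2, 1, 4, 2, 2, 2, 2, 2, 2, -6, 3;
     2, 2, 2, 2, 4, 1, 2, 2, 2, 2, -6, 3;
     2, 2, 2, 2, 1, 4, 2, 2, 2, 2, -6, 3;
     2, 2, 2, 2, 2, 2, 4, 1, 2, 2, -6, 3;
     2, 2, 2, 2, 2, 2, 1, 4, 2, 2, -6, 3;
     2, 2, 2, 2, 2, 2, 2, 2, 4, 1, -6, 3;
     2, 2, 2, 2, 2, 2, 2, 2, 1, 4, -6, 3;
     -6, -6, -6, -6, -6, -6, -6, -6, -6, -6, 18, -9;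
     3, 3, 3, 3, 3, 3, 3, 3, 3, 3, -9, 6]

def ternaryTri : Matrix (Fin 12) (Fin 12) ℤ :=
  !![1, -1, 0, 0, 0, 0, 0, 0, 0, 0, -1, 1;
     0, 2, 0, 0, 0, 0, 0, 0, 0, 0, -1, 1;
     0, 0, 1, -1, 0, 0, 0, 0, 0, 0, -1, 1;
     0, 0, 0, 2, 0, 0, 0, 0, 0, 0, -1, 1;
     0, 0, 0, 0, 1, -1, 0, 0, 0, 0, -1, 1;
     0, 0, 0, 0, 0, 2, 0, 0, 0, 0, -1, 1;
     0, 0, 0, 0, 0, 0, 1, -1, 0, 0, -1, 1;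
     0, 0, 0, 0, 0, 0, 0, 2, 0, 0, -1, 1;
     0, 0, 0, 0, 0, 0, 0, 0, 1, -1, -1, 1;
     0, 0, 0, 0, 0, 0, 0, 0, 0, 2, -1, 1;
     0, 0, 0, 0, 0, 0, 0, 0, 0, 0, 3, -3;
     0, 0, 0, 0, 0, 0, 0, 0, 0, 0, 0, 2]

theorem exists_basis_three :
    ∃ (g : Fin (2 * 6 + 2) → GVec 3 6 × ℤ × ℤ) (Q : Matrix (Fin (2 * 6 + 2)) (Fin (2 * 6 + 2)) ℤ),
      (∀ i, MemLvec 3 6 (g i)) ∧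
      (∀ v, MemLvec 3 6 v → ∃ c : Fin (2 * 6 + 2) → ℤ, v = ∑ i, c i • g i) ∧
      (∀ i j, (Q i j : ℚ) = blL 3 6 (g i) (g j)) ∧ InGenusIIpm 3 6 Q := by
  refine exists_lorentz_basis_inGenus ternaryVec (fun i => ⟨?_, ?_, fun g hg => ?_⟩)
    (fun z hz => ?_) (K := ternaryGram) (C := ternaryDual) ?_ ?_ ?_ ?_ ?_
  · revert i; decide +kernel
  · revert i; decide +kernel
  · have hg0 : ∑ i, g i = 0 := by simpa [glueCode] using hg
    have h : ∀ i : Fin 12, ∃ e : ZMod 3, ∀ a : Fin 6, (ternaryVec i a 0 : ZMod 3) = e := by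
      decide +kernel
    obtain ⟨e, he⟩ := h i
    simp only [he, ← Finset.mul_sum, hg0, mul_zero]
  · have hw : ∀ i k, ∃ w, z i k - z 5 0 = 3 * w := fun i k => by
      have hg : Pi.single i 1 - Pi.single 5 1 ∈ glueCode 3 6 := by
        simp [glueCode, Finset.sum_sub_distrib]
      have h1 := hz.2.2 _ hg
      simp only [Pi.sub_apply, mul_sub, Finset.sum_sub_distrib, Pi.single_apply, mul_ite, mul_one,
        mul_zero, Finset.sum_ite_eq', Finset.mem_univ, if_true] at h1
      rw [← Int.cast_sub, ZMod.intCast_zmod_eq_zero_iff_dvd] at h1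
      have h2 := dvd_add (hz.2.1 i k) h1
      rwa [sub_add_sub_cancel] at h2
    choose w hw using hw
    refine ⟨fun j : Fin 12 => if j = 10 then z 5 0 else w ⟨j / 2, by omega⟩ ⟨j % 2, by omega⟩,
      fun i k => ?_⟩
    have h0 := hz.1 i
    have h1 := hw i 0
    have h2 := hw i 1
    simp only [Fin.sum_univ_succ, Fin.sum_univ_zero] at h0
    fin_cases i <;> fin_cases k <;> simp [Fin.sum_univ_succ, ternaryVec] at h0 h1 h2 ⊢ <;> omega
  · decide +kernel
  · decide +kernel
  · ext i j; revert i j; decide +kernel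
  · decide +kernel
  · have h := det_mul_prod_of_triangular (K := ternaryGram) (X := ternaryTri)
      (by decide +kernel) (by decide +kernel)
    have h1 : ∏ i, ternaryTri i i = 192 := by decide +kernel
    have h2 : ∏ i, (ternaryGram * ternaryTri) i i = 192 * 81 := by decide +kernel
    rw [h1, h2] at h
    have h3 : ternaryGram.det = 81 := by omega
    exact (congrArg (· * (3 : ℤ) ^ 2) h3).trans (by norm_num)

/-! ### The glue lattice of `A₁¹⁶` -/

/-- A basis of the lattice of vectors in `ℤ¹⁶` reducing to the first order Reed-Muller code
modulo `2`: the code words in the rows `0, 1, 2, 4, 8`, and twice a unit vector in the others. -/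
def reedMullerBasis : Matrix (Fin 16) (Fin 16) ℤ :=
  of fun i j =>
    if i = 0 then (if (j.1 + j.1 / 2 + j.1 / 4 + j.1 / 8) % 2 = 0 then 1 else 0)
    else if i = 1 then (j.1 % 2 : ℕ)
    else if i = 2 then (j.1 / 2 % 2 : ℕ)
    else if i = 4 then (j.1 / 4 % 2 : ℕ)
    else if i = 8 then (j.1 / 8 % 2 : ℕ)
    else if i = j then 2 else 0

/-- Whether the position is an information position of the first order Reed-Muller code. -/
def isInfo (i : Fin 16) : Bool := i = 0 || i = 1 || i = 2 || i = 4 || i = 8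

def binaryVec (j : Fin 16) (i : Fin 16) (k : Fin 2) : ℤ :=
  if k = 0 then reedMullerBasis j i else -reedMullerBasis j i

def binaryGram : Matrix (Fin 16) (Fin 16) ℤ :=
  of fun i j => (∑ k, reedMullerBasis i k * reedMullerBasis j k) / 2

/-- Twice the inverse of `reedMullerBasis`. -/
def reedMullerInv : Matrix (Fin 16) (Fin 16) ℤ :=
  of fun i j => if isInfo i then (if i = j then 2 else -reedMullerBasis i j) else if i = j then 1 else 0

def binaryDual : Matrix (Fin 16) (Fin 16) ℤ := reedMullerInvᵀ * reedMullerInv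

/-- A word of the extended Hamming code, expressing the `j`-th coordinate of a Reed-Muller code word
by the information positions. -/
def hammingWord (j i : Fin 16) : ℤ :=
  (if i = j then 1 else 0) - if isInfo i then reedMullerBasis i j else 0

theorem hammingWord_mem (j : Fin 16) : (fun i => (hammingWord j i : ZMod 2)) ∈ glueCode 2 16 := by
  have h1 : ∀ j, ∑ i, (hammingWord j i : ZMod 2) = 0 := by decide +kernel
  have h2 : ∀ j : Fin 16, ∀ l : Fin 4,
      (∑ i : Fin 16, if Nat.testBit i.1 l.1 then (hammingWord j i : ZMod 2) else 0) = 0 := by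
    decide +kernel
  rw [glueCode, Finset.mem_filter, if_pos rfl]
  exact ⟨Finset.mem_univ _, h1 j, h2 j⟩

theorem reedMullerBasis_orthogonal {g : Fin 16 → ZMod 2} (hg : g ∈ glueCode 2 16) (i : Fin 16) :
    ∑ a, (reedMullerBasis i a : ZMod 2) * g a = 0 := by
  rw [glueCode, Finset.mem_filter, if_pos rfl] at hg
  obtain ⟨-, h1, h2⟩ := hg
  have h : ∀ i, ∃ e : ZMod 2 × ZMod 2 × ZMod 2 × ZMod 2 × ZMod 2, ∀ a : Fin 16,
      (reedMullerBasis i a : ZMod 2) = e.1 + (if Nat.testBit a.1 0 then e.2.1 else 0) +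
        (if Nat.testBit a.1 1 then e.2.2.1 else 0) + (if Nat.testBit a.1 2 then e.2.2.2.1 else 0) +
        (if Nat.testBit a.1 3 then e.2.2.2.2 else 0) := by
    decide +kernel
  obtain ⟨⟨e, e0, e1, e2, e3⟩, he⟩ := h i
  have h3 : ∀ (c : ZMod 2) (l : Fin 4), ∑ a : Fin 16, (if Nat.testBit a.1 l.1 then c else 0) * g a = 0 :=
    fun c l => by
      have := congrArg (c * ·) (h2 l)
      simpa only [Finset.mul_sum, mul_zero, mul_ite, ite_mul, zero_mul] using this
  have h30 : ∑ a : Fin 16, (if Nat.testBit a.1 0 then e0 else 0) * g a = 0 := h3 e0 0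
  have h31 : ∑ a : Fin 16, (if Nat.testBit a.1 1 then e1 else 0) * g a = 0 := h3 e1 1
  have h32 : ∑ a : Fin 16, (if Nat.testBit a.1 2 then e2 else 0) * g a = 0 := h3 e2 2
  have h33 : ∑ a : Fin 16, (if Nat.testBit a.1 3 then e3 else 0) * g a = 0 := h3 e3 3
  simp only [he, add_mul, Finset.sum_add_distrib, ← Finset.mul_sum, h1, mul_zero, h30, h31, h32, h33,
    add_zero]

theorem exists_basis_two :
    ∃ (g : Fin (2 * 8 + 2) → GVec 2 16 × ℤ × ℤ) (Q : Matrix (Fin (2 * 8 + 2)) (Fin (2 * 8 + 2)) ℤ),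
      (∀ i, MemLvec 2 16 (g i)) ∧
      (∀ v, MemLvec 2 16 v → ∃ c : Fin (2 * 8 + 2) → ℤ, v = ∑ i, c i • g i) ∧
      (∀ i j, (Q i j : ℚ) = blL 2 16 (g i) (g j)) ∧ InGenusIIpm 2 8 Q := by
  refine exists_lorentz_basis_inGenus binaryVec (fun i => ⟨?_, ?_, fun g hg => ?_⟩)
    (fun z hz => ?_) (K := binaryGram) (C := binaryDual) ?_ ?_ ?_ ?_ ?_
  · revert i; decide +kernel
  · revert i; decide +kernel
  · exact reedMullerBasis_orthogonal hg i
  · have ht : ∀ j, ∃ t, z j 0 - (∑ i, if isInfo i then z i 0 * reedMullerBasis i j else 0) = 2 * t :=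
      fun j => by
        have h1 := hz.2.2 _ (hammingWord_mem j)
        have h2 : ((∑ i, z i 0 * hammingWord j i : ℤ) : ZMod 2) = 0 := by
          push_cast; exact h1
        rw [ZMod.intCast_zmod_eq_zero_iff_dvd] at h2
        simp only [hammingWord, mul_sub, Finset.sum_sub_distrib, mul_ite, mul_one, mul_zero,
          Finset.sum_ite_eq', Finset.mem_univ, if_true] at h2
        exact h2
    choose t ht using ht
    have hH : ∀ i : Fin 16 × Fin 16, isInfo i.1 = true ∨
        reedMullerBasis i.1 i.2 = if i.1 = i.2 then 2 else 0 := by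
      decide +kernel
    have hI : ∀ i : Fin 16 × Fin 16, (isInfo i.1 && isInfo i.2) = false ∨
        reedMullerBasis i.1 i.2 = if i.1 = i.2 then 1 else 0 := by
      decide +kernel
    have hI' : ∀ i j : Fin 16, isInfo i = true → isInfo j = true →
        reedMullerBasis i j = if i = j then 1 else 0 := fun i j hi hj =>
      (hI (i, j)).resolve_left (by simp [hi, hj])
    have hc : ∀ j, z j 0 = ∑ i, (if isInfo i then z i 0 else t i) * reedMullerBasis i j := fun j => by
      have h1 : ∀ i, (if isInfo i then z i 0 else t i) * reedMullerBasis i j =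
          (if isInfo i then z i 0 * reedMullerBasis i j else 0) +
            if i = j then (if isInfo i then 0 else t i * 2) else 0 := fun i => by
        by_cases hi : isInfo i
        · simp [hi]
        · rw [(hH (i, j)).resolve_left hi]
          simp [hi]
      simp only [h1, Finset.sum_add_distrib, Finset.sum_ite_eq', Finset.mem_univ, if_true]
      have h2 := ht j
      by_cases hj : isInfo j
      · have h3 : (∑ i, if isInfo i then z i 0 * reedMullerBasis i j else 0) = z j 0 := by
          rw [Finset.sum_eq_single j]
          · rw [if_pos hj, hI' j j hj hj, if_pos rfl, mul_one]
          · intro i _ hij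
            by_cases hi : isInfo i
            · rw [if_pos hi, hI' i j hi hj, if_neg hij, mul_zero]
            · rw [if_neg hi]
          · simp
        rw [h3, if_pos hj, add_zero]
      · rw [if_neg hj]; omega
    refine ⟨fun i : Fin 16 => if isInfo i then z i 0 else t i, fun i k => ?_⟩
    have h0 := hz.1 i
    rw [Fin.sum_univ_two] at h0
    have h1 := hc i
    fin_cases k
    · exact h1
    · change z i 1 = ∑ j, (if isInfo j then z j 0 else t j) * -reedMullerBasis j i
      simp only [mul_neg, Finset.sum_neg_distrib]
      rw [← h1]; omega
  · decide +kernel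
  · decide +kernel
  · ext i j; revert i j; decide +kernel
  · decide +kernel
  · have h : (2 : ℤ) • binaryGram = reedMullerBasis * reedMullerBasisᵀ := by
      ext i j; revert i j; decide +kernel
    have h1 := congrArg det h
    have h2 : ∀ i : Fin 16 × Fin 16, i.1 ≤ i.2 ∨ reedMullerBasis i.1 i.2 = 0 := by decide +kernel
    have h3 : ∏ i, reedMullerBasis i i = 2 ^ 11 := by decide +kernel
    rw [det_smul, det_mul, det_transpose, Fintype.card_fin,
      det_of_isUpperTriangular (M := reedMullerBasis)
        (fun i j h => (h2 (i, j)).resolve_left (not_le.2 h)), h3] at h1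
    have h4 : binaryGram.det = 2 ^ 6 := by omega
    exact (congrArg (· * (2 : ℤ) ^ 2) h4).trans (by norm_num)


theorem blL_comm (p r : ℕ) (v w : GVec p r × ℤ × ℤ) : blL p r v w = blL p r w v := by
  rw [blL, blL]
  congr 1
  · exact Finset.sum_congr rfl fun i _ => Finset.sum_congr rfl fun k _ => mul_comm _ _
  · ring

theorem blL_sum_right (p r : ℕ) {ι : Type*} (s : Finset ι) (v : GVec p r × ℤ × ℤ) (c : ι → ℤ)
    (g : ι → GVec p r × ℤ × ℤ) :
    blL p r v (∑ i ∈ s, c i • g i) = ∑ i ∈ s, (c i : ℚ) * blL p r v (g i) := by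
  let f : GVec p r × ℤ × ℤ →ₗ[ℤ] ℚ :=
    { toFun := blL p r v
      map_add' := fun x y => by
        simp only [blL, Prod.fst_add, Prod.snd_add, Pi.add_apply, mul_add, Finset.sum_add_distrib]
        push_cast; ring
      map_smul' := fun c x => by
        simp only [blL, Prod.smul_fst, Prod.smul_snd, Pi.smul_apply, smul_eq_mul,
          RingHom.id_apply, smul_add, Finset.smul_sum]
        push_cast
        congr 1
        · exact Finset.sum_congr rfl fun i _ => Finset.sum_congr rfl fun k _ => by
            rw [zsmul_eq_mul, zsmul_eq_mul]; ring
        · rw [zsmul_eq_mul]; ring }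
  have h := map_sum f (fun i => c i • g i) s
  simp only [map_smul] at h
  exact h.trans (Finset.sum_congr rfl fun i _ => zsmul_eq_mul _ _)

theorem blL_sum_sum (p r : ℕ) {ι : Type*} [Fintype ι] {g : ι → GVec p r × ℤ × ℤ}
    {Q : Matrix ι ι ℤ} (hQ : ∀ i j, (Q i j : ℚ) = blL p r (g i) (g j)) (a b : ι → ℤ) :
    blL p r (∑ i, a i • g i) (∑ j, b j • g j) = ((a ⬝ᵥ Q *ᵥ b : ℤ) : ℚ) := by
  rw [blL_sum_right]
  simp_rw [blL_comm p r (∑ i, a i • g i), blL_sum_right, ← hQ, dotProduct, mulVec, dotProduct]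
  push_cast
  simp_rw [Finset.mul_sum]
  rw [Finset.sum_comm]
  refine Finset.sum_congr rfl fun i _ => Finset.sum_congr rfl fun j _ => ?_
  have : (Q j i : ℚ) = Q i j := by rw [hQ, hQ, blL_comm]
  rw [this]; ring

theorem MemLvec.sum {p r : ℕ} [NeZero p] {ι : Type*} [Fintype ι] {g : ι → GVec p r × ℤ × ℤ}
    (h : ∀ i, MemLvec p r (g i)) (c : ι → ℤ) : MemLvec p r (∑ i, c i • g i) := by
  choose z hz hz' using fun i => exists_scaled (h i)
  refine memGluePerp_of_scaled (z := fun a k => ∑ i, c i * z i a k) (fun a k => ?_)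
    ⟨fun a => ?_, fun a k => ?_, fun g' hg => ?_⟩
  · rw [Prod.fst_sum, Finset.sum_apply, Finset.sum_apply, Finset.mul_sum]
    push_cast
    refine Finset.sum_congr rfl fun i _ => ?_
    rw [← hz, Prod.smul_fst, Pi.smul_apply, Pi.smul_apply, zsmul_eq_mul]; ring
  · rw [Finset.sum_comm]
    refine Finset.sum_eq_zero fun i _ => ?_
    rw [← Finset.mul_sum, (hz' i).1, mul_zero]
  · rw [← Finset.sum_sub_distrib]
    refine Finset.dvd_sum fun i _ => ?_
    rw [← mul_sub]
    exact ((hz' i).2.1 a k).mul_left _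
  · push_cast
    simp_rw [Finset.sum_mul]
    rw [Finset.sum_comm]
    refine Finset.sum_eq_zero fun i _ => ?_
    simp_rw [mul_assoc]
    rw [← Finset.mul_sum, (hz' i).2.2 g' hg, mul_zero]

/-- Two Gram matrices related by an invertible matrix belong to bases of the same lattice. -/
theorem exists_basis_change {p r n : ℕ} [NeZero p] {g : Fin n → GVec p r × ℤ × ℤ}
    {Q Q' V : Matrix (Fin n) (Fin n) ℤ} (hg : ∀ i, MemLvec p r (g i))
    (hs : ∀ v, MemLvec p r v → ∃ c : Fin n → ℤ, v = ∑ i, c i • g i)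
    (hQ : ∀ i j, (Q i j : ℚ) = blL p r (g i) (g j)) (hV : IsUnit V.det) (hVQ : Vᵀ * Q * V = Q') :
    ∃ g' : Fin n → GVec p r × ℤ × ℤ, (∀ i, MemLvec p r (g' i)) ∧
      (∀ v, MemLvec p r v → ∃ c : Fin n → ℤ, v = ∑ i, c i • g' i) ∧
      ∀ i j, (Q' i j : ℚ) = blL p r (g' i) (g' j) := by
  refine ⟨fun j => ∑ i, V i j • g i, fun j => MemLvec.sum hg _, fun v hv => ?_, fun i j => ?_⟩
  · obtain ⟨c, rfl⟩ := hs v hv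
    refine ⟨V⁻¹ *ᵥ c, ?_⟩
    have h1 : V *ᵥ (V⁻¹ *ᵥ c) = c := by rw [mulVec_mulVec, mul_nonsing_inv V hV, one_mulVec]
    simp_rw [Finset.smul_sum, smul_smul]
    rw [Finset.sum_comm]
    refine Finset.sum_congr rfl fun i _ => ?_
    rw [← Finset.sum_smul]
    have h2 : c i = ∑ j, (V⁻¹ *ᵥ c) j * V i j :=
      (congrFun h1 i).symm.trans (dotProduct_comm _ _)
    rw [← h2]
  · rw [blL_sum_sum p r hQ, ← hVQ, mul_assoc]
    rfl

theorem lorentz_main {p r m : ℕ} [NeZero p]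
    (hone : OneClass p (2 * m + 2) m)
    (hbasis : ∃ (g : Fin (2 * m + 2) → GVec p r × ℤ × ℤ)
        (Q : Matrix (Fin (2 * m + 2)) (Fin (2 * m + 2)) ℤ),
      (∀ i, MemLvec p r (g i)) ∧
      (∀ v, MemLvec p r v → ∃ c : Fin (2 * m + 2) → ℤ, v = ∑ i, c i • g i) ∧
      (∀ i j, (Q i j : ℚ) = blL p r (g i) (g j)) ∧ InGenusIIpm p m Q)
    {A : Matrix (Fin (2 * m)) (Fin (2 * m)) ℤ} (hA : InGenusIIpm p m (addHyp A !![0, 1; 1, 0])) :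
    (∀ v : GVec p r × ℤ × ℤ, MemLvec p r v → ∃ z : ℤ, blL p r v v = 2 * z) ∧
    (∃ (g : Fin (2 * m + 2) → GVec p r × ℤ × ℤ)
        (Q : Matrix (Fin (2 * m + 2)) (Fin (2 * m + 2)) ℤ),
      (∀ i, MemLvec p r (g i)) ∧
      (∀ v, MemLvec p r v → ∃ c : Fin (2 * m + 2) → ℤ, v = ∑ i, c i • g i) ∧
      (∀ i j, (Q i j : ℚ) = blL p r (g i) (g j)) ∧ InGenusIIpm p m Q) ∧
    (∀ B1 B2 : Matrix (Fin (2 * m + 2)) (Fin (2 * m + 2)) ℤ,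
      InGenusIIpm p m B1 → InGenusIIpm p m B2 →
      ∃ V : Matrix (Fin (2 * m + 2)) (Fin (2 * m + 2)) ℤ,
        IsUnit V.det ∧ Vᵀ * B1 * V = B2) ∧
    (∃ g : (Fin (2 * m) ⊕ Fin 2) → GVec p r × ℤ × ℤ,
      (∀ i, MemLvec p r (g i)) ∧
      (∀ v, MemLvec p r v → ∃ c : (Fin (2 * m) ⊕ Fin 2) → ℤ, v = ∑ i, c i • g i) ∧
      ∀ i j, blL p r (g i) (g j)
        = ((Matrix.fromBlocks A 0 0 !![0, 1; 1, 0]) i j : ℚ)) := by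
  have hclass := fun B1 B2 (h1 : InGenusIIpm p m B1) (h2 : InGenusIIpm p m B2) =>
    exists_of_inGenus (NeZero.ne p) hone h1 h2
  refine ⟨fun v hv => ?_, hbasis, hclass, ?_⟩
  · obtain ⟨g, Q, -, hs, hQ, hQs, hQe, -⟩ := hbasis
    obtain ⟨c, rfl⟩ := hs v hv
    obtain ⟨z, hz⟩ := ofMatrix_isEven hQs hQe c
    refine ⟨z, ?_⟩
    rw [blL_sum_sum p r hQ]
    rw [ofMatrix_form] at hz
    rw [hz]
    push_cast
    ring
  · obtain ⟨g, Q, hg, hs, hQ, hQG⟩ := hbasis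
    obtain ⟨V, hV, hVQ⟩ := hclass _ _ hQG hA
    obtain ⟨g', hg', hs', hQ'⟩ := exists_basis_change hg hs hQ hV hVQ
    refine ⟨fun i => g' (finSumFinEquiv i), fun i => hg' _, fun v hv => ?_, fun i j => ?_⟩
    · obtain ⟨c, hc⟩ := hs' v hv
      refine ⟨fun i => c (finSumFinEquiv i), ?_⟩
      rw [hc, Equiv.sum_comp finSumFinEquiv (fun i => c i • g' i)]
    · rw [← hQ']
      simp [addHyp]

end ILat

/-- `L = p·(N' ⊕ II_{1,1})` is an even lattice of genus
`II_{2m+1,1}(p^{+m})`, this genus contains a single class, and `L ≅ Λ_p ⊕ II_{1,1}`. -/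
theorem rescaledDual_single_class_genus
    (p q r m : ℕ) [NeZero p] (hp : p = 2 ∨ p = 3 ∨ p = 5 ∨ p = 7)
    (hq : q = p - 1) (hr : q * (p + 1) * r = 48) (hm : (p + 1) * m = 24)
    -- a model of the Leech lattice with an automorphism of cycle shape 1^m p^m,
    -- and a ℤ-basis bb of its fixpoint lattice Λ_p, with Gram matrix A
    (B : Matrix (Fin 24) (Fin 24) ℤ) (hBsymm : B.IsSymm) (hBeven : ∀ i, 2 ∣ B i i)
    (hBpos : (B.map (Int.cast : ℤ → ℚ)).PosDef) (hBdet : B.det = 1)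
    (hBnoroots : ∀ v : Fin 24 → ℤ, v ≠ 0 → v ⬝ᵥ B.mulVec v ≠ 2)
    (U : Matrix (Fin 24) (Fin 24) ℤ) (hUaut : Uᵀ * B * U = B)
    (hUcycle : U.charpoly = (X - 1) ^ m * (X ^ p - 1) ^ m)
    (bb : Fin (2 * m) → (Fin 24 → ℤ)) (hbbfix : ∀ i, U.mulVec (bb i) = bb i)
    (hbbspan : ∀ v : Fin 24 → ℤ, U.mulVec v = v →
      ∃ c : Fin (2 * m) → ℤ, v = ∑ i, c i • bb i)
    (A : Matrix (Fin (2 * m)) (Fin (2 * m)) ℤ)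
    (hA : ∀ i j, A i j = bb i ⬝ᵥ B.mulVec (bb j)) :
    -- L is even
    (∀ v : GVec p r × ℤ × ℤ, MemLvec p r v → ∃ z : ℤ, blL p r v v = 2 * z) ∧
    -- L has genus II_{2m+1,1}(p^{+m}): it admits a ℤ-basis whose Gram matrix
    -- satisfies the invariants characterizing this genus
    (∃ (g : Fin (2 * m + 2) → GVec p r × ℤ × ℤ)
        (Q : Matrix (Fin (2 * m + 2)) (Fin (2 * m + 2)) ℤ),
      (∀ i, MemLvec p r (g i)) ∧
      (∀ v, MemLvec p r v → ∃ c : Fin (2 * m + 2) → ℤ, v = ∑ i, c i • g i) ∧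
      (∀ i j, (Q i j : ℚ) = blL p r (g i) (g j)) ∧ InGenusIIpm p m Q) ∧
    -- the genus II_{2m+1,1}(p^{+m}) contains a single class
    (∀ B1 B2 : Matrix (Fin (2 * m + 2)) (Fin (2 * m + 2)) ℤ,
      InGenusIIpm p m B1 → InGenusIIpm p m B2 →
      ∃ V : Matrix (Fin (2 * m + 2)) (Fin (2 * m + 2)) ℤ,
        IsUnit V.det ∧ Vᵀ * B1 * V = B2) ∧
    -- L is isomorphic to Λ_p ⊕ II_{1,1}
    (∃ g : (Fin (2 * m) ⊕ Fin 2) → GVec p r × ℤ × ℤ,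
      (∀ i, MemLvec p r (g i)) ∧
      (∀ v, MemLvec p r v → ∃ c : (Fin (2 * m) ⊕ Fin 2) → ℤ, v = ∑ i, c i • g i) ∧
      ∀ i j, blL p r (g i) (g j)
        = ((Matrix.fromBlocks A 0 0 !![0, 1; 1, 0]) i j : ℚ)) := by
  obtain rfl | rfl | rfl | rfl := hp
  · obtain rfl : q = 1 := hq
    obtain rfl : m = 8 := by omega
    obtain rfl : r = 16 := by omega
    exact ILat.lorentz_main ILat.oneClass_two ILat.exists_basis_two
      (ILat.inGenus_fixed (by simp) hBsymm hBeven hBpos hBdet hBnoroots hUaut hUcycle hbbfix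
        hbbspan hA)
  · obtain rfl : q = 2 := hq
    obtain rfl : m = 6 := by omega
    obtain rfl : r = 6 := by omega
    exact ILat.lorentz_main ILat.oneClass_three ILat.exists_basis_three
      (ILat.inGenus_fixed (by simp) hBsymm hBeven hBpos hBdet hBnoroots hUaut hUcycle hbbfix
        hbbspan hA)
  · obtain rfl : q = 4 := hq
    obtain rfl : m = 4 := by omega
    obtain rfl : r = 2 := by omega
    exact ILat.lorentz_main ILat.oneClass_five ILat.exists_basis_five
      (ILat.inGenus_fixed (by simp) hBsymm hBeven hBpos hBdet hBnoroots hUaut hUcycle hbbfix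
        hbbspan hA)
  · obtain rfl : q = 6 := hq
    obtain rfl : m = 3 := by omega
    obtain rfl : r = 1 := by omega
    exact ILat.lorentz_main ILat.oneClass_seven ILat.exists_basis_seven
      (ILat.inGenus_fixed (by simp) hBsymm hBeven hBpos hBdet hBnoroots hUaut hUcycle hbbfix
        hbbspan hA)
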